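/- Let n ≥ 1 and let Ω = {x ∈ ℝⁿ : v·x > c} be an open half-space, where v ∈ ℝⁿ is nonzero and c ∈ ℝ. Suppose u ∈ C²(Ω) ∩ C⁰(cl Ω) satisfies the minimal surface equation ∑_{i=1}^n D_i( D_i u / √(1+|Du|²) ) = 0 at every point of Ω, and u = l on the boundary hyperplane {x : v·x = c}, where l : ℝⁿ → ℝ is an affine function. Then there exists a ∈ ℝ such that u(x) = l(x) + a·(v·x − c) for all x ∈ cl Ω. -/

import Mathlib

open Set Metric MeasureTheory
open scoped RealInnerProductSpace ENNReal

/-- The `i`-th partial derivative of `u` at `x`. -/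
noncomputable def pderiv' {n : ℕ} (u : EuclideanSpace ℝ (Fin n) → ℝ) (i : Fin n)
    (x : EuclideanSpace ℝ (Fin n)) : ℝ :=
  fderiv ℝ u x (EuclideanSpace.single i 1)

/-- The squared norm of the gradient of `u` at `x`: `|Du|² = ∑ᵢ (Dᵢu)²`. -/
noncomputable def gradSq {n : ℕ} (u : EuclideanSpace ℝ (Fin n) → ℝ)
    (x : EuclideanSpace ℝ (Fin n)) : ℝ :=
  ∑ i, (pderiv' u i x) ^ 2

/-- `u` satisfies the minimal surface equation
`∑ᵢ Dᵢ( Dᵢu / √(1+|Du|²) ) = 0` at every point of `Ω`. -/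
def MinimalSurfaceEq {n : ℕ} (u : EuclideanSpace ℝ (Fin n) → ℝ)
    (Ω : Set (EuclideanSpace ℝ (Fin n))) : Prop :=
  ∀ x ∈ Ω,
    ∑ i, pderiv' (fun y => pderiv' u i y / Real.sqrt (1 + gradSq u y)) i x = 0

namespace Bern
open Filter Topology InnerProductSpace

abbrev Eu (n : ℕ) := EuclideanSpace ℝ (Fin n)

/-- test functions: `C¹` on `Ω`, vanishing off a compact subset -/
structure TF {n : ℕ} (Ω : Set (Eu n)) (φ : Eu n → ℝ) : Prop where
  smooth : ContDiffOn ℝ 1 φ Ω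
  supp : ∃ K, IsCompact K ∧ K ⊆ Ω ∧ ∀ x ∈ Ω, x ∉ K → φ x = 0

variable {n : ℕ} {Ω : Set (Eu n)}

lemma cdiff_hasFDerivAt (hΩ : IsOpen Ω) {φ : Eu n → ℝ} (h : ContDiffOn ℝ 1 φ Ω) {x : Eu n}
    (hx : x ∈ Ω) : HasFDerivAt φ (fderiv ℝ φ x) x :=
  ((h.differentiableOn (by norm_num)) x hx |>.differentiableAt (hΩ.mem_nhds hx)).hasFDerivAt

lemma cdiff_contFDeriv (hΩ : IsOpen Ω) {φ : Eu n → ℝ} (h : ContDiffOn ℝ 1 φ Ω) :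
    ContinuousOn (fun x => fderiv ℝ φ x) Ω :=
  h.continuousOn_fderiv_of_isOpen hΩ le_rfl

lemma TF.mul {φ ψ : Eu n → ℝ} (h : TF Ω φ) (hψ : ContDiffOn ℝ 1 ψ Ω) :
    TF Ω (fun x => ψ x * φ x) := by
  obtain ⟨K, hK, hKΩ, h0⟩ := h.supp
  exact ⟨hψ.mul h.smooth, K, hK, hKΩ, fun x hx hxK => by simp [h0 x hx hxK]⟩

lemma fderiv_zero_off (hΩ : IsOpen Ω) {φ : Eu n → ℝ} {K : Set (Eu n)} (hK : IsCompact K)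
    (h0 : ∀ x ∈ Ω, x ∉ K → φ x = 0) : ∀ x ∈ Ω, x ∉ K → fderiv ℝ φ x = 0 := by
  intro x hx hxK
  have : φ =ᶠ[𝓝 x] fun _ => 0 := by
    filter_upwards [(hΩ.inter hK.isClosed.isOpen_compl).mem_nhds ⟨hx, hxK⟩] with y hy
    exact h0 y hy.1 hy.2
  rw [this.fderiv_eq]; simp

lemma integrableOn_of_supp (hΩ : IsOpen Ω) {f : Eu n → ℝ} (hf : ContinuousOn f Ω)
    {K : Set (Eu n)} (hK : IsCompact K) (hKΩ : K ⊆ Ω)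
    (h0 : ∀ x ∈ Ω, x ∉ K → f x = 0) : IntegrableOn f Ω := by
  have h1 : IntegrableOn f K := (hf.mono hKΩ).integrableOn_compact hK
  have h2 : IntegrableOn f (Ω \ K) :=
    (integrableOn_zero (ε' := ℝ)).congr_fun (fun x hx => (h0 x hx.1 hx.2).symm)
      (hΩ.measurableSet.diff hK.measurableSet)
  have := h1.union h2
  rwa [union_sdiff_cancel hKΩ] at this

lemma TF.integral_fderiv (hΩ : IsOpen Ω) {φ : Eu n → ℝ} (h : TF Ω φ) (a : Eu n) :
    ∫ x in Ω, fderiv ℝ φ x a = 0 := by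
  obtain ⟨K, hK, hKΩ, h0⟩ := h.supp
  set g := Ω.indicator φ with hg
  have e1 : ∀ x ∈ Ω, g =ᶠ[𝓝 x] φ := fun x hx => by
    filter_upwards [hΩ.mem_nhds hx] with y hy
    simp [hg, hy]
  have e2 : ∀ x ∉ Ω, g =ᶠ[𝓝 x] fun _ => 0 := fun x hx => by
    filter_upwards [hK.isClosed.isOpen_compl.mem_nhds (fun h => hx (hKΩ h))] with y hy
    by_cases hyΩ : y ∈ Ω
    · simp [hg, hyΩ, h0 y hyΩ hy]
    · simp [hg, hyΩ]
  have hfd : (fun x => fderiv ℝ g x a) = Ω.indicator (fun x => fderiv ℝ φ x a) := by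
    ext x
    by_cases hx : x ∈ Ω
    · simp [hx, (e1 x hx).fderiv_eq]
    · simp [hx, (e2 x hx).fderiv_eq]
  have hdiff : Differentiable ℝ g := fun x => by
    by_cases hx : x ∈ Ω
    · exact ((e1 x hx).differentiableAt_iff).2 (cdiff_hasFDerivAt hΩ h.smooth hx).differentiableAt
    · exact ((e2 x hx).differentiableAt_iff).2 (differentiableAt_const _)
  have i1 : Integrable g :=
    (integrableOn_of_supp hΩ h.smooth.continuousOn hK hKΩ h0).integrable_indicator hΩ.measurableSet
  have i2 : Integrable (fun x => fderiv ℝ g x a) := by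
    rw [hfd]
    refine (integrableOn_of_supp hΩ ?_ hK hKΩ ?_).integrable_indicator hΩ.measurableSet
    · exact (cdiff_contFDeriv hΩ h.smooth).clm_apply continuousOn_const
    · intro x hx hxK; rw [fderiv_zero_off hΩ hK h0 x hx hxK]; simp
  have := integral_mul_fderiv_eq_neg_fderiv_mul_of_integrable (μ := volume) (f := fun _ : Eu n => (1:ℝ))
    (g := g) (v := a) (by simp) (by simpa using i2) (by simpa using i1) (by simp)
    (fun x _ => hdiff x)
  rw [← integral_indicator hΩ.measurableSet, ← hfd]
  simpa using this

lemma TF.integrable_fderiv (hΩ : IsOpen Ω) {φ : Eu n → ℝ} (h : TF Ω φ) {a : Eu n → Eu n}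
    (ha : ContinuousOn a Ω) {k : Eu n → ℝ} (hk : ContinuousOn k Ω) :
    IntegrableOn (fun x => k x * fderiv ℝ φ x (a x)) Ω := by
  obtain ⟨K, hK, hKΩ, h0⟩ := h.supp
  refine integrableOn_of_supp hΩ ?_ hK hKΩ ?_
  · exact hk.mul ((cdiff_contFDeriv hΩ h.smooth).clm_apply ha)
  · intro x hx hxK; rw [fderiv_zero_off hΩ hK h0 x hx hxK]; simp

lemma TF.integrable_mul (hΩ : IsOpen Ω) {φ : Eu n → ℝ} (h : TF Ω φ)
    {k : Eu n → ℝ} (hk : ContinuousOn k Ω) :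
    IntegrableOn (fun x => k x * φ x) Ω := by
  obtain ⟨K, hK, hKΩ, h0⟩ := h.supp
  refine integrableOn_of_supp hΩ (hk.mul h.smooth.continuousOn) hK hKΩ ?_
  intro x hx hxK; simp [h0 x hx hxK]

/-- gradient as a vector -/
noncomputable def Dg (u : Eu n → ℝ) (x : Eu n) : Eu n := gradient u x
noncomputable def Wg (u : Eu n → ℝ) (x : Eu n) : ℝ := √(1 + ‖Dg u x‖ ^ 2)

lemma inner_Dg (u : Eu n → ℝ) (x a : Eu n) : ⟪Dg u x, a⟫ = fderiv ℝ u x a := by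
  rw [Dg, ← toDual_gradient]; rfl

lemma Wg_pos (u : Eu n → ℝ) (x : Eu n) : 0 < Wg u x := by unfold Wg; positivity
lemma one_le_Wg (u : Eu n → ℝ) (x : Eu n) : 1 ≤ Wg u x := by
  unfold Wg; rw [Real.one_le_sqrt]; nlinarith [sq_nonneg ‖Dg u x‖]
lemma Wg_sq (u : Eu n → ℝ) (x : Eu n) : Wg u x ^ 2 = 1 + ‖Dg u x‖ ^ 2 := by
  unfold Wg; rw [Real.sq_sqrt]; positivity

lemma cont_Dg (hΩ : IsOpen Ω) {u : Eu n → ℝ} (hu : ContDiffOn ℝ 1 u Ω) : ContinuousOn (Dg u) Ω :=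
  (toDual ℝ (Eu n)).symm.continuous.comp_continuousOn (cdiff_contFDeriv hΩ hu)

lemma cont_Wg (hΩ : IsOpen Ω) {u : Eu n → ℝ} (hu : ContDiffOn ℝ 1 u Ω) : ContinuousOn (Wg u) Ω := by
  unfold Wg
  have := cont_Dg hΩ hu
  fun_prop

lemma smooth_Dg (hΩ : IsOpen Ω) {u : Eu n → ℝ} (hu : ContDiffOn ℝ 2 u Ω) :
    ContDiffOn ℝ 1 (Dg u) Ω :=
  ((toDual ℝ (Eu n)).symm.toContinuousLinearEquiv.contDiff).comp_contDiffOn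
    (hu.fderiv_of_isOpen hΩ (by norm_num))

lemma smooth_Wg (hΩ : IsOpen Ω) {u : Eu n → ℝ} (hu : ContDiffOn ℝ 2 u Ω) :
    ContDiffOn ℝ 1 (Wg u) Ω := by
  unfold Wg
  refine ContDiffOn.sqrt (contDiffOn_const.add ((smooth_Dg hΩ hu).norm_sq ℝ)) ?_
  intro x _; positivity

/-- `C²` solution in divergence form, coordinate version -/
def DivFree (u : Eu n → ℝ) (Ω : Set (Eu n)) : Prop :=
  ∀ x ∈ Ω, ∑ i, fderiv ℝ (fun y => ⟪Dg u y, EuclideanSpace.single i 1⟫ / Wg u y) x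
    (EuclideanSpace.single i 1) = 0

lemma single_sum (x : Eu n) : ∑ i, x i • (EuclideanSpace.single i (1:ℝ) : Eu n) = x := by
  have := (EuclideanSpace.basisFun (Fin n) ℝ).sum_repr x
  simpa using this

lemma gradSq_eq (u : Eu n → ℝ) (x : Eu n) : gradSq u x = ‖Dg u x‖ ^ 2 := by
  rw [gradSq, EuclideanSpace.norm_sq_eq]
  refine Finset.sum_congr rfl fun i _ => ?_
  rw [pderiv', ← inner_Dg]; simp [EuclideanSpace.inner_single_right]

lemma divFree_of_mse {u : Eu n → ℝ} (h : MinimalSurfaceEq u Ω) : DivFree u Ω := by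
  intro x hx
  have := h x hx
  simp only [pderiv', gradSq_eq] at this
  simpa only [inner_Dg, Wg] using this

lemma H0 (hΩ : IsOpen Ω) {u : Eu n → ℝ} (hu : ContDiffOn ℝ 2 u Ω) (hd : DivFree u Ω)
    {ψ : Eu n → ℝ} (hψ : TF Ω ψ) : ∫ x in Ω, (Wg u x)⁻¹ * fderiv ℝ ψ x (Dg u x) = 0 := by
  set E : Fin n → Eu n := fun i => EuclideanSpace.single i 1 with hE
  set T : Fin n → Eu n → ℝ := fun i y => ⟪Dg u y, E i⟫ / Wg u y with hT
  have hTs : ∀ i, ContDiffOn ℝ 1 (T i) Ω := fun i =>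
    ((smooth_Dg hΩ hu).inner ℝ contDiffOn_const).div (smooth_Wg hΩ hu) fun x _ => (Wg_pos u x).ne'
  have key : ∀ x ∈ Ω, (Wg u x)⁻¹ * fderiv ℝ ψ x (Dg u x) =
      ∑ i, fderiv ℝ (fun y => T i y * ψ y) x (E i) := by
    intro x hx
    have h1 : ∀ i, fderiv ℝ (fun y => T i y * ψ y) x (E i) =
        T i x * fderiv ℝ ψ x (E i) + ψ x * fderiv ℝ (T i) x (E i) := fun i => by
      have := ((cdiff_hasFDerivAt hΩ (hTs i) hx).mul (cdiff_hasFDerivAt hΩ hψ.smooth hx)).fderiv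
      change fderiv ℝ (T i * ψ) x (E i) = _
      rw [this]; simp
    simp only [h1, Finset.sum_add_distrib, ← Finset.mul_sum]
    have h2 := hd x hx
    change ∑ i, fderiv ℝ (T i) x (E i) = 0 at h2
    rw [h2, mul_zero, add_zero]
    conv_lhs => rw [← single_sum (Dg u x)]
    simp only [map_sum, Finset.mul_sum, hT, hE, map_smul, smul_eq_mul]
    refine Finset.sum_congr rfl fun i _ => ?_
    rw [EuclideanSpace.inner_single_right]
    simp; ring
  rw [setIntegral_congr_fun hΩ.measurableSet key, integral_finsetSum]
  · exact Finset.sum_eq_zero fun i _ => (hψ.mul (hTs i)).integral_fderiv hΩ (E i)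
  · intro i _
    simpa [IntegrableOn] using (hψ.mul (hTs i)).integrable_fderiv hΩ (a := fun _ => E i) continuousOn_const
      (k := fun _ => 1) continuousOn_const

/-- The bracket. -/
noncomputable def Br (u : Eu n → ℝ) (a : Eu n) (t : ℝ) (L : Eu n →L[ℝ] ℝ) (x : Eu n) : ℝ :=
  Wg u x * L a + (t - ⟪a, Dg u x⟫) * (Wg u x)⁻¹ * L (Dg u x)

lemma HH (hΩ : IsOpen Ω) {u : Eu n → ℝ} (hu : ContDiffOn ℝ 2 u Ω) (hd : DivFree u Ω)
    (a : Eu n) (t : ℝ) {φ : Eu n → ℝ} (hφ : TF Ω φ) :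
    IntegrableOn (fun x => Br u a t (fderiv ℝ φ x) x) Ω ∧
    ∫ x in Ω, Br u a t (fderiv ℝ φ x) x = 0 := by
  have hu1 : ContDiffOn ℝ 1 u Ω := hu.of_le (by norm_num)
  have hWi : ContinuousOn (fun x => (Wg u x)⁻¹) Ω :=
    (cont_Wg hΩ hu1).inv₀ fun x _ => (Wg_pos u x).ne'
  have hDa : ContDiffOn ℝ 1 (fun x => ⟪a, Dg u x⟫) Ω := contDiffOn_const.inner ℝ (smooth_Dg hΩ hu)
  have i1 : IntegrableOn (fun x => Wg u x * fderiv ℝ φ x a) Ω :=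
    hφ.integrable_fderiv hΩ (a := fun _ => a) continuousOn_const (cont_Wg hΩ hu1)
  have i2 : IntegrableOn (fun x => (t - ⟪a, Dg u x⟫) * (Wg u x)⁻¹ * fderiv ℝ φ x (Dg u x)) Ω :=
    hφ.integrable_fderiv hΩ (cont_Dg hΩ hu1)
      ((continuousOn_const.sub hDa.continuousOn).mul hWi)
  refine ⟨i1.add i2, ?_⟩
  have t1 := H0 hΩ hu hd hφ
  have hφ2 := hφ.mul hDa
  have t2 := H0 hΩ hu hd hφ2
  have hφ3 := hφ.mul (smooth_Wg hΩ hu)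
  have t3 := hφ3.integral_fderiv hΩ a
  have key : ∀ x ∈ Ω, Br u a t (fderiv ℝ φ x) x =
      (t * ((Wg u x)⁻¹ * fderiv ℝ φ x (Dg u x)) + fderiv ℝ (fun y => Wg u y * φ y) x a)
      - (Wg u x)⁻¹ * fderiv ℝ (fun y => ⟪a, Dg u y⟫ * φ y) x (Dg u x) := by
    intro x hx
    have d1 : fderiv ℝ (fun y => Wg u y * φ y) x a = Wg u x * fderiv ℝ φ x a
        + φ x * fderiv ℝ (Wg u) x a := by
      have := ((cdiff_hasFDerivAt hΩ (smooth_Wg hΩ hu) hx).mul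
        (cdiff_hasFDerivAt hΩ hφ.smooth hx)).fderiv
      change fderiv ℝ (Wg u * φ) x a = _
      rw [this]; simp
    have hDd : DifferentiableAt ℝ (Dg u) x :=
      ((smooth_Dg hΩ hu).differentiableOn (by norm_num) x hx).differentiableAt (hΩ.mem_nhds hx)
    set D' := fderiv ℝ (Dg u) x with hD'
    have d2 : fderiv ℝ (fun y => ⟪a, Dg u y⟫ * φ y) x (Dg u x) =
        ⟪a, Dg u x⟫ * fderiv ℝ φ x (Dg u x) + φ x * ⟪a, D' (Dg u x)⟫ := by
      have h0 : HasFDerivAt (fun y => ⟪a, Dg u y⟫) ((innerSL ℝ a).comp D') x :=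
        (innerSL ℝ a).hasFDerivAt.comp x hDd.hasFDerivAt
      have := (h0.mul (cdiff_hasFDerivAt hΩ hφ.smooth hx)).fderiv
      change fderiv ℝ ((fun y => ⟪a, Dg u y⟫) * φ) x (Dg u x) = _
      rw [this]; simp
    have d3 : fderiv ℝ (Wg u) x a = (Wg u x)⁻¹ * ⟪Dg u x, D' a⟫ := by
      have h0 : HasFDerivAt (fun y => 1 + ‖Dg u y‖ ^ 2) (2 • (innerSL ℝ (Dg u x)).comp D') x :=
        (hDd.hasFDerivAt.norm_sq).const_add 1
      have h1 := (h0.sqrt (by positivity)).fderiv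
      change fderiv ℝ (fun y => √(1 + ‖Dg u y‖ ^ 2)) x a = _
      rw [h1]
      simp [Wg]; ring
    have sym : ⟪a, D' (Dg u x)⟫ = ⟪Dg u x, D' a⟫ := by
      have hs : IsSymmSndFDerivAt ℝ u x :=
        (hu.contDiffAt (hΩ.mem_nhds hx)).isSymmSndFDerivAt (by simp)
      have hh : ∀ b c : Eu n, ⟪D' b, c⟫ = fderiv ℝ (fderiv ℝ u) x b c := by
        intro b c
        have h1 : HasFDerivAt (fun y => ⟪c, Dg u y⟫) ((innerSL ℝ c).comp D') x :=
          (innerSL ℝ c).hasFDerivAt.comp x hDd.hasFDerivAt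
        have h2 : HasFDerivAt (fun y => fderiv ℝ u y c)
            ((ContinuousLinearMap.apply ℝ ℝ c).comp (fderiv ℝ (fderiv ℝ u) x)) x := by
          refine (ContinuousLinearMap.apply ℝ ℝ c).hasFDerivAt.comp x ?_
          exact ((hu.fderiv_of_isOpen hΩ (m := 1) (by norm_num)).differentiableOn (by norm_num) x hx
            |>.differentiableAt (hΩ.mem_nhds hx)).hasFDerivAt
        have h3 : (fun y => ⟪c, Dg u y⟫) = fun y => fderiv ℝ u y c := by
          ext y; rw [real_inner_comm, inner_Dg]
        rw [h3] at h1
        have h4 := congrArg (fun L => L b) (h1.unique h2)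
        rw [real_inner_comm]
        simpa using h4
      rw [real_inner_comm, hh, real_inner_comm, hh]
      exact hs.eq _ _
    rw [d1, d2, d3, sym, Br]
    have := (Wg_pos u x).ne'
    ring
  rw [setIntegral_congr_fun hΩ.measurableSet key, integral_sub, integral_add, integral_const_mul,
    t1, t2, t3]
  · simp
  · exact ((hφ.integrable_fderiv hΩ (cont_Dg hΩ hu1) hWi).const_mul t)
  · simpa [IntegrableOn] using hφ3.integrable_fderiv hΩ (a := fun _ => a) continuousOn_const
      (k := fun _ => 1) continuousOn_const
  · refine Integrable.add ((hφ.integrable_fderiv hΩ (cont_Dg hΩ hu1) hWi).const_mul t) ?_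
    simpa [IntegrableOn] using hφ3.integrable_fderiv hΩ (a := fun _ => a) continuousOn_const
      (k := fun _ => 1) continuousOn_const
  · exact hφ2.integrable_fderiv hΩ (cont_Dg hΩ hu1) hWi

end Bern

namespace Bern
open Filter Topology InnerProductSpace
variable {n : ℕ}

def Om (e : Eu n) : Set (Eu n) := {x | 0 < ⟪e, x⟫}
lemma isOpen_Om (e : Eu n) : IsOpen (Om e) := isOpen_lt (by fun_prop) (by fun_prop)

/-- normalized data -/
structure Geo (e p : Eu n) (u : Eu n → ℝ) : Prop where
  he : ‖e‖ = 1
  hep : ⟪e, p⟫ = 0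
  C1 : ContDiffOn ℝ 1 u (Om e)
  cont : ContinuousOn u {x | 0 ≤ ⟪e, x⟫}
  bd : ∀ x, ⟪e, x⟫ = 0 → u x = ⟪p, x⟫

structure Sol (e p : Eu n) (u : Eu n → ℝ) : Prop extends Geo e p u where
  C2 : ContDiffOn ℝ 2 u (Om e)
  df : DivFree u (Om e)

noncomputable def sf (e x : Eu n) : ℝ := ⟪e, x⟫
noncomputable def qf (p : Eu n) : ℝ := √(1 + ‖p‖ ^ 2)
noncomputable def tf (p : Eu n) (u : Eu n → ℝ) (x : Eu n) : ℝ := (u x - ⟪p, x⟫) / qf p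
noncomputable def zf (u : Eu n → ℝ) (x : Eu n) : ℝ := ‖x‖ ^ 2 + u x ^ 2
noncomputable def rf (e p : Eu n) (u : Eu n → ℝ) (x : Eu n) : ℝ := √(sf e x ^ 2 + tf p u x ^ 2)
noncomputable def nE (e : Eu n) (u : Eu n → ℝ) (x : Eu n) : ℝ := -⟪e, Dg u x⟫ / Wg u x
noncomputable def nN (p : Eu n) (u : Eu n → ℝ) (x : Eu n) : ℝ := (1 + ⟪p, Dg u x⟫) / (qf p * Wg u x)
noncomputable def hf (u : Eu n → ℝ) (x : Eu n) : ℝ := (u x - ⟪x, Dg u x⟫) / Wg u x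
noncomputable def nR (e p : Eu n) (u : Eu n → ℝ) (x : Eu n) : ℝ :=
  (sf e x * nE e u x + tf p u x * nN p u x) / rf e p u x
noncomputable def nT (e p : Eu n) (u : Eu n → ℝ) (x : Eu n) : ℝ :=
  (sf e x * nN p u x - tf p u x * nE e u x) / rf e p u x
noncomputable def kp (e p : Eu n) (u : Eu n → ℝ) (x : Eu n) : ℝ := 1 - nT e p u x ^ 2

noncomputable def Ls (e : Eu n) : Eu n →L[ℝ] ℝ := innerSL ℝ e
noncomputable def Lt (p : Eu n) (u : Eu n → ℝ) (x : Eu n) : Eu n →L[ℝ] ℝ :=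
  (qf p)⁻¹ • (innerSL ℝ (Dg u x) - innerSL ℝ p)
noncomputable def Lz (u : Eu n → ℝ) (x : Eu n) : Eu n →L[ℝ] ℝ :=
  (2:ℝ) • (innerSL ℝ x + u x • innerSL ℝ (Dg u x))

lemma qf_pos (p : Eu n) : 0 < qf p := by unfold qf; positivity
lemma qf_sq (p : Eu n) : qf p ^ 2 = 1 + ‖p‖ ^ 2 := by
  unfold qf; rw [Real.sq_sqrt]; positivity
lemma one_le_qf (p : Eu n) : 1 ≤ qf p := by
  unfold qf; rw [Real.one_le_sqrt]; nlinarith [sq_nonneg ‖p‖]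

section alg
variable {e p : Eu n} {u : Eu n → ℝ}

lemma rf_sq (x : Eu n) : rf e p u x ^ 2 = sf e x ^ 2 + tf p u x ^ 2 := by
  unfold rf; rw [Real.sq_sqrt]; positivity

lemma rf_nonneg (x : Eu n) : 0 ≤ rf e p u x := Real.sqrt_nonneg _
lemma rf_pos {x : Eu n} (hx : x ∈ Om e) : 0 < rf e p u x := by
  have : 0 < sf e x := hx
  unfold rf; positivity

lemma sf_le_rf (x : Eu n) : sf e x ≤ rf e p u x :=
  Real.le_sqrt_of_sq_le (by nlinarith [sq_nonneg (tf p u x)])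

lemma nE_eq {x : Eu n} (hx : x ∈ Om e) : nE e u x =
    (sf e x * nR e p u x - tf p u x * nT e p u x) / rf e p u x := by
  have h := rf_pos (p := p) (u := u) hx
  have h2 := rf_sq (e := e) (p := p) (u := u) x
  rw [nR, nT, eq_div_iff h.ne', mul_div_assoc', mul_div_assoc', ← sub_div, eq_div_iff h.ne']
  linear_combination nE e u x * h2

lemma nN_eq {x : Eu n} (hx : x ∈ Om e) : nN p u x =
    (tf p u x * nR e p u x + sf e x * nT e p u x) / rf e p u x := by
  have h := rf_pos (p := p) (u := u) hx
  have h2 := rf_sq (e := e) (p := p) (u := u) x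
  rw [nR, nT, eq_div_iff h.ne', mul_div_assoc', mul_div_assoc', ← add_div, eq_div_iff h.ne']
  linear_combination nN p u x * h2

lemma nRT_sq {x : Eu n} (hx : x ∈ Om e) : nR e p u x ^ 2 + nT e p u x ^ 2 =
    nE e u x ^ 2 + nN p u x ^ 2 := by
  have h := rf_pos (p := p) (u := u) hx
  have h2 := rf_sq (e := e) (p := p) (u := u) x
  rw [nR, nT, div_pow, div_pow, ← add_div, div_eq_iff (by positivity), h2]
  ring

lemma Br_e (G : Geo e p u) (x : Eu n) (A B C : ℝ) :
    Br u e 0 (A • Ls e + B • Lt p u x + C • Lz u x) x =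
    Wg u x * (A * (1 - nE e u x ^ 2) - B * (nE e u x * nN p u x)
      + 2 * C * (sf e x - nE e u x * hf u x)) := by
  have hW := Wg_pos u x
  have hq := qf_pos p
  have h1 : ⟪e, e⟫ = (1:ℝ) := by rw [real_inner_self_eq_norm_sq, G.he]; norm_num
  have h2 := Wg_sq u x
  have h3 := G.hep
  simp only [Br, Ls, Lt, Lz, nE, nN, hf, sf, _root_.add_apply, _root_.sub_apply,
    _root_.smul_apply, innerSL_apply_apply, smul_eq_mul, h1, real_inner_self_eq_norm_sq,
    real_inner_comm e p, h3, real_inner_comm e (Dg u x), real_inner_comm e x]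
  have h4 : ‖Dg u x‖ ^ 2 = Wg u x ^ 2 - 1 := by linarith
  rw [h4]
  field_simp
  ring

lemma inner_N (x : Eu n) : ⟪p, x⟫ = u x - qf p * tf p u x := by
  have := qf_pos p
  unfold tf; field_simp; ring

lemma Br_N (G : Geo e p u) (x : Eu n) (A B C : ℝ) :
    Br u (-(qf p)⁻¹ • p) (qf p)⁻¹ (A • Ls e + B • Lt p u x + C • Lz u x) x =
    Wg u x * (- A * (nE e u x * nN p u x) + B * (1 - nN p u x ^ 2)
      + 2 * C * (tf p u x - nN p u x * hf u x)) := by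
  have hW := Wg_pos u x
  have hq := qf_pos p
  have h2 := Wg_sq u x
  have h3 := G.hep
  have h5 := qf_sq p
  simp only [Br, Ls, Lt, Lz, nE, nN, hf, tf, _root_.add_apply, _root_.sub_apply,
    _root_.smul_apply, innerSL_apply_apply, smul_eq_mul, real_inner_self_eq_norm_sq,
    h3, real_inner_comm p (Dg u x), real_inner_comm p x, inner_smul_left, inner_smul_right, inner_neg_left, map_neg, map_inv₀, neg_smul,
    conj_trivial]
  have h4 : ‖Dg u x‖ ^ 2 = Wg u x ^ 2 - 1 := by linarith
  have h6 : ‖p‖ ^ 2 = qf p ^ 2 - 1 := by linarith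
  rw [h4, h6]
  field_simp
  ring

end alg
end Bern

namespace Bern
open Filter Topology InnerProductSpace
variable {n : ℕ}
section alg2
variable {e p : Eu n} {u : Eu n → ℝ}

lemma Br_X (x : Eu n) (A B C : ℝ) :
    Br u x (u x) (A • Ls e + B • Lt p u x + C • Lz u x) x =
    Wg u x * (A * (sf e x - hf u x * nE e u x) + B * (tf p u x - hf u x * nN p u x)
      + 2 * C * (zf u x - hf u x ^ 2)) := by
  have hW := Wg_pos u x
  have hq := qf_pos p
  have h2 := Wg_sq u x
  simp only [Br, Ls, Lt, Lz, nE, nN, hf, sf, tf, zf, _root_.add_apply, _root_.sub_apply,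
    _root_.smul_apply, innerSL_apply_apply, smul_eq_mul, real_inner_self_eq_norm_sq,
    real_inner_comm x (Dg u x), real_inner_comm p x]
  have h4 : ‖Dg u x‖ ^ 2 = Wg u x ^ 2 - 1 := by linarith
  rw [h4]
  field_simp
  ring

lemma bessel {F : Type*} [NormedAddCommGroup F] [InnerProductSpace ℝ F] (a b v X : F)
    (ha : ⟪a, a⟫ = (1:ℝ)) (hb : ⟪b, b⟫ = (1:ℝ)) (hab : ⟪a, b⟫ = (0:ℝ)) (hv : ⟪v, v⟫ = (1:ℝ)) :
    ⟪v, a⟫ ^ 2 + ⟪v, b⟫ ^ 2 ≤ (1:ℝ) ∧ ⟪X, a⟫ ^ 2 + ⟪X, b⟫ ^ 2 ≤ ⟪X, X⟫ ∧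
    (⟪v, X⟫ - ⟪X, a⟫ * ⟪v, a⟫ - ⟪X, b⟫ * ⟪v, b⟫) ^ 2 ≤
      (⟪X, X⟫ - ⟪X, a⟫ ^ 2 - ⟪X, b⟫ ^ 2) * (1 - ⟪v, a⟫ ^ 2 - ⟪v, b⟫ ^ 2) := by
  have key : ∀ y z : F, ⟪y - ⟪y, a⟫ • a - ⟪y, b⟫ • b, z - ⟪z, a⟫ • a - ⟪z, b⟫ • b⟫ =
      ⟪y, z⟫ - ⟪y, a⟫ * ⟪z, a⟫ - ⟪y, b⟫ * ⟪z, b⟫ := by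
    intro y z
    simp only [inner_sub_left, inner_sub_right, real_inner_smul_left, real_inner_smul_right, ha, hb, hab,
      real_inner_comm a b, real_inner_comm z a, real_inner_comm z b]
    ring
  have k1 := key v v
  have k2 := key X X
  have k3 := key v X
  have p1 := real_inner_self_nonneg (x := v - ⟪v, a⟫ • a - ⟪v, b⟫ • b)
  have p2 := real_inner_self_nonneg (x := X - ⟪X, a⟫ • a - ⟪X, b⟫ • b)
  have p3 := real_inner_mul_inner_self_le (v - ⟪v, a⟫ • a - ⟪v, b⟫ • b) (X - ⟪X, a⟫ • a - ⟪X, b⟫ • b)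
  rw [k1] at p1
  rw [k2] at p2
  rw [k1, k2, k3, hv] at p3
  refine ⟨by nlinarith, by nlinarith, ?_⟩
  nlinarith

lemma bessel_graph (G : Geo e p u) (x : Eu n) :
    nE e u x ^ 2 + nN p u x ^ 2 ≤ 1 ∧ sf e x ^ 2 + tf p u x ^ 2 ≤ zf u x ∧
    (hf u x - sf e x * nE e u x - tf p u x * nN p u x) ^ 2 ≤
      (zf u x - sf e x ^ 2 - tf p u x ^ 2) * (1 - nE e u x ^ 2 - nN p u x ^ 2) := by
  have hW := Wg_pos u x
  have hq := qf_pos p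
  have h2 := Wg_sq u x
  have h5 := qf_sq p
  have h4 : ‖Dg u x‖ ^ 2 = Wg u x ^ 2 - 1 := by linarith
  have h6 : ‖p‖ ^ 2 = qf p ^ 2 - 1 := by linarith
  have := bessel (F := WithLp 2 (Eu n × ℝ)) (WithLp.toLp 2 (e, 0))
    (WithLp.toLp 2 (-(qf p)⁻¹ • p, (qf p)⁻¹)) (WithLp.toLp 2 (-(Wg u x)⁻¹ • Dg u x, (Wg u x)⁻¹))
    (WithLp.toLp 2 (x, u x)) ?_ ?_ ?_ ?_
  · simp only [WithLp.prod_inner_apply, real_inner_smul_left, real_inner_smul_right,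
      inner_zero_right, RCLike.inner_apply, conj_trivial, mul_zero, real_inner_self_eq_norm_sq] at this
    convert this using 3
    all_goals
      simp only [nE, nN, hf, sf, tf, zf, real_inner_comm e (Dg u x), real_inner_comm p (Dg u x), real_inner_comm x (Dg u x), 
        real_inner_comm x e, real_inner_comm x p]
      field_simp
      try ring
  · simp [WithLp.prod_inner_apply, G.he]
  · simp only [WithLp.prod_inner_apply, real_inner_smul_left, real_inner_smul_right,
      RCLike.inner_apply, conj_trivial, real_inner_self_eq_norm_sq, norm_smul, mul_pow, norm_neg, norm_inv, Real.norm_eq_abs, sq_abs, inv_pow, h6]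
    field_simp; ring
  · simp [WithLp.prod_inner_apply, real_inner_smul_right, G.hep]
  · simp only [WithLp.prod_inner_apply, real_inner_smul_left, real_inner_smul_right,
      RCLike.inner_apply, conj_trivial, real_inner_self_eq_norm_sq, norm_smul, mul_pow, norm_neg, norm_inv, Real.norm_eq_abs, sq_abs, inv_pow, h4]
    field_simp; ring

end alg2
end Bern

namespace Bern
open Filter Topology InnerProductSpace
variable {n : ℕ}
section ids
variable {e p : Eu n} {u : Eu n → ℝ}

lemma hfd_congr {f g : Eu n → ℝ} {L M : Eu n →L[ℝ] ℝ} {x : Eu n} (h : HasFDerivAt f L x)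
    (h1 : ∀ y, f y = g y) (h2 : ∀ y, L y = M y) : HasFDerivAt g M x := by
  obtain rfl : f = g := funext h1
  obtain rfl : L = M := ContinuousLinearMap.ext h2
  exact h

lemma hasFDerivAt_u (G : Geo e p u) {x : Eu n} (hx : x ∈ Om e) :
    HasFDerivAt u (innerSL ℝ (Dg u x)) x := by
  have := cdiff_hasFDerivAt (isOpen_Om e) G.C1 hx
  exact hfd_congr this (fun _ => rfl) fun a => by simp [inner_Dg]

lemma hasFDerivAt_sf (x : Eu n) : HasFDerivAt (sf e) (Ls e) x := (innerSL ℝ e).hasFDerivAt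

lemma hasFDerivAt_tf (G : Geo e p u) {x : Eu n} (hx : x ∈ Om e) :
    HasFDerivAt (tf p u) (Lt p u x) x := by
  have h := ((hasFDerivAt_u G hx).sub ((innerSL ℝ p).hasFDerivAt (x := x))).const_smul (qf p)⁻¹
  exact hfd_congr h (fun y => by simp [tf, div_eq_inv_mul]) fun a => rfl

lemma hasFDerivAt_zf (G : Geo e p u) {x : Eu n} (hx : x ∈ Om e) :
    HasFDerivAt (zf u) (Lz u x) x := by
  have h := ((hasFDerivAt_id x).norm_sq).add ((hasFDerivAt_u G hx).pow 2)
  exact hfd_congr h (fun y => by simp [zf]) fun a => by simp [Lz]; ring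

lemma smooth_sf (Ω : Set (Eu n)) : ContDiffOn ℝ 1 (sf e) Ω :=
  (innerSL ℝ e).contDiff.contDiffOn

lemma smooth_tf (G : Geo e p u) : ContDiffOn ℝ 1 (tf p u) (Om e) :=
  (G.C1.sub (innerSL ℝ p).contDiff.contDiffOn).div_const _

lemma smooth_zf (G : Geo e p u) : ContDiffOn ℝ 1 (zf u) (Om e) :=
  ((contDiff_norm_sq ℝ).contDiffOn).add (G.C1.pow 2)

lemma smooth_rf (G : Geo e p u) : ContDiffOn ℝ 1 (rf e p u) (Om e) := by
  refine (((smooth_sf _).pow 2).add ((smooth_tf G).pow 2)).sqrt ?_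
  intro x hx
  have : 0 < sf e x := hx
  positivity

lemma hasFDerivAt_rf (G : Geo e p u) {x : Eu n} (hx : x ∈ Om e) :
    HasFDerivAt (rf e p u) ((sf e x / rf e p u x) • Ls e + (tf p u x / rf e p u x) • Lt p u x) x := by
  have hs : 0 < sf e x := hx
  have h := (((hasFDerivAt_sf (e := e) x).pow 2).add ((hasFDerivAt_tf G hx).pow 2)).sqrt
    (by simp only [Pi.add_apply, Pi.pow_apply]; positivity)
  have hr := rf_pos (p := p) (u := u) hx
  refine hfd_congr h (fun y => rfl) fun y => ?_
  simp only [_root_.add_apply, _root_.smul_apply, smul_eq_mul, Pi.add_apply, Pi.pow_apply]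
  change 1 / (2 * rf e p u x) * _ = _
  field_simp
  simp
  ring

lemma cont_nE (G : Geo e p u) : ContinuousOn (nE e u) (Om e) :=
  (continuousOn_const.inner (𝕜 := ℝ) (cont_Dg (isOpen_Om e) G.C1)).neg.div (cont_Wg (isOpen_Om e) G.C1)
    fun x _ => (Wg_pos u x).ne'
lemma cont_nN (G : Geo e p u) : ContinuousOn (nN p u) (Om e) :=
  (continuousOn_const.add (continuousOn_const.inner (𝕜 := ℝ) (cont_Dg (isOpen_Om e) G.C1))).div
    (continuousOn_const.mul (cont_Wg (isOpen_Om e) G.C1))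
    fun x _ => (mul_pos (qf_pos p) (Wg_pos u x)).ne'
lemma cont_hf (G : Geo e p u) : ContinuousOn (hf u) (Om e) :=
  (G.C1.continuousOn.sub (continuousOn_id.inner (𝕜 := ℝ) (cont_Dg (isOpen_Om e) G.C1))).div (cont_Wg (isOpen_Om e) G.C1)
    fun x _ => (Wg_pos u x).ne'
lemma cont_nR (G : Geo e p u) : ContinuousOn (nR e p u) (Om e) :=
  (((smooth_sf _).continuousOn.mul (cont_nE G)).add ((smooth_tf G).continuousOn.mul (cont_nN G))).div
    (smooth_rf G).continuousOn fun x hx => (rf_pos hx).ne'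
lemma cont_nT (G : Geo e p u) : ContinuousOn (nT e p u) (Om e) :=
  (((smooth_sf _).continuousOn.mul (cont_nN G)).sub ((smooth_tf G).continuousOn.mul (cont_nE G))).div
    (smooth_rf G).continuousOn fun x hx => (rf_pos hx).ne'
lemma cont_kp (G : Geo e p u) : ContinuousOn (kp e p u) (Om e) :=
  continuousOn_const.sub ((cont_nT G).pow 2)

lemma id_e (S : Sol e p u) {φ : Eu n → ℝ} (hφ : TF (Om e) φ) (A B C : Eu n → ℝ)
    (hd : ∀ x ∈ Om e, HasFDerivAt φ (A x • Ls e + B x • Lt p u x + C x • Lz u x) x) :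
    IntegrableOn (fun x => Wg u x * (A x * (1 - nE e u x ^ 2) - B x * (nE e u x * nN p u x)
      + 2 * C x * (sf e x - nE e u x * hf u x))) (Om e) ∧
    ∫ x in Om e, Wg u x * (A x * (1 - nE e u x ^ 2) - B x * (nE e u x * nN p u x)
      + 2 * C x * (sf e x - nE e u x * hf u x)) = 0 := by
  have h := HH (isOpen_Om e) S.C2 S.df e 0 hφ
  have key : EqOn (fun x => Br u e 0 (fderiv ℝ φ x) x) (fun x => Wg u x * (A x * (1 - nE e u x ^ 2) - B x * (nE e u x * nN p u x)
      + 2 * C x * (sf e x - nE e u x * hf u x))) (Om e) := by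
    intro x hx
    simp only
    rw [(hd x hx).fderiv, Br_e S.toGeo]
  have hm := (isOpen_Om e).measurableSet
  exact ⟨h.1.congr_fun key hm, by rw [← setIntegral_congr_fun hm key]; exact h.2⟩

lemma id_N (S : Sol e p u) {φ : Eu n → ℝ} (hφ : TF (Om e) φ) (A B C : Eu n → ℝ)
    (hd : ∀ x ∈ Om e, HasFDerivAt φ (A x • Ls e + B x • Lt p u x + C x • Lz u x) x) :
    IntegrableOn (fun x => Wg u x * (- A x * (nE e u x * nN p u x) + B x * (1 - nN p u x ^ 2)
      + 2 * C x * (tf p u x - nN p u x * hf u x))) (Om e) ∧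
    ∫ x in Om e, Wg u x * (- A x * (nE e u x * nN p u x) + B x * (1 - nN p u x ^ 2)
      + 2 * C x * (tf p u x - nN p u x * hf u x)) = 0 := by
  have h := HH (isOpen_Om e) S.C2 S.df (-(qf p)⁻¹ • p) (qf p)⁻¹ hφ
  have key : EqOn (fun x => Br u (-(qf p)⁻¹ • p) (qf p)⁻¹ (fderiv ℝ φ x) x) (fun x => Wg u x * (- A x * (nE e u x * nN p u x) + B x * (1 - nN p u x ^ 2)
      + 2 * C x * (tf p u x - nN p u x * hf u x))) (Om e) := by
    intro x hx
    simp only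
    rw [(hd x hx).fderiv, Br_N S.toGeo]
  have hm := (isOpen_Om e).measurableSet
  exact ⟨h.1.congr_fun key hm, by rw [← setIntegral_congr_fun hm key]; exact h.2⟩

lemma id_X (S : Sol e p u) {φ : Eu n → ℝ} (hφ : TF (Om e) φ) (A B C : Eu n → ℝ)
    (hd : ∀ x ∈ Om e, HasFDerivAt φ (A x • Ls e + B x • Lt p u x + C x • Lz u x) x) :
    ∫ x in Om e, Wg u x * (n * φ x + A x * (sf e x - hf u x * nE e u x)
      + B x * (tf p u x - hf u x * nN p u x) + 2 * C x * (zf u x - hf u x ^ 2)) = 0 := by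
  set E : Fin n → Eu n := fun i => EuclideanSpace.single i 1 with hE
  have hm := (isOpen_Om e).measurableSet
  have hpr : ∀ i, ContDiffOn ℝ 1 (fun x : Eu n => x i) (Om e) := fun i =>
    (EuclideanSpace.proj (𝕜 := ℝ) i).contDiff.contDiffOn
  have h1 := fun i => HH (isOpen_Om e) S.C2 S.df (E i) 0 (hφ.mul (hpr i))
  have h2 := HH (isOpen_Om e) S.C2 S.df 0 1 (hφ.mul S.C1)
  have key : EqOn (fun x => Wg u x * (n * φ x + A x * (sf e x - hf u x * nE e u x)
      + B x * (tf p u x - hf u x * nN p u x) + 2 * C x * (zf u x - hf u x ^ 2)))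
      (fun x => (∑ i, Br u (E i) 0 (fderiv ℝ (fun y => y i * φ y) x) x)
        + Br u 0 1 (fderiv ℝ (fun y => u y * φ y) x) x) (Om e) := by
    intro x hx
    simp only
    have hX := Br_X (e := e) (p := p) (u := u) x (A x) (B x) (C x)
    rw [← (hd x hx).fderiv] at hX
    have d := cdiff_hasFDerivAt (isOpen_Om e) hφ.smooth hx
    have f1 : ∀ i, fderiv ℝ (fun y => y i * φ y) x =
        x i • fderiv ℝ φ x + φ x • (EuclideanSpace.proj (𝕜 := ℝ) i : Eu n →L[ℝ] ℝ) := fun i =>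
      ((EuclideanSpace.proj (𝕜 := ℝ) i : Eu n →L[ℝ] ℝ).hasFDerivAt.mul d).fderiv
    have f2 : fderiv ℝ (fun y => u y * φ y) x = u x • fderiv ℝ φ x + φ x • innerSL ℝ (Dg u x) :=
      ((hasFDerivAt_u S.toGeo hx).mul d).fderiv
    have f3 : fderiv ℝ φ x x = ∑ i, x i * fderiv ℝ φ x (E i) := by
      conv_lhs => arg 2; rw [← single_sum x]
      simp only [map_sum, hE, map_smul, smul_eq_mul]
    have f4 : ⟪x, Dg u x⟫ = ∑ i, x i * Dg u x i := by
      simp [PiLp.inner_apply, mul_comm]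
    have f5 : ‖Dg u x‖ ^ 2 = ∑ i, Dg u x i * Dg u x i := by
      rw [EuclideanSpace.norm_sq_eq]; simp [sq]
    have hW := (Wg_pos u x)
    have : ∑ i, Br u (E i) 0 (fderiv ℝ (fun y => y i * φ y) x) x = 
       n * (Wg u x * φ x) + Wg u x * fderiv ℝ φ x x - ⟪x, Dg u x⟫ * (Wg u x)⁻¹ * fderiv ℝ φ x (Dg u x)
       - ‖Dg u x‖ ^ 2 * (Wg u x)⁻¹ * φ x := by
      rw [f3, f4, f5]
      simp only [Finset.mul_sum, Finset.sum_mul]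
      have hn : (n:ℝ) * (Wg u x * φ x) = ∑ i : Fin n, Wg u x * φ x := by simp
      rw [hn, ← Finset.sum_add_distrib, ← Finset.sum_sub_distrib, ← Finset.sum_sub_distrib]
      refine Finset.sum_congr rfl fun i _ => ?_
      rw [f1, Br]
      simp [hE, EuclideanSpace.inner_single_left]
      ring
    rw [this, f2]
    simp only [Br, _root_.add_apply, _root_.smul_apply, smul_eq_mul, innerSL_apply_apply,
      inner_zero_left, map_zero, real_inner_self_eq_norm_sq] at hX ⊢
    linear_combination -hX
  rw [setIntegral_congr_fun hm key, integral_add, integral_finsetSum, h2.2, add_zero]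
  · exact Finset.sum_eq_zero fun i _ => (h1 i).2
  · exact fun i _ => (h1 i).1
  · exact integrable_finsetSum _ fun i _ => (h1 i).1
  · exact h2.1

end ids
end Bern

namespace Bern
open Filter Topology InnerProductSpace
variable {n : ℕ}

noncomputable def mf (z : ℝ) : ℝ := (max 0 z) ^ 2

lemma hasDerivAt_mf (z : ℝ) : HasDerivAt mf (2 * max 0 z) z := by
  rcases lt_trichotomy z 0 with h | h | h
  · have e1 : mf =ᶠ[𝓝 z] fun _ => 0 := by
      filter_upwards [Iio_mem_nhds h] with y hy
      simp [mf, max_eq_left (le_of_lt (mem_Iio.1 hy))]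
    rw [max_eq_left h.le, mul_zero]
    exact (hasDerivAt_const z (0:ℝ)).congr_of_eventuallyEq e1
  · subst h
    have : HasDerivAt mf 0 0 := by
      rw [hasDerivAt_iff_isLittleO_nhds_zero]
      have h2 : (fun h : ℝ => h ^ 2) =o[𝓝 0] fun h => h := by
        simpa using Asymptotics.isLittleO_pow_id (𝕜 := ℝ) one_lt_two
      refine Asymptotics.IsBigO.trans_isLittleO ?_ h2
      refine Asymptotics.IsBigO.of_bound 1 (Eventually.of_forall fun h => ?_)
      have h0 : mf (0 + h) - mf 0 - h • (0:ℝ) = max 0 h ^ 2 := by simp [mf]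
      rw [h0, one_mul, Real.norm_of_nonneg (sq_nonneg _), Real.norm_of_nonneg (sq_nonneg _)]
      rcases le_total 0 h with hh | hh
      · rw [max_eq_right hh]
      · rw [max_eq_left hh]; simp; positivity
    simpa using this
  · have e1 : mf =ᶠ[𝓝 z] fun y => y ^ 2 := by
      filter_upwards [Ioi_mem_nhds h] with y hy
      simp [mf, max_eq_right (le_of_lt (mem_Ioi.1 hy))]
    rw [max_eq_right h.le]
    simpa using (hasDerivAt_pow 2 z).congr_of_eventuallyEq e1

lemma contDiff_mf : ContDiff ℝ 1 mf := by
  rw [contDiff_one_iff_deriv]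
  refine ⟨fun z => (hasDerivAt_mf z).differentiableAt, ?_⟩
  have : deriv mf = fun z => 2 * max 0 z := by ext z; exact (hasDerivAt_mf z).deriv
  rw [this]; fun_prop

lemma mf_nonneg (z : ℝ) : 0 ≤ mf z := sq_nonneg _
lemma mf_zero {z : ℝ} (h : z ≤ 0) : mf z = 0 := by simp [mf, max_eq_left h]
lemma mf_le_one {z : ℝ} (h : z ≤ 1) : mf z ≤ 1 := by
  unfold mf
  exact pow_le_one₀ (le_max_left _ _) (max_le zero_le_one h)

noncomputable def et (R : ℝ) (u : Eu n → ℝ) (x : Eu n) : ℝ := mf (2 - zf u x / R ^ 2)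
noncomputable def etd (R : ℝ) (u : Eu n → ℝ) (x : Eu n) : ℝ := -2 * max 0 (2 - zf u x / R ^ 2) / R ^ 2
noncomputable def ch (ε : ℝ) (e p : Eu n) (u : Eu n → ℝ) (x : Eu n) : ℝ := mf (1 - ε / rf e p u x)
noncomputable def chd (ε : ℝ) (e p : Eu n) (u : Eu n → ℝ) (x : Eu n) : ℝ :=
  2 * max 0 (1 - ε / rf e p u x) * (ε / rf e p u x ^ 2)

section
variable {e p : Eu n} {u : Eu n → ℝ} {R ε : ℝ}

lemma et_nonneg (x : Eu n) : 0 ≤ et R u x := mf_nonneg _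
lemma zf_nonneg (x : Eu n) : 0 ≤ zf u x := by unfold zf; positivity
lemma et_le (x : Eu n) : et R u x ≤ 4 := by
  have : 0 ≤ zf u x / R ^ 2 := div_nonneg (zf_nonneg x) (sq_nonneg _)
  have h : max 0 (2 - zf u x / R ^ 2) ≤ 2 := max_le (by norm_num) (by linarith)
  unfold et mf
  nlinarith [le_max_left 0 (2 - zf u x / R ^ 2)]
lemma etd_nonpos (x : Eu n) : etd R u x ≤ 0 := by
  unfold etd
  have := le_max_left 0 (2 - zf u x / R ^ 2)
  exact div_nonpos_of_nonpos_of_nonneg (by linarith) (sq_nonneg _)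
lemma et_zero (hR : 0 < R) {x : Eu n} (h : 2 * R ^ 2 ≤ zf u x) : et R u x = 0 := by
  refine mf_zero ?_
  have : 2 ≤ zf u x / R ^ 2 := (le_div_iff₀ (by positivity)).2 h
  linarith
lemma etd_zero (hR : 0 < R) {x : Eu n} (h : 2 * R ^ 2 ≤ zf u x) : etd R u x = 0 := by
  have : 2 ≤ zf u x / R ^ 2 := (le_div_iff₀ (by positivity)).2 h
  unfold etd
  rw [max_eq_left (by linarith)]; simp
lemma et_ge_one (hR : 0 < R) {x : Eu n} (h : zf u x ≤ R ^ 2) : 1 ≤ et R u x := by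
  have h1 : zf u x / R ^ 2 ≤ 1 := (div_le_iff₀ (by positivity)).2 (by linarith)
  have h2 : 1 ≤ max 0 (2 - zf u x / R ^ 2) := le_trans (by linarith) (le_max_right _ _)
  unfold et mf; nlinarith
lemma abs_etd_le (hR : 0 < R) (x : Eu n) : |etd R u x| ≤ 4 / R ^ 2 := by
  have : 0 ≤ zf u x / R ^ 2 := div_nonneg (zf_nonneg x) (sq_nonneg _)
  have h : max 0 (2 - zf u x / R ^ 2) ≤ 2 := max_le (by norm_num) (by linarith)
  rw [abs_of_nonpos (etd_nonpos x), etd, neg_div', ]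
  gcongr
  linarith

lemma ch_nonneg (x : Eu n) : 0 ≤ ch ε e p u x := mf_nonneg _
lemma ch_le_one (hε : 0 < ε) (x : Eu n) : ch ε e p u x ≤ 1 := by
  refine mf_le_one ?_
  have : 0 ≤ ε / rf e p u x := div_nonneg hε.le (rf_nonneg x)
  linarith
lemma chd_nonneg (hε : 0 < ε) (x : Eu n) : 0 ≤ chd ε e p u x := by
  unfold chd
  have := le_max_left 0 (1 - ε / rf e p u x)
  positivity
lemma r_chd (hε : 0 < ε) {x : Eu n} (hx : x ∈ Om e) :
    rf e p u x * chd ε e p u x = 2 * max 0 (1 - ε / rf e p u x) * (ε / rf e p u x) := by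
  have := rf_pos (p := p) (u := u) hx
  unfold chd; field_simp
lemma r_chd_le (hε : 0 < ε) {x : Eu n} (hx : x ∈ Om e) : rf e p u x * chd ε e p u x ≤ 1 := by
  have := rf_pos (p := p) (u := u) hx
  rw [r_chd hε hx]
  have h0 : 0 < ε / rf e p u x := by positivity
  rcases le_total 0 (1 - ε / rf e p u x) with h | h
  · rw [max_eq_right h]; nlinarith [sq_nonneg (ε / rf e p u x - 1 / 2)]
  · rw [max_eq_left h]; simp
lemma ch_zero {x : Eu n} (hx : x ∈ Om e) (h : rf e p u x ≤ ε) : ch ε e p u x = 0 := by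
  refine mf_zero ?_
  have := (one_le_div (rf_pos (p := p) (u := u) hx)).2 h
  linarith
lemma chd_zero {x : Eu n} (hx : x ∈ Om e) (h : rf e p u x ≤ ε) : chd ε e p u x = 0 := by
  have := (one_le_div (rf_pos (p := p) (u := u) hx)).2 h
  unfold chd
  rw [max_eq_left (by linarith)]; simp

lemma hasFDerivAt_et (G : Geo e p u) {x : Eu n} (hx : x ∈ Om e) :
    HasFDerivAt (et R u) (etd R u x • Lz u x) x := by
  have h1 : HasFDerivAt (fun y => 2 - zf u y / R ^ 2) (-((R ^ 2)⁻¹ • Lz u x)) x :=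
    hfd_congr (((hasFDerivAt_zf G hx).const_smul (R ^ 2)⁻¹).const_sub 2)
      (fun y => by simp [div_eq_inv_mul]) (fun y => rfl)
  refine hfd_congr ((hasDerivAt_mf _).comp_hasFDerivAt x h1) (fun y => rfl) fun y => ?_
  simp [etd]; ring

lemma smooth_et (G : Geo e p u) : ContDiffOn ℝ 1 (et R u) (Om e) :=
  contDiff_mf.comp_contDiffOn (contDiffOn_const.sub ((smooth_zf G).div_const _))

lemma cont_etd (G : Geo e p u) : ContinuousOn (etd R u) (Om e) := by
  have := (smooth_zf G).continuousOn
  unfold etd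
  fun_prop

lemma hasFDerivAt_ch (G : Geo e p u) {x : Eu n} (hx : x ∈ Om e) :
    HasFDerivAt (ch ε e p u) (chd ε e p u x • ((sf e x / rf e p u x) • Ls e + (tf p u x / rf e p u x) • Lt p u x)) x := by
  have hr := rf_pos (p := p) (u := u) hx
  have h0 : HasDerivAt (fun r : ℝ => 1 - ε / r) (ε / rf e p u x ^ 2) (rf e p u x) := by
    have := ((hasDerivAt_inv hr.ne').const_mul ε).const_sub 1
    refine this.congr_deriv ?_
    field_simp
  exact hfd_congr (((hasDerivAt_mf _).comp _ h0).comp_hasFDerivAt x (hasFDerivAt_rf G hx)) (fun y => rfl) fun y => rfl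

lemma smooth_ch (G : Geo e p u) : ContDiffOn ℝ 1 (ch ε e p u) (Om e) :=
  contDiff_mf.comp_contDiffOn (contDiffOn_const.sub (contDiffOn_const.div (smooth_rf G)
    fun x hx => (rf_pos hx).ne'))

lemma cont_chd (G : Geo e p u) : ContinuousOn (chd ε e p u) (Om e) := by
  have h1 := (smooth_rf G).continuousOn
  have h2 : ContinuousOn (fun x => ε / rf e p u x) (Om e) :=
    continuousOn_const.div h1 fun x hx => (rf_pos hx).ne'
  have h3 : ContinuousOn (fun x => ε / rf e p u x ^ 2) (Om e) :=
    continuousOn_const.div (h1.pow 2) fun x hx => by have := rf_pos (p := p) (u := u) hx; positivity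
  unfold chd
  fun_prop

lemma supp_compact (G : Geo e p u) (hε : 0 < ε) (M : ℝ) :
    ∃ K, IsCompact K ∧ K ⊆ Om e ∧ ∀ x ∈ Om e, x ∉ K → M < zf u x ∨ rf e p u x < ε := by
  set H := {x : Eu n | 0 ≤ ⟪e, x⟫} with hH
  have hHc : IsClosed H := isClosed_le (by fun_prop) (by fun_prop)
  have hr : ContinuousOn (rf e p u) H := by
    have := G.cont
    unfold rf sf tf
    fun_prop
  refine ⟨(H ∩ rf e p u ⁻¹' Ici ε) ∩ closedBall 0 (√M), ?_, ?_, ?_⟩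
  · exact (isCompact_closedBall 0 _).inter_left (hr.preimage_isClosed_of_isClosed hHc isClosed_Ici)
  · rintro x ⟨⟨h1, h2⟩, -⟩
    refine lt_of_le_of_ne (show 0 ≤ ⟪e, x⟫ from h1) fun h0 => ?_
    have : rf e p u x = 0 := by
      have := G.bd x h0.symm
      simp [rf, sf, tf, ← h0, this]
    simp only [mem_preimage, mem_Ici, this] at h2
    linarith
  · intro x hx hxK
    by_contra! hcon
    refine hxK ⟨⟨(show 0 ≤ ⟪e, x⟫ from le_of_lt hx), hcon.2⟩, ?_⟩
    rw [mem_closedBall_zero_iff]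
    refine Real.le_sqrt_of_sq_le (le_trans ?_ hcon.1)
    unfold zf; nlinarith [sq_nonneg (u x)]

lemma int_piece (G : Geo e p u) (hε : 0 < ε) {f : Eu n → ℝ} (hf : ContinuousOn f (Om e))
    (h0 : ∀ x ∈ Om e, (2 * R ^ 2 ≤ zf u x ∨ rf e p u x ≤ ε) → f x = 0) : IntegrableOn f (Om e) := by
  obtain ⟨K, h1, h2, h3⟩ := supp_compact G hε (2 * R ^ 2)
  refine integrableOn_of_supp (isOpen_Om e) hf h1 h2 fun x hx hxK => h0 x hx ?_
  rcases h3 x hx hxK with h | h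
  · exact Or.inl h.le
  · exact Or.inr h.le

lemma TF_ph (G : Geo e p u) (hε : 0 < ε) (hR : 0 < R) : TF (Om e) (fun x => et R u x * ch ε e p u x) := by
  obtain ⟨K, h1, h2, h3⟩ := supp_compact G hε (2 * R ^ 2)
  refine ⟨(smooth_et G).mul (smooth_ch G), K, h1, h2, fun x hx hxK => ?_⟩
  rcases h3 x hx hxK with h | h
  · simp [et_zero hR h.le]
  · simp [ch_zero hx h.le]

lemma hasFDerivAt_ph (G : Geo e p u) {x : Eu n} (hx : x ∈ Om e) :
    HasFDerivAt (fun x => et R u x * ch ε e p u x)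
      ((et R u x * chd ε e p u x * (sf e x / rf e p u x)) • Ls e
        + (et R u x * chd ε e p u x * (tf p u x / rf e p u x)) • Lt p u x
        + (ch ε e p u x * etd R u x) • Lz u x) x := by
  refine hfd_congr ((hasFDerivAt_et (R := R) G hx).mul (hasFDerivAt_ch (ε := ε) G hx)) (fun y => rfl) fun y => ?_
  simp; ring

lemma id_X_cut (S : Sol e p u) (hε : 0 < ε) (hR : 0 < R) :
    ∫ x in Om e, Wg u x * (n * (et R u x * ch ε e p u x) +
      et R u x * chd ε e p u x * (rf e p u x - hf u x * nR e p u x)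
      + 2 * (ch ε e p u x * etd R u x) * (zf u x - hf u x ^ 2)) = 0 := by
  have h := id_X S (TF_ph S.toGeo hε hR) _ _ _ fun x hx => hasFDerivAt_ph S.toGeo hx
  rw [← h]
  refine setIntegral_congr_fun (isOpen_Om e).measurableSet fun x hx => ?_
  have hr := rf_pos (p := p) (u := u) hx
  have h2 := rf_sq (e := e) (p := p) (u := u) x
  simp only [nR]
  field_simp
  rw [h2]
  ring

lemma id_R_cut (S : Sol e p u) (hε : 0 < ε) (hR : 0 < R) :
    ∫ x in Om e, Wg u x * (et R u x * ch ε e p u x * kp e p u x / rf e p u x +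
      et R u x * chd ε e p u x * (1 - nR e p u x ^ 2)
      + 2 * (ch ε e p u x * etd R u x) * (rf e p u x - hf u x * nR e p u x)) = 0 := by
  have G := S.toGeo
  have hT := TF_ph G hε hR
  have hri : ContDiffOn ℝ 1 (fun x => (rf e p u x)⁻¹) (Om e) := (smooth_rf G).inv fun x hx => (rf_pos hx).ne'
  have dri : ∀ x ∈ Om e, HasFDerivAt (fun x => (rf e p u x)⁻¹)
      (-((rf e p u x) ^ 2)⁻¹ • ((sf e x / rf e p u x) • Ls e + (tf p u x / rf e p u x) • Lt p u x)) x :=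
    fun x hx => (hasDerivAt_inv (rf_pos hx).ne').comp_hasFDerivAt x (hasFDerivAt_rf G hx)
  have t1 := hT.mul ((smooth_sf (e := e) (Om e)).mul hri)
  have t2 := hT.mul ((smooth_tf G).mul hri)
  have h1 := id_e S t1
    (fun x => et R u x * ch ε e p u x * ((rf e p u x)⁻¹ - sf e x ^ 2 * (rf e p u x)⁻¹ ^ 3) +
      sf e x * (rf e p u x)⁻¹ * (et R u x * chd ε e p u x * (sf e x * (rf e p u x)⁻¹)))
    (fun x => - (et R u x * ch ε e p u x * (sf e x * tf p u x * (rf e p u x)⁻¹ ^ 3)) +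
      sf e x * (rf e p u x)⁻¹ * (et R u x * chd ε e p u x * (tf p u x * (rf e p u x)⁻¹)))
    (fun x => sf e x * (rf e p u x)⁻¹ * (ch ε e p u x * etd R u x)) (fun x hx => by
      refine hfd_congr (((hasFDerivAt_sf (e := e) x).mul (dri x hx)).mul (hasFDerivAt_ph G hx)) (fun y => rfl) fun y => ?_
      simp; ring)
  have h2 := id_N S t2
    (fun x => - (et R u x * ch ε e p u x * (sf e x * tf p u x * (rf e p u x)⁻¹ ^ 3)) +
      tf p u x * (rf e p u x)⁻¹ * (et R u x * chd ε e p u x * (sf e x * (rf e p u x)⁻¹)))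
    (fun x => et R u x * ch ε e p u x * ((rf e p u x)⁻¹ - tf p u x ^ 2 * (rf e p u x)⁻¹ ^ 3) +
      tf p u x * (rf e p u x)⁻¹ * (et R u x * chd ε e p u x * (tf p u x * (rf e p u x)⁻¹)))
    (fun x => tf p u x * (rf e p u x)⁻¹ * (ch ε e p u x * etd R u x)) (fun x hx => by
      refine hfd_congr (((hasFDerivAt_tf G hx).mul (dri x hx)).mul (hasFDerivAt_ph G hx)) (fun y => rfl) fun y => ?_
      simp; ring)
  have h3 := integral_add h1.1 h2.1
  rw [h1.2, h2.2, add_zero] at h3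
  rw [← h3]
  refine setIntegral_congr_fun (isOpen_Om e).measurableSet fun x hx => ?_
  have hr := rf_pos (p := p) (u := u) hx
  have h2 := rf_sq (e := e) (p := p) (u := u) x
  obtain ⟨i, hi⟩ : ∃ i, (rf e p u x)⁻¹ = i := ⟨_, rfl⟩
  have P : (sf e x ^ 2 + tf p u x ^ 2) * i ^ 2 = 1 := by rw [← hi, ← h2]; field_simp
  have hr' : rf e p u x = (sf e x ^ 2 + tf p u x ^ 2) * i := by rw [← hi, ← h2]; field_simp
  simp only [nR, nT, kp, div_eq_mul_inv, hi]
  rw [hr']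
  linear_combination (-Wg u x * (et R u x * ch ε e p u x * i * (1 - nE e u x ^ 2 - nN p u x ^ 2) * (-1) + et R u x * chd ε e p u x)) * P

lemma id_K_cut (S : Sol e p u) (hε : 0 < ε) (hR : 0 < R) :
    ∫ x in Om e, Wg u x * (et R u x * ch ε e p u x * kp e p u x
      - Real.arctan (tf p u x / sf e x) * (et R u x * chd ε e p u x * (rf e p u x * nR e p u x * nT e p u x))
      - 2 * Real.arctan (tf p u x / sf e x) * (ch ε e p u x * etd R u x) * (hf u x * (rf e p u x * nT e p u x))) = 0 := by
  have G := S.toGeo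
  have hT := TF_ph G hε hR
  have hts : ContDiffOn ℝ 1 (fun x => tf p u x / sf e x) (Om e) := (smooth_tf G).div (smooth_sf _) fun x hx => ne_of_gt hx
  have hat : ContDiffOn ℝ 1 (fun x => Real.arctan (tf p u x / sf e x)) (Om e) := Real.contDiff_arctan.comp_contDiffOn hts
  have dat : ∀ x ∈ Om e, HasFDerivAt (fun x => Real.arctan (tf p u x / sf e x))
      ((-(tf p u x * (rf e p u x)⁻¹ ^ 2)) • Ls e + (sf e x * (rf e p u x)⁻¹ ^ 2) • Lt p u x) x := by
    intro x hx
    have hs : 0 < sf e x := hx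
    have h2 := rf_sq (e := e) (p := p) (u := u) x
    have h := ((hasFDerivAt_tf G hx).mul ((hasDerivAt_inv hs.ne').comp_hasFDerivAt x (hasFDerivAt_sf x))).arctan
    refine hfd_congr h (fun y => rfl) fun y => ?_
    simp only [inv_pow, h2]
    simp
    field_simp
  have t0 := hT.mul hat
  have t1 := t0.mul (smooth_sf (e := e) (Om e))
  have t2 := t0.mul (smooth_tf G)
  have d0 := fun x hx => (dat x hx).mul (hasFDerivAt_ph (R := R) (ε := ε) G hx)
  have h1 := id_N S t1
    (fun x => Real.arctan (tf p u x / sf e x) * (et R u x * ch ε e p u x) + sf e x * (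
        Real.arctan (tf p u x / sf e x) * (et R u x * chd ε e p u x * (sf e x * (rf e p u x)⁻¹))
        - (et R u x * ch ε e p u x) * (tf p u x * (rf e p u x)⁻¹ ^ 2)))
    (fun x => sf e x * (
        Real.arctan (tf p u x / sf e x) * (et R u x * chd ε e p u x * (tf p u x * (rf e p u x)⁻¹))
        + (et R u x * ch ε e p u x) * (sf e x * (rf e p u x)⁻¹ ^ 2)))
    (fun x => sf e x * (Real.arctan (tf p u x / sf e x) * (ch ε e p u x * etd R u x))) (fun x hx => by
      refine hfd_congr ((hasFDerivAt_sf (e := e) x).mul (d0 x hx)) (fun y => rfl) fun y => ?_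
      simp; ring)
  have h2 := id_e S t2
    (fun x => tf p u x * (
        Real.arctan (tf p u x / sf e x) * (et R u x * chd ε e p u x * (sf e x * (rf e p u x)⁻¹))
        - (et R u x * ch ε e p u x) * (tf p u x * (rf e p u x)⁻¹ ^ 2)))
    (fun x => Real.arctan (tf p u x / sf e x) * (et R u x * ch ε e p u x) + tf p u x * (
        Real.arctan (tf p u x / sf e x) * (et R u x * chd ε e p u x * (tf p u x * (rf e p u x)⁻¹))
        + (et R u x * ch ε e p u x) * (sf e x * (rf e p u x)⁻¹ ^ 2)))
    (fun x => tf p u x * (Real.arctan (tf p u x / sf e x) * (ch ε e p u x * etd R u x))) (fun x hx => by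
      refine hfd_congr ((hasFDerivAt_tf G hx).mul (d0 x hx)) (fun y => rfl) fun y => ?_
      simp; ring)
  have h3 := integral_sub h1.1 h2.1
  rw [h1.2, h2.2, sub_zero] at h3
  rw [← h3]
  refine setIntegral_congr_fun (isOpen_Om e).measurableSet fun x hx => ?_
  have hr := rf_pos (p := p) (u := u) hx
  have h2 := rf_sq (e := e) (p := p) (u := u) x
  obtain ⟨i, hi⟩ : ∃ i, (rf e p u x)⁻¹ = i := ⟨_, rfl⟩
  have P : (sf e x ^ 2 + tf p u x ^ 2) * i ^ 2 = 1 := by rw [← hi, ← h2]; field_simp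
  have hr' : rf e p u x = (sf e x ^ 2 + tf p u x ^ 2) * i := by rw [← hi, ← h2]; field_simp
  generalize hth : Real.arctan (tf p u x / sf e x) = θ
  simp only [nR, nT, kp, hth]
  simp only [div_eq_mul_inv, hi]
  rw [hr']
  linear_combination (-Wg u x * (et R u x * ch ε e p u x + θ * et R u x * chd ε e p u x * i * (sf e x * nE e u x + tf p u x * nN p u x) * (sf e x * nN p u x - tf p u x * nE e u x) + 2 * θ * (ch ε e p u x * etd R u x) * hf u x * (sf e x * nN p u x - tf p u x * nE e u x))) * P
end
end Bern

namespace Bern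
open Filter Topology InnerProductSpace
variable {n : ℕ}

lemma swap_int {Ω : Set (Eu n)} (hΩ : IsOpen Ω) {F : Eu n → ℝ → ℝ}
    (hF : ContinuousOn (fun z : Eu n × ℝ => F z.1 z.2) (Ω ×ˢ univ)) {K : Set (Eu n)}
    (hK : IsCompact K) (hKΩ : K ⊆ Ω)
    (h0 : ∀ x ∈ Ω, x ∉ K → ∀ l ∈ Icc (0:ℝ) 1, F x l = 0) :
    IntegrableOn (fun x => ∫ l in (0:ℝ)..1, F x l) Ω ∧
    ∫ x in Ω, ∫ l in (0:ℝ)..1, F x l = ∫ l in (0:ℝ)..1, ∫ x in Ω, F x l := by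
  have hi : IntegrableOn (fun z : Eu n × ℝ => F z.1 z.2) (Ω ×ˢ Ioc (0:ℝ) 1) (volume.prod volume) := by
    have h1 : IntegrableOn (fun z : Eu n × ℝ => F z.1 z.2) (K ×ˢ Icc (0:ℝ) 1) (volume.prod volume) :=
      (hF.mono (prod_mono hKΩ (subset_univ _))).integrableOn_compact (hK.prod isCompact_Icc)
    have h2 : IntegrableOn (fun z : Eu n × ℝ => F z.1 z.2) ((Ω \ K) ×ˢ Icc (0:ℝ) 1)
        (volume.prod volume) := by
      refine (integrableOn_zero (ε' := ℝ)).congr_fun (fun z hz => ?_)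
        ((hΩ.measurableSet.diff hK.measurableSet).prod measurableSet_Icc)
      exact (h0 z.1 hz.1.1 hz.1.2 z.2 hz.2).symm
    have h3 := h1.union h2
    rw [← union_prod, union_sdiff_cancel hKΩ] at h3
    exact h3.mono_set (prod_mono le_rfl Ioc_subset_Icc_self)
  rw [IntegrableOn, ← Measure.prod_restrict] at hi
  simp only [intervalIntegral.integral_of_le (zero_le_one (α := ℝ))]
  exact ⟨hi.integral_prod_left, integral_integral_swap hi⟩

noncomputable def uc (e p : Eu n) (c : ℝ) (x : Eu n) : ℝ := ⟪p, x⟫ + c * qf p * sf e x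
noncomputable def uh (e p : Eu n) (u : Eu n → ℝ) (c l : ℝ) (x : Eu n) : ℝ :=
  uc e p c x + l * (u x - uc e p c x)

section
variable {e p : Eu n} {u : Eu n → ℝ} {c l : ℝ}

lemma Dg_of {v : Eu n → ℝ} {g x : Eu n} (h : HasFDerivAt v (innerSL ℝ g) x) : Dg v x = g := by
  refine ext_inner_right ℝ fun a => ?_
  rw [inner_Dg, h.fderiv]; rfl

lemma hasFDerivAt_uc (x : Eu n) : HasFDerivAt (uc e p c) (innerSL ℝ (p + (c * qf p) • e)) x := by
  refine hfd_congr (((innerSL ℝ p).hasFDerivAt).add (((innerSL ℝ e).hasFDerivAt).const_mul (c * qf p)))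
    (fun y => ?_) (fun y => ?_)
  · simp [uc, sf]
  · simp [inner_add_left, inner_smul_left]

lemma Dg_uc (x : Eu n) : Dg (uc e p c) x = p + (c * qf p) • e := Dg_of (hasFDerivAt_uc x)

lemma contDiff_uc : ContDiff ℝ 1 (uc e p c) := by
  exact ((innerSL ℝ p).contDiff).add (contDiff_const.mul (innerSL ℝ e).contDiff)

lemma Geo_uc (he : ‖e‖ = 1) (hep : ⟪e, p⟫ = (0:ℝ)) (c : ℝ) : Geo e p (uc e p c) where
  he := he
  hep := hep
  C1 := contDiff_uc.contDiffOn
  cont := contDiff_uc.continuous.continuousOn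
  bd := fun x hx => by simp [uc, sf, hx]

lemma Geo_uh (G : Geo e p u) (c l : ℝ) : Geo e p (uh e p u c l) where
  he := G.he
  hep := G.hep
  C1 := contDiff_uc.contDiffOn.add (contDiffOn_const.mul (G.C1.sub contDiff_uc.contDiffOn))
  cont := contDiff_uc.continuous.continuousOn.add
    (continuousOn_const.mul (G.cont.sub contDiff_uc.continuous.continuousOn))
  bd := fun x hx => by simp [uh, uc, sf, hx, G.bd x hx]

lemma Dg_uh (G : Geo e p u) {x : Eu n} (hx : x ∈ Om e) : Dg (uh e p u c l) x =
    Dg (uc e p c) x + l • (Dg u x - Dg (uc e p c) x) := by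
  refine Dg_of ?_
  rw [Dg_uc]
  refine hfd_congr ((hasFDerivAt_uc (e := e) (p := p) (c := c) x).add
    (((hasFDerivAt_u G hx).sub (hasFDerivAt_uc (e := e) (p := p) (c := c) x)).const_mul l))
    (fun y => ?_) (fun y => ?_)
  · simp [uh]
  · simp only [ContinuousLinearMap.add_apply, ContinuousLinearMap.smul_apply,
      ContinuousLinearMap.sub_apply, innerSL_apply_apply, inner_add_left, inner_smul_left, inner_sub_left,
      smul_eq_mul, conj_trivial]

lemma tf_uc (x : Eu n) : tf p (uc e p c) x = c * sf e x := by
  have := qf_pos p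
  unfold tf uc; field_simp; ring

lemma tf_uh (x : Eu n) : tf p (uh e p u c l) x = c * sf e x + l * (tf p u x - c * sf e x) := by
  have := qf_pos p
  unfold tf uh uc; field_simp; ring

lemma uh_one : uh e p u c 1 = u := by ext x; simp [uh]
lemma uh_zero : uh e p u c 0 = uc e p c := by ext x; simp [uh]

lemma u_sub_uc (x : Eu n) : u x - uc e p c x = qf p * (tf p u x - c * sf e x) := by
  have := qf_pos p
  unfold tf uc; field_simp; ring

/-- joint continuity basics -/
lemma jc {f : Eu n → ℝ} {Ω : Set (Eu n)} (hf : ContinuousOn f Ω) :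
    ContinuousOn (fun z : Eu n × ℝ => f z.1) (Ω ×ˢ univ) :=
  hf.comp continuousOn_fst fun z hz => hz.1

lemma jc_uh (G : Geo e p u) (c : ℝ) :
    ContinuousOn (fun z : Eu n × ℝ => uh e p u c z.2 z.1) (Om e ×ˢ univ) := by
  have h1 := jc (contDiff_uc (e := e) (p := p) (c := c)).continuous.continuousOn (Ω := Om e)
  have h2 := jc G.C1.continuousOn
  exact h1.add (continuousOn_snd.mul (h2.sub h1))

lemma jc_zf (G : Geo e p u) (c : ℝ) :
    ContinuousOn (fun z : Eu n × ℝ => zf (uh e p u c z.2) z.1) (Om e ×ˢ univ) := by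
  have h1 := jc_uh G c
  unfold zf; fun_prop

lemma jc_tf (G : Geo e p u) (c : ℝ) :
    ContinuousOn (fun z : Eu n × ℝ => tf p (uh e p u c z.2) z.1) (Om e ×ˢ univ) := by
  have h1 := jc_uh G c
  unfold tf; fun_prop

lemma jc_sf : ContinuousOn (fun z : Eu n × ℝ => sf e z.1) (Om e ×ˢ univ) := by
  unfold sf; fun_prop

lemma jc_rf (G : Geo e p u) (c : ℝ) :
    ContinuousOn (fun z : Eu n × ℝ => rf e p (uh e p u c z.2) z.1) (Om e ×ˢ univ) := by
  have h1 := jc_tf G c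
  have h2 := jc_sf (e := e)
  unfold rf; fun_prop

lemma jc_rfi (G : Geo e p u) (c : ℝ) :
    ContinuousOn (fun z : Eu n × ℝ => (rf e p (uh e p u c z.2) z.1)⁻¹) (Om e ×ˢ univ) :=
  (jc_rf G c).inv₀ fun z hz => (rf_pos hz.1).ne'

lemma jc_et (G : Geo e p u) (c R : ℝ) :
    ContinuousOn (fun z : Eu n × ℝ => et R (uh e p u c z.2) z.1) (Om e ×ˢ univ) := by
  have h1 := jc_zf G c
  unfold et mf; fun_prop

lemma jc_etd (G : Geo e p u) (c R : ℝ) :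
    ContinuousOn (fun z : Eu n × ℝ => etd R (uh e p u c z.2) z.1) (Om e ×ˢ univ) := by
  have h1 := jc_zf G c
  unfold etd; fun_prop

lemma jc_ch (G : Geo e p u) (c ε : ℝ) :
    ContinuousOn (fun z : Eu n × ℝ => ch ε e p (uh e p u c z.2) z.1) (Om e ×ˢ univ) := by
  have h1 := jc_rfi G c
  unfold ch mf; simp only [div_eq_mul_inv]; fun_prop

lemma jc_chd (G : Geo e p u) (c ε : ℝ) :
    ContinuousOn (fun z : Eu n × ℝ => chd ε e p (uh e p u c z.2) z.1) (Om e ×ˢ univ) := by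
  have h1 := jc_rfi G c
  unfold chd; simp only [div_eq_mul_inv, ← inv_pow]; fun_prop

/-- derivatives in the homotopy parameter -/
lemma hd_uh (x : Eu n) : HasDerivAt (fun l => uh e p u c l x) (u x - uc e p c x) l := by
  unfold uh
  simpa using ((hasDerivAt_id l).mul_const (u x - uc e p c x)).const_add (uc e p c x)

lemma hd_tf (x : Eu n) : HasDerivAt (fun l => tf p (uh e p u c l) x) (tf p u x - c * sf e x) l := by
  simp only [tf_uh]
  simpa using ((hasDerivAt_id l).mul_const (tf p u x - c * sf e x)).const_add (c * sf e x)

lemma hd_et {R : ℝ} (x : Eu n) : HasDerivAt (fun l => et R (uh e p u c l) x)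
    (etd R (uh e p u c l) x * (2 * uh e p u c l x * (u x - uc e p c x))) l := by
  have h1 := ((((hd_uh (e := e) (p := p) (u := u) (c := c) (l := l) x).pow 2).const_add
    (‖x‖ ^ 2)).div_const (R ^ 2)).const_sub 2
  have h2 := (hasDerivAt_mf _).comp l h1
  refine h2.congr_deriv ?_
  simp only [etd, zf]; push_cast; simp only [Pi.pow_apply]; ring

lemma hd_ch {ε : ℝ} {x : Eu n} (hx : x ∈ Om e) : HasDerivAt (fun l => ch ε e p (uh e p u c l) x)
    (chd ε e p (uh e p u c l) x * (tf p (uh e p u c l) x / rf e p (uh e p u c l) x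
      * (tf p u x - c * sf e x))) l := by
  have hs : 0 < sf e x := hx
  have h1 := ((hd_tf (e := e) (p := p) (u := u) (c := c) (l := l) x).pow 2).const_add (sf e x ^ 2)
  have hr := rf_pos (p := p) (u := uh e p u c l) hx
  have h2 := h1.sqrt (by simp only [Pi.pow_apply]; positivity)
  have h3 : HasDerivAt (fun l => rf e p (uh e p u c l) x) _ l := h2
  have h4 := ((h3.inv hr.ne').const_mul ε).const_sub 1
  have h5 := (hasDerivAt_mf _).comp l h4
  have h6 : HasDerivAt (fun l => ch ε e p (uh e p u c l) x) _ l := h5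
  refine h6.congr_deriv ?_
  have e1 : √(sf e x ^ 2 + tf p (uh e p u c l) x ^ 2) = rf e p (uh e p u c l) x := rfl
  simp only [Pi.inv_apply, Pi.pow_apply, chd, div_eq_mul_inv, e1]
  push_cast
  field_simp

end
end Bern

namespace Bern
open Filter Topology InnerProductSpace
variable {n : ℕ} {e p : Eu n} {u : Eu n → ℝ} {c l ε R : ℝ}

noncomputable def gg (ε R : ℝ) (e p : Eu n) (u : Eu n → ℝ) (x : Eu n) : ℝ :=
  (rf e p u x)⁻¹ * (et R u x * ch ε e p u x)
noncomputable def gk (ε R : ℝ) (e p : Eu n) (u : Eu n → ℝ) (x : Eu n) : ℝ :=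
  et R u x * (chd ε e p u x * (rf e p u x)⁻¹ - ch ε e p u x * (rf e p u x)⁻¹ ^ 2) * (rf e p u x)⁻¹
noncomputable def gz (ε R : ℝ) (e p : Eu n) (u : Eu n → ℝ) (x : Eu n) : ℝ :=
  etd R u x * ch ε e p u x * (rf e p u x)⁻¹

lemma smooth_rfi (G : Geo e p u) : ContDiffOn ℝ 1 (fun x => (rf e p u x)⁻¹) (Om e) :=
  (smooth_rf G).inv fun x hx => (rf_pos hx).ne'

lemma hasFDerivAt_gg (G : Geo e p u) {x : Eu n} (hx : x ∈ Om e) :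
    HasFDerivAt (gg ε R e p u) ((gk ε R e p u x * sf e x) • Ls e + (gk ε R e p u x * tf p u x) • Lt p u x
      + gz ε R e p u x • Lz u x) x := by
  have hr := rf_pos (p := p) (u := u) hx
  have h1 := (hasDerivAt_inv hr.ne').comp_hasFDerivAt x (hasFDerivAt_rf G hx)
  have h2 := h1.mul (hasFDerivAt_ph (ε := ε) (R := R) G hx)
  refine hfd_congr h2 (fun y => rfl) (fun y => ?_)
  simp only [ContinuousLinearMap.add_apply, ContinuousLinearMap.smul_apply, smul_eq_mul, gk, gz,
    Function.comp_apply, div_eq_mul_inv]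
  rw [inv_pow]
  ring

lemma hd_gg {x : Eu n} (hx : x ∈ Om e) : HasDerivAt (fun l => gg ε R e p (uh e p u c l) x)
    (gk ε R e p (uh e p u c l) x * tf p (uh e p u c l) x * (tf p u x - c * sf e x)
      + gz ε R e p (uh e p u c l) x * (2 * uh e p u c l x * (u x - uc e p c x))) l := by
  have hs : 0 < sf e x := hx
  have h1 := ((hd_tf (e := e) (p := p) (u := u) (c := c) (l := l) x).pow 2).const_add (sf e x ^ 2)
  have hr := rf_pos (p := p) (u := uh e p u c l) hx
  have h2 := h1.sqrt (by simp only [Pi.pow_apply]; positivity)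
  have h3 : HasDerivAt (fun l => rf e p (uh e p u c l) x) _ l := h2
  have h4 := (h3.inv hr.ne').mul ((hd_et (R := R) (e := e) (p := p) (u := u) (c := c) x).mul (hd_ch (ε := ε) (p := p) (u := u) (c := c) hx))
  have h5 : HasDerivAt (fun l => gg ε R e p (uh e p u c l) x) _ l := h4
  refine h5.congr_deriv ?_
  have e1 : √(sf e x ^ 2 + tf p (uh e p u c l) x ^ 2) = rf e p (uh e p u c l) x := rfl
  simp only [Pi.inv_apply, Pi.mul_apply, Pi.pow_apply, gk, gz, div_eq_mul_inv, e1]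
  push_cast
  field_simp
  ring

noncomputable def ML (ε R c : ℝ) (e p : Eu n) (u : Eu n → ℝ) (x : Eu n) (l : ℝ) : ℝ :=
  gg ε R e p (uh e p u c l) x * (sf e x * (1 + (⟪p, Dg (uc e p c) x⟫ + l * ⟪p, Dg u x - Dg (uc e p c) x⟫)) * (qf p)⁻¹
    + tf p (uh e p u c l) x * (⟪e, Dg (uc e p c) x⟫ + l * ⟪e, Dg u x - Dg (uc e p c) x⟫))

noncomputable def MLd (ε R c : ℝ) (e p : Eu n) (u : Eu n → ℝ) (x : Eu n) (l : ℝ) : ℝ :=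
  (gk ε R e p (uh e p u c l) x * tf p (uh e p u c l) x * (tf p u x - c * sf e x)
      + gz ε R e p (uh e p u c l) x * (2 * uh e p u c l x * (u x - uc e p c x))) *
    (sf e x * (1 + (⟪p, Dg (uc e p c) x⟫ + l * ⟪p, Dg u x - Dg (uc e p c) x⟫)) * (qf p)⁻¹
    + tf p (uh e p u c l) x * (⟪e, Dg (uc e p c) x⟫ + l * ⟪e, Dg u x - Dg (uc e p c) x⟫))
  + gg ε R e p (uh e p u c l) x * (sf e x * ⟪p, Dg u x - Dg (uc e p c) x⟫ * (qf p)⁻¹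
    + (tf p u x - c * sf e x) * (⟪e, Dg (uc e p c) x⟫ + l * ⟪e, Dg u x - Dg (uc e p c) x⟫)
    + tf p (uh e p u c l) x * ⟪e, Dg u x - Dg (uc e p c) x⟫)

lemma hd_ML {x : Eu n} (hx : x ∈ Om e) : HasDerivAt (ML ε R c e p u x) (MLd ε R c e p u x l) l := by
  have hl := hasDerivAt_id l
  have h1 := (((((hl.mul_const ⟪p, Dg u x - Dg (uc e p c) x⟫).const_add ⟪p, Dg (uc e p c) x⟫).const_add
    1).const_mul (sf e x)).mul_const (qf p)⁻¹)
  have h2 := (hd_tf (e := e) (p := p) (u := u) (c := c) (l := l) x).mul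
    ((hl.mul_const ⟪e, Dg u x - Dg (uc e p c) x⟫).const_add ⟪e, Dg (uc e p c) x⟫)
  have h3 := (hd_gg (ε := ε) (R := R) (u := u) (c := c) (l := l) (p := p) hx).mul (h1.add h2)
  have h4 : HasDerivAt (ML ε R c e p u x) _ l := h3
  refine h4.congr_deriv ?_
  simp only [MLd, id, Pi.add_apply, Pi.mul_apply]
  ring

lemma jc_MLd (G : Geo e p u) :
    ContinuousOn (fun z : Eu n × ℝ => MLd ε R c e p u z.1 z.2) (Om e ×ˢ univ) := by
  have h1 := jc_uh G c
  have h2 := jc_tf G c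
  have h3 := jc_sf (e := e)
  have h4 := jc_rfi G c
  have h5 := jc_et G c R
  have h6 := jc_etd G c R
  have h7 := jc_ch G c ε
  have h8 := jc_chd G c ε
  have h9 := jc (smooth_tf G).continuousOn
  have h10 := jc G.C1.continuousOn
  have h11 := jc (contDiff_uc (e := e) (p := p) (c := c)).continuous.continuousOn (Ω := Om e)
  have h12 := jc (f := fun x => ⟪p, Dg (uc e p c) x⟫) (Ω := Om e) (by simp only [Dg_uc]; fun_prop)
  have h13 := jc (f := fun x => ⟪e, Dg (uc e p c) x⟫) (Ω := Om e) (by simp only [Dg_uc]; fun_prop)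
  have hD := cont_Dg (isOpen_Om e) G.C1
  have h14 := jc (f := fun x => ⟪p, Dg u x - Dg (uc e p c) x⟫) (Ω := Om e)
    (by simp only [Dg_uc]; fun_prop)
  have h15 := jc (f := fun x => ⟪e, Dg u x - Dg (uc e p c) x⟫) (Ω := Om e)
    (by simp only [Dg_uc]; fun_prop)
  have h16 : ContinuousOn (fun z : Eu n × ℝ => z.2) (Om e ×ˢ univ) := continuousOn_snd
  have hq : ContinuousOn (fun _ : Eu n × ℝ => (qf p)⁻¹) (Om e ×ˢ univ) := continuousOn_const
  have hc : ContinuousOn (fun _ : Eu n × ℝ => c) (Om e ×ˢ univ) := continuousOn_const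
  have h17 := h4.mul (h5.mul h7)
  have h18 := (h5.mul ((h8.mul h4).sub (h7.mul (h4.pow 2)))).mul h4
  have h19 := (h6.mul h7).mul h4
  have h20 := h9.sub (hc.mul h3)
  have h21 := h13.add (h16.mul h15)
  have h22 := ((h3.mul ((continuousOn_const (c := (1:ℝ))).add (h12.add (h16.mul h14)))).mul hq).add (h2.mul h21)
  exact ((((h18.mul h2).mul h20).add (h19.mul (((continuousOn_const (c := (2:ℝ))).mul h1).mul (h10.sub h11)))).mul
    h22).add (h17.mul ((((h3.mul h14).mul hq).add (h20.mul h21)).add (h2.mul h15)))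

lemma MLd_int (G : Geo e p u) (hε : 0 < ε) (hR : 0 < R) (l : ℝ) :
    ∫ x in Om e, MLd ε R c e p u x l = 0 := by
  have Gl := Geo_uh G c l
  have hT := TF_ph Gl hε hR
  have s0 := smooth_sf (e := e) (Om e)
  have s1 := smooth_tf G
  have s2 := smooth_tf Gl
  have s3 := smooth_rfi Gl
  have T1 := hT.mul ((s0.mul (s1.sub ((contDiffOn_const (c := c)).mul s0))).mul s3)
  have T2 := hT.mul (((contDiffOn_const (c := qf p)).mul (s2.mul (s1.sub ((contDiffOn_const (c := c)).mul s0)))).mul s3)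
  have i1 := T1.integral_fderiv (isOpen_Om e) p
  have i2 := T2.integral_fderiv (isOpen_Om e) e
  have j1 := T1.integrable_fderiv (isOpen_Om e) (a := fun _ => p) continuousOn_const
    (k := fun _ => 1) continuousOn_const
  have j2 := T2.integrable_fderiv (isOpen_Om e) (a := fun _ => e) continuousOn_const
    (k := fun _ => 1) continuousOn_const
  simp only [one_mul] at j1 j2
  have := integral_add j1 j2
  rw [i1, i2, add_zero] at this
  rw [← this]
  refine setIntegral_congr_fun (isOpen_Om e).measurableSet fun x hx => ?_
  have hω : HasFDerivAt (fun x => tf p u x - c * sf e x) (Lt p u x - c • Ls e) x :=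
    (hasFDerivAt_tf G hx).sub ((hasFDerivAt_sf x).const_mul c)
  have hg := hasFDerivAt_gg (ε := ε) (R := R) Gl hx
  have d1 : fderiv ℝ (fun x => (sf e x * (tf p u x - c * sf e x)) * (rf e p (uh e p u c l) x)⁻¹ *
      (et R (uh e p u c l) x * ch ε e p (uh e p u c l) x)) x = _ :=
    (hfd_congr (((hasFDerivAt_sf x).mul hω).mul hg)
      (g := (fun x => (sf e x * (tf p u x - c * sf e x)) * (rf e p (uh e p u c l) x)⁻¹ *
      (et R (uh e p u c l) x * ch ε e p (uh e p u c l) x)))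
      (fun y => by simp only [gg, Pi.mul_apply]; ring) (fun y => rfl)).fderiv
  have d2 : fderiv ℝ (fun x => (qf p * (tf p (uh e p u c l) x * (tf p u x - c * sf e x))) * (rf e p (uh e p u c l) x)⁻¹ *
      (et R (uh e p u c l) x * ch ε e p (uh e p u c l) x)) x = _ :=
    (hfd_congr ((((hasFDerivAt_tf Gl hx).mul hω).const_mul (qf p)).mul hg)
      (g := (fun x => (qf p * (tf p (uh e p u c l) x * (tf p u x - c * sf e x))) * (rf e p (uh e p u c l) x)⁻¹ *
      (et R (uh e p u c l) x * ch ε e p (uh e p u c l) x)))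
      (fun y => by simp only [gg, Pi.mul_apply]; ring) (fun y => rfl)).fderiv
  have d1' := congrArg (fun L => L p) d1
  have d2' := congrArg (fun L => L e) d2
  show _ = fderiv ℝ _ x p + fderiv ℝ _ x e
  erw [d1', d2']
  have hq := qf_pos p
  have hq2 := qf_sq p
  have n1 : ⟪e, e⟫ = (1:ℝ) := by rw [real_inner_self_eq_norm_sq, G.he]; norm_num
  have n2 : ⟪p, p⟫ = qf p ^ 2 - 1 := by rw [real_inner_self_eq_norm_sq]; linarith
  have n3 := G.hep
  have n4 : ⟪p, e⟫ = (0:ℝ) := by rw [real_inner_comm]; exact n3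
  have n5 : ⟪x, p⟫ = uh e p u c l x - qf p * tf p (uh e p u c l) x := by
    rw [real_inner_comm]; exact inner_N x
  have n6 : ⟪x, e⟫ = sf e x := real_inner_comm _ _
  have n7 := u_sub_uc (e := e) (p := p) (u := u) (c := c) x
  have m1 : ⟪p, Dg (uc e p c) x⟫ = qf p ^ 2 - 1 := by
    rw [Dg_uc, inner_add_right, inner_smul_right, n2, n4]; ring
  have m2 : ⟪e, Dg (uc e p c) x⟫ = c * qf p := by
    rw [Dg_uc, inner_add_right, inner_smul_right, n3, n1]; ring
  have m3 : ⟪Dg (uc e p c) x, p⟫ = qf p ^ 2 - 1 := by rw [real_inner_comm]; exact m1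
  have m4 : ⟪Dg (uc e p c) x, e⟫ = c * qf p := by rw [real_inner_comm]; exact m2
  have m5 : ⟪Dg u x, p⟫ = ⟪p, Dg u x⟫ := real_inner_comm _ _
  have m6 : ⟪Dg u x, e⟫ = ⟪e, Dg u x⟫ := real_inner_comm _ _
  simp only [MLd, Ls, Lt, Lz, Dg_uh G hx, ContinuousLinearMap.add_apply, ContinuousLinearMap.smul_apply,
      ContinuousLinearMap.sub_apply, innerSL_apply_apply, inner_add_left, inner_smul_left, inner_sub_left,
      smul_eq_mul, conj_trivial, inner_sub_right, n1, n2, n3, n4, n5, n6, n7, m1, m2, m3, m4, m5, m6, Pi.mul_apply]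
  field_simp
  ring

lemma ML_one (G : Geo e p u) {x : Eu n} (hx : x ∈ Om e) : ML ε R c e p u x 1 =
    Wg u x * nT e p u x * (et R u x * ch ε e p u x) := by
  have hq := qf_pos p
  have hW := Wg_pos u x
  have hr := rf_pos (p := p) (u := u) hx
  simp only [ML, uh_one, inner_sub_right, gg, nT, nE, nN]
  field_simp
  ring

lemma ML_zero (G : Geo e p u) {x : Eu n} (hx : x ∈ Om e) : ML ε R c e p u x 0 =
    Wg (uc e p c) x * nT e p (uc e p c) x * (et R (uc e p c) x * ch ε e p (uc e p c) x) := by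
  have hq := qf_pos p
  have hW := Wg_pos (uc e p c) x
  have hr := rf_pos (p := p) (u := uc e p c) hx
  simp only [ML, uh_zero, inner_sub_right, gg, nT, nE, nN]
  field_simp
  ring

lemma supp_compact_h (G : Geo e p u) (hε : 0 < ε) (c M : ℝ) :
    ∃ K, IsCompact K ∧ K ⊆ Om e ∧ ∀ x ∈ Om e, x ∉ K → ∀ l ∈ Icc (0:ℝ) 1,
      M < zf (uh e p u c l) x ∨ rf e p (uh e p u c l) x < ε := by
  have ht : ContinuousOn (tf p u) {x | 0 ≤ ⟪e, x⟫} := by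
    have := G.cont
    unfold tf; fun_prop
  refine ⟨{x | 0 ≤ ⟪e, x⟫} ∩ (closedBall 0 (√M) ∩ {x | 0 ≤ ⟪e, x⟫} ∩
    (fun x => (1 + |c|) * sf e x + (|tf p u x| + |c| * sf e x)) ⁻¹' Ici ε), ?_, ?_, ?_⟩
  · have hc : IsClosed {x : Eu n | 0 ≤ ⟪e, x⟫} := isClosed_le continuous_const (by fun_prop)
    have h1 : IsCompact (closedBall (0 : Eu n) (√M) ∩ {x | 0 ≤ ⟪e, x⟫}) :=
      (isCompact_closedBall _ _).inter_right hc
    have h2 : ContinuousOn (fun x => (1 + |c|) * sf e x + (|tf p u x| + |c| * sf e x))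
        (closedBall (0 : Eu n) (√M) ∩ {x | 0 ≤ ⟪e, x⟫}) := by
      have := ht.mono (inter_subset_right (s := closedBall (0 : Eu n) (√M)))
      unfold sf; fun_prop
    have h3 := h2.preimage_isClosed_of_isClosed h1.isClosed (isClosed_Ici (a := ε))
    exact ((h1.of_isClosed_subset h3 inter_subset_left)).inter_left hc
  · rintro x ⟨h0, ⟨h1, h2⟩, h3⟩
    rcases (show 0 ≤ ⟪e, x⟫ from h0).eq_or_lt with h | h
    · exfalso
      have h4 : tf p u x = 0 := by rw [tf, G.bd x h.symm]; simp
      have h5 : sf e x = 0 := h.symm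
      simp only [mem_preimage, mem_Ici, h4, h5] at h3
      simp at h3; linarith
    · exact h
  · intro x hx hxK l hl
    by_contra! hcon
    obtain ⟨h1, h2⟩ := hcon
    have hs : 0 < sf e x := hx
    refine hxK ⟨hs.le, ⟨?_, hs.le⟩, ?_⟩
    · rw [mem_closedBall_zero_iff]
      exact Real.le_sqrt_of_sq_le (by unfold zf at h1; nlinarith [sq_nonneg (uh e p u c l x)])
    · simp only [mem_preimage, mem_Ici]
      have h3 : rf e p (uh e p u c l) x ≤ sf e x + |tf p (uh e p u c l) x| := by
        rw [rf, Real.sqrt_le_iff]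
        refine ⟨by positivity, ?_⟩
        nlinarith [abs_nonneg (tf p (uh e p u c l) x), sq_abs (tf p (uh e p u c l) x)]
      have h4 : |tf p (uh e p u c l) x| ≤ |c| * sf e x + (|tf p u x| + |c| * sf e x) := by
        rw [tf_uh]
        have a1 : |c * sf e x| = |c| * sf e x := by rw [abs_mul, abs_of_pos hs]
        have a2 : |l * (tf p u x - c * sf e x)| ≤ |tf p u x| + |c| * sf e x := by
          rw [abs_mul, abs_of_nonneg hl.1]
          have := abs_sub (tf p u x) (c * sf e x)
          rw [a1] at this
          nlinarith [abs_nonneg (tf p u x - c * sf e x), hl.2]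
        exact (abs_add_le _ _).trans (by rw [a1]; linarith)
      nlinarith

lemma flux_cut (G : Geo e p u) (hε : 0 < ε) (hR : 0 < R) (c : ℝ) :
    ∫ x in Om e, Wg u x * nT e p u x * (et R u x * ch ε e p u x) =
    ∫ x in Om e, Wg (uc e p c) x * nT e p (uc e p c) x * (et R (uc e p c) x * ch ε e p (uc e p c) x) := by
  obtain ⟨K, hK, hKΩ, hK0⟩ := supp_compact_h G hε c (2 * R ^ 2)
  have hz : ∀ x ∈ Om e, x ∉ K → ∀ l ∈ Icc (0:ℝ) 1, MLd ε R c e p u x l = 0 := by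
    intro x hx hxK l hl
    rcases hK0 x hx hxK l hl with h | h
    · simp [MLd, gk, gz, gg, et_zero hR h.le, etd_zero hR h.le]
    · simp [MLd, gk, gz, gg, ch_zero hx h.le, chd_zero hx h.le]
  obtain ⟨-, h2⟩ := swap_int (isOpen_Om e) (jc_MLd (ε := ε) (R := R) (c := c) G) hK hKΩ hz
  simp only [MLd_int G hε hR, intervalIntegral.integral_zero] at h2
  have h3 : ∀ x ∈ Om e, ∫ l in (0:ℝ)..1, MLd ε R c e p u x l =
      Wg u x * nT e p u x * (et R u x * ch ε e p u x) -
      Wg (uc e p c) x * nT e p (uc e p c) x * (et R (uc e p c) x * ch ε e p (uc e p c) x) := by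
    intro x hx
    rw [← ML_one (c := c) G hx, ← ML_zero G hx]
    refine intervalIntegral.integral_eq_sub_of_hasDerivAt (fun l _ => hd_ML hx) ?_
    refine Continuous.intervalIntegrable ?_ _ _
    have := (jc_MLd (ε := ε) (R := R) (c := c) G).comp_continuous (f := fun l : ℝ => (x, l))
      (by fun_prop) (fun l => ⟨hx, mem_univ _⟩)
    exact this
  rw [setIntegral_congr_fun (isOpen_Om e).measurableSet h3] at h2
  have I1 : ∀ {v : Eu n → ℝ}, Geo e p v → IntegrableOn
      (fun x => Wg v x * nT e p v x * (et R v x * ch ε e p v x)) (Om e) := by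
    intro v Gv
    exact (TF_ph Gv hε hR).integrable_mul (isOpen_Om e)
      ((cont_Wg (isOpen_Om e) Gv.C1).mul (cont_nT Gv))
  rw [integral_sub (I1 G) (I1 (Geo_uc G.he G.hep c))] at h2
  linarith
end Bern

namespace Bern
open Filter Topology InnerProductSpace
variable {n : ℕ} {e p : Eu n} {u : Eu n → ℝ} {c l ε R : ℝ}

lemma fatou {α : Type*} [MeasurableSpace α] {μ : Measure α} {F : ℕ → α → ℝ} {f : α → ℝ}
    (hF : ∀ k, Integrable (F k) μ) (h0 : ∀ k, 0 ≤ᵐ[μ] F k)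
    (hlim : ∀ᵐ x ∂μ, Tendsto (fun k => F k x) atTop (𝓝 (f x))) {C : ℕ → ℝ} {c : ℝ}
    (hC : ∀ k, ∫ x, F k x ∂μ ≤ C k) (hc : Tendsto C atTop (𝓝 c)) :
    Integrable f μ ∧ ∫ x, f x ∂μ ≤ c := by
  have hm : AEStronglyMeasurable f μ :=
    aestronglyMeasurable_of_tendsto_ae atTop (fun k => (hF k).aestronglyMeasurable) hlim
  have hf0 : 0 ≤ᵐ[μ] f := by
    filter_upwards [hlim, ae_all_iff.2 h0] with x h1 h2
    exact ge_of_tendsto' h1 h2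
  have key : ∫⁻ x, ENNReal.ofReal (f x) ∂μ ≤ ENNReal.ofReal c := by
    have h1 : ∫⁻ x, ENNReal.ofReal (f x) ∂μ = ∫⁻ x, liminf (fun k => ENNReal.ofReal (F k x)) atTop ∂μ := by
      refine lintegral_congr_ae ?_
      filter_upwards [hlim] with x hx
      exact ((ENNReal.continuous_ofReal.tendsto _).comp hx).liminf_eq.symm
    rw [h1]
    refine (lintegral_liminf_le' fun k => (hF k).aestronglyMeasurable.aemeasurable.ennreal_ofReal).trans ?_
    have h2 : ∀ k, ∫⁻ x, ENNReal.ofReal (F k x) ∂μ ≤ ENNReal.ofReal (C k) := fun k => by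
      rw [← ofReal_integral_eq_lintegral_ofReal (hF k) (h0 k)]
      exact ENNReal.ofReal_le_ofReal (hC k)
    have h3 : Tendsto (fun k => ENNReal.ofReal (C k)) atTop (𝓝 (ENNReal.ofReal c)) :=
      (ENNReal.continuous_ofReal.tendsto _).comp hc
    rw [← h3.liminf_eq]
    exact liminf_le_liminf (Eventually.of_forall h2)
  have hc0 : 0 ≤ c := ge_of_tendsto' hc fun k => (integral_nonneg_of_ae (h0 k)).trans (hC k)
  have hi : Integrable f μ := ⟨hm, by
    rw [hasFiniteIntegral_iff_ofReal hf0]; exact key.trans_lt ENNReal.ofReal_lt_top⟩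
  refine ⟨hi, ?_⟩
  rw [integral_eq_lintegral_of_nonneg_ae hf0 hm]
  exact ENNReal.toReal_le_of_le_ofReal hc0 key

noncomputable def ee (k : ℕ) : ℝ := 1 / ((k : ℝ) + 1)
lemma ee_pos (k : ℕ) : 0 < ee k := by unfold ee; positivity
lemma ee_lim : Tendsto ee atTop (𝓝 0) := tendsto_one_div_add_atTop_nhds_zero_nat

lemma ch_lim {x : Eu n} (hx : x ∈ Om e) : Tendsto (fun k => ch (ee k) e p u x) atTop (𝓝 1) := by
  have h : Tendsto (fun k => 1 - ee k / rf e p u x) atTop (𝓝 (1 - 0 / rf e p u x)) :=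
    (ee_lim.div_const _).const_sub 1
  have h2 := (contDiff_mf.continuous.tendsto _).comp h
  have : mf (1 - 0 / rf e p u x) = 1 := by simp [mf]
  rw [this] at h2
  exact h2

lemma chd_lim {x : Eu n} : Tendsto (fun k => chd (ee k) e p u x) atTop (𝓝 0) := by
  have hc : Continuous fun t : ℝ => 2 * max 0 (1 - t / rf e p u x) * (t / rf e p u x ^ 2) := by fun_prop
  have h := (hc.tendsto 0).comp ee_lim
  simpa [chd, Function.comp_def] using h

lemma Geo0 (he : ‖e‖ = 1) : Geo e 0 (fun _ => 0) where
  he := he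
  hep := by simp
  C1 := contDiffOn_const
  cont := continuousOn_const
  bd := fun x _ => by simp

lemma rf0 {x : Eu n} (hx : x ∈ Om e) : rf e 0 (fun _ => 0) x = sf e x := by
  have : 0 < sf e x := hx
  simp [rf, tf, Real.sqrt_sq this.le]

lemma slab_bound (he : ‖e‖ = 1) (hR : 0 < R) : ∃ C, ∀ ε > 0,
    ∫ x in Om e, et R (fun _ => 0) x * chd ε e 0 (fun _ => 0) x ≤ C := by
  have G := Geo0 he
  refine ⟨∫ x in Om e ∩ closedBall 0 (2 * R), (16 / R : ℝ), fun ε hε => ?_⟩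
  have hT := TF_ph G hε hR
  have h1 := hT.integral_fderiv (isOpen_Om e) e
  have e1 : ∀ x ∈ Om e, fderiv ℝ (fun x => et R (fun _ => 0) x * ch ε e 0 (fun _ => 0) x) x e =
      et R (fun _ => 0) x * chd ε e 0 (fun _ => 0) x
       - (-(ch ε e 0 (fun _ => 0) x * etd R (fun _ => 0) x * (2 * sf e x))) := by
    intro x hx
    have hs : 0 < sf e x := hx
    rw [(hasFDerivAt_ph G hx).fderiv]
    have a1 : ⟪e, e⟫ = (1:ℝ) := by rw [real_inner_self_eq_norm_sq, he]; norm_num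
    have a2 : ⟪x, e⟫ = sf e x := real_inner_comm _ _
    have a3 : tf 0 (fun _ => (0:ℝ)) x = 0 := by simp [tf]
    rw [rf0 hx, a3]
    simp [Ls, Lz, a1, a2, hs.ne', he]
  rw [setIntegral_congr_fun (isOpen_Om e).measurableSet e1] at h1
  have I1 : IntegrableOn (fun x => et R (fun _ => 0) x * chd ε e 0 (fun _ => 0) x) (Om e) := by
    refine int_piece (R := R) G hε ((smooth_et G).continuousOn.mul (cont_chd G)) ?_
    rintro x hx (h | h)
    · simp [et_zero hR h]
    · simp [chd_zero hx h]
  have I2 : IntegrableOn (fun x => -(ch ε e 0 (fun _ => 0) x * etd R (fun _ => 0) x * (2 * sf e x))) (Om e) := by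
    refine int_piece (R := R) G hε ((((smooth_ch G).continuousOn.mul (cont_etd G)).mul
      (continuousOn_const.mul (smooth_sf _).continuousOn)).neg) ?_
    rintro x hx (h | h)
    · simp [etd_zero hR h]
    · simp [ch_zero hx h]
  rw [integral_sub I1 I2] at h1
  have hcl : MeasurableSet (closedBall (0 : Eu n) (2 * R)) := isClosed_closedBall.measurableSet
  rw [sub_eq_zero.1 h1, ← setIntegral_indicator hcl]
  refine setIntegral_mono_on I2 ?_ (isOpen_Om e).measurableSet fun x hx => ?_
  · refine (IntegrableOn.integrable_indicator ?_ hcl).integrableOn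
    exact integrableOn_const (measure_closedBall_lt_top).ne
  · have hs : 0 < sf e x := hx
    by_cases hz : 2 * R ^ 2 ≤ zf (fun _ => 0) x
    · rw [etd_zero hR hz]; simp only [mul_zero, zero_mul, neg_zero]
      exact indicator_nonneg (fun _ _ => by positivity) _
    · push Not at hz
      have hx2 : ‖x‖ ≤ 2 * R := by
        simp only [zf] at hz
        nlinarith [norm_nonneg x]
      rw [indicator_of_mem (by simpa using hx2)]
      have b1 := (abs_le.1 (abs_etd_le (u := fun _ : Eu n => (0:ℝ)) hR x)).1
      have b2 := ch_le_one (e := e) (p := 0) (u := fun _ => 0) hε x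
      have b3 := ch_nonneg (e := e) (p := 0) (u := fun _ => 0) (ε := ε) x
      have b4 : sf e x ≤ 2 * R := by
        have := real_inner_le_norm e x
        rw [he, one_mul] at this
        exact this.trans hx2
      have b5 := etd_nonpos (R := R) (u := fun _ : Eu n => (0:ℝ)) x
      calc -(ch ε e 0 (fun _ => 0) x * etd R (fun _ => 0) x * (2 * sf e x))
          = ch ε e 0 (fun _ => 0) x * ((-etd R (fun _ => 0) x) * (2 * sf e x)) := by ring
        _ ≤ 1 * ((4 / R ^ 2) * (2 * (2 * R))) := by
            refine mul_le_mul b2 ?_ ?_ zero_le_one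
            · refine mul_le_mul (by linarith) (by linarith) (by linarith) (by positivity)
            · exact mul_nonneg (by linarith) (by linarith)
        _ = 16 / R := by field_simp; ring

lemma slab_lim (he : ‖e‖ = 1) (hR : 0 < R) {ψ : Eu n → ℝ} (hψ : ContinuousOn ψ {x | 0 ≤ ⟪e, x⟫})
    (h0 : ∀ x, ⟪e, x⟫ = 0 → ψ x = 0) :
    Tendsto (fun k => ∫ x in Om e, et R (fun _ => 0) x * chd (ee k) e 0 (fun _ => 0) x * |ψ x|)
      atTop (𝓝 0) := by
  have G := Geo0 he
  obtain ⟨C, hC⟩ := slab_bound he hR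
  have hO : Om e ⊆ {x | 0 ≤ ⟪e, x⟫} := fun x hx => le_of_lt (show 0 < ⟪e, x⟫ from hx)
  have hc : IsClosed {x : Eu n | 0 ≤ ⟪e, x⟫} := isClosed_le continuous_const (by fun_prop)
  have hB : IsCompact (closedBall (0 : Eu n) (2 * R) ∩ {x | 0 ≤ ⟪e, x⟫}) :=
    (isCompact_closedBall _ _).inter_right hc
  have hψB : ContinuousOn (fun x => |ψ x|) (closedBall (0 : Eu n) (2 * R) ∩ {x | 0 ≤ ⟪e, x⟫}) :=
    (hψ.mono inter_subset_right).abs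
  obtain ⟨M, hM⟩ := hB.exists_bound_of_continuousOn hψB
  have nn : ∀ k, ∀ x ∈ Om e, 0 ≤ et R (fun _ => 0) x * chd (ee k) e 0 (fun _ => 0) x * |ψ x| :=
    fun k x hx => mul_nonneg (mul_nonneg (et_nonneg x) (chd_nonneg (ee_pos k) x)) (abs_nonneg _)
  have I0 : ∀ k, IntegrableOn (fun x => et R (fun _ => 0) x * chd (ee k) e 0 (fun _ => 0) x) (Om e) := by
    intro k
    refine int_piece (R := R) G (ee_pos k) ((smooth_et G).continuousOn.mul (cont_chd G)) ?_
    rintro x hx (h | h)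
    · simp [et_zero hR h]
    · simp [chd_zero hx h]
  have I1 : ∀ k, IntegrableOn (fun x => et R (fun _ => 0) x * chd (ee k) e 0 (fun _ => 0) x * |ψ x|) (Om e) := by
    intro k
    refine int_piece (R := R) G (ee_pos k) (((smooth_et G).continuousOn.mul (cont_chd G)).mul (hψ.mono hO).abs) ?_
    rintro x hx (h | h)
    · simp [et_zero hR h]
    · simp [chd_zero hx h]
  rw [Metric.tendsto_atTop]
  intro δ hδ
  set δ' := δ / (2 * (|C| + 1)) with hδ'
  have hδp : 0 < δ' := by positivity
  set K := (closedBall (0 : Eu n) (2 * R) ∩ {x | 0 ≤ ⟪e, x⟫}) ∩ (fun x => |ψ x|) ⁻¹' Ici δ' with hK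
  have hKc : IsCompact K :=
    hB.of_isClosed_subset (hψB.preimage_isClosed_of_isClosed hB.isClosed isClosed_Ici) inter_subset_left
  have hKO : K ⊆ Om e := by
    rintro x ⟨⟨_, h1⟩, h2⟩
    rcases (show 0 ≤ ⟪e, x⟫ from h1).eq_or_lt with h | h
    · exfalso
      simp only [mem_preimage, mem_Ici, h0 x h.symm, abs_zero] at h2; linarith
    · exact h
  obtain ⟨s0, hs0, hs0K⟩ : ∃ s0 > 0, ∀ x ∈ K, s0 ≤ sf e x := by
    rcases K.eq_empty_or_nonempty with h | h
    · exact ⟨1, one_pos, by simp [h]⟩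
    · obtain ⟨y, hy, hmin⟩ := hKc.exists_isMinOn h (f := sf e) (smooth_sf (Ω := K)).continuousOn
      exact ⟨sf e y, hKO hy, fun x hx => hmin hx⟩
  set V := ∫ x in K, (8 * |M| / s0 ^ 2 : ℝ) with hV
  have hV0 : 0 ≤ V := integral_nonneg fun x => by positivity
  have ev : ∀ᶠ k in atTop, ee k < δ / (2 * (V + 1)) :=
    ee_lim.eventually (gt_mem_nhds (by positivity))
  obtain ⟨N, hN⟩ := eventually_atTop.1 ev
  refine ⟨N, fun k hk => ?_⟩
  rw [Real.dist_eq, sub_zero, abs_of_nonneg (setIntegral_nonneg (isOpen_Om e).measurableSet (nn k))]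
  have bd : ∫ x in Om e, et R (fun _ => 0) x * chd (ee k) e 0 (fun _ => 0) x * |ψ x| ≤
      ∫ x in Om e, (δ' * (et R (fun _ => 0) x * chd (ee k) e 0 (fun _ => 0) x) +
        K.indicator (fun _ => ee k * (8 * |M| / s0 ^ 2)) x) := by
    refine setIntegral_mono_on (I1 k) ((I0 k).const_mul _ |>.add ?_) (isOpen_Om e).measurableSet fun x hx => ?_
    · refine (IntegrableOn.integrable_indicator ?_ hKc.measurableSet).integrableOn
      exact integrableOn_const hKc.measure_lt_top.ne
    · have p1 := et_nonneg (R := R) (u := fun _ : Eu n => (0:ℝ)) x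
      have p2 := chd_nonneg (e := e) (p := 0) (u := fun _ => 0) (ee_pos k) x
      by_cases hz : 2 * R ^ 2 ≤ zf (fun _ => 0) x
      · rw [et_zero hR hz]; simp only [mul_zero, zero_mul, zero_add]
        exact indicator_nonneg (fun _ _ => by have := ee_pos k; positivity) _
      push Not at hz
      have hx2 : ‖x‖ ≤ 2 * R := by
        simp only [zf] at hz
        nlinarith [norm_nonneg x]
      by_cases hxK : x ∈ K
      · rw [indicator_of_mem hxK]
        have hs := hs0K x hxK
        have q1 := et_le (R := R) (u := fun _ : Eu n => (0:ℝ)) x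
        have q2 : |ψ x| ≤ |M| := by
          have := hM x hxK.1
          rw [Real.norm_eq_abs, abs_abs] at this
          exact this.trans (le_abs_self _)
        have q3 : chd (ee k) e 0 (fun _ => 0) x ≤ 2 * (ee k / s0 ^ 2) := by
          unfold chd; rw [rf0 hx]
          have hk := ee_pos k
          have hsp : 0 < sf e x := hx
          have a1 : max 0 (1 - ee k / sf e x) ≤ 1 :=
            max_le zero_le_one (by have : 0 ≤ ee k / sf e x := by positivity
                                   linarith)
          have a2 : ee k / sf e x ^ 2 ≤ ee k / s0 ^ 2 := by gcongr
          have a3 : 0 ≤ ee k / sf e x ^ 2 := by positivity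
          nlinarith
        have q4 : et R (fun _ => 0) x * chd (ee k) e 0 (fun _ => 0) x * |ψ x| ≤
            4 * (2 * (ee k / s0 ^ 2)) * |M| := by
          have := ee_pos k
          gcongr
        have q5 : 0 ≤ δ' * (et R (fun _ => 0) x * chd (ee k) e 0 (fun _ => 0) x) := by positivity
        have q6 : 4 * (2 * (ee k / s0 ^ 2)) * |M| = ee k * (8 * |M| / s0 ^ 2) := by ring
        linarith
      · rw [indicator_of_notMem hxK, add_zero]
        have : |ψ x| < δ' := by
          by_contra! hcon
          exact hxK ⟨⟨by simpa using hx2, le_of_lt (show 0 < ⟪e, x⟫ from hx)⟩, hcon⟩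
        nlinarith [mul_nonneg p1 p2]
  refine bd.trans_lt ?_
  rw [integral_add ((I0 k).const_mul _) ((IntegrableOn.integrable_indicator
    (integrableOn_const hKc.measure_lt_top.ne) hKc.measurableSet).integrableOn), integral_const_mul,
    setIntegral_indicator hKc.measurableSet, inter_eq_self_of_subset_right hKO, integral_const_mul]
  have b1 : δ' * ∫ x in Om e, et R (fun _ => 0) x * chd (ee k) e 0 (fun _ => 0) x ≤ δ / 2 := by
    have := hC (ee k) (ee_pos k)
    calc _ ≤ δ' * (|C| + 1) := by
            refine mul_le_mul_of_nonneg_left (this.trans ?_) hδp.le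
            linarith [le_abs_self C]
      _ = δ / 2 := by rw [hδ']; field_simp
  have b2 : ee k * V < δ / 2 := by
    have h1 := hN k hk
    have h2 : δ / (2 * (V + 1)) * (V + 1) = δ / 2 := by field_simp
    have := ee_pos k
    nlinarith
  linarith
end Bern

namespace Bern
open Filter Topology InnerProductSpace
variable {n : ℕ} {e p : Eu n} {u : Eu n → ℝ} {c l ε R : ℝ}

noncomputable def b0 (c : ℝ) (e p : Eu n) (u : Eu n → ℝ) (x : Eu n) : ℝ := ⟪Dg (uc e p c) x, Dg u x⟫
noncomputable def b1 (c : ℝ) (e p : Eu n) (u : Eu n → ℝ) (x : Eu n) : ℝ :=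
  ⟪Dg u x - Dg (uc e p c) x, Dg u x⟫

noncomputable def FJ (ε R c : ℝ) (e p : Eu n) (u : Eu n → ℝ) (x : Eu n) (l : ℝ) : ℝ :=
  (Wg u x)⁻¹ * (b1 c e p u x * (et R (uh e p u c l) x * ch ε e 0 (fun _ => 0) x)
    + (u x - uc e p c x) * (etd R (uh e p u c l) x *
        (2 * (⟪x, Dg u x⟫ + uh e p u c l x * (b0 c e p u x + l * b1 c e p u x))) * ch ε e 0 (fun _ => 0) x
      + et R (uh e p u c l) x * (chd ε e 0 (fun _ => 0) x * ⟪e, Dg u x⟫)))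

lemma cont_b0 (G : Geo e p u) : ContinuousOn (b0 c e p u) (Om e) := by
  have h1 := cont_Dg (isOpen_Om e) G.C1
  have h2 := cont_Dg (isOpen_Om e) (Geo_uc G.he G.hep c).C1
  unfold b0; exact h2.inner h1
lemma cont_b1 (G : Geo e p u) : ContinuousOn (b1 c e p u) (Om e) := by
  have h1 := cont_Dg (isOpen_Om e) G.C1
  have h2 := cont_Dg (isOpen_Om e) (Geo_uc G.he G.hep c).C1
  unfold b1; exact (h1.sub h2).inner h1

lemma jc_FJ (G : Geo e p u) : ContinuousOn (fun z : Eu n × ℝ => FJ ε R c e p u z.1 z.2) (Om e ×ˢ univ) := by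
  have G0 := Geo0 G.he
  have hD := cont_Dg (isOpen_Om e) G.C1
  have w := jc ((cont_Wg (isOpen_Om e) G.C1).inv₀ fun x _ => (Wg_pos u x).ne')
  have k0 := jc (cont_b0 (c := c) G)
  have k1 := jc (cont_b1 (c := c) G)
  have k2 := jc (G.C1.continuousOn.sub (Geo_uc G.he G.hep c).C1.continuousOn)
  have k3 := jc (continuousOn_id.inner (𝕜 := ℝ) hD)
  have k4 := jc ((continuousOn_const (c := e)).inner (𝕜 := ℝ) hD)
  have k5 := jc (smooth_ch (ε := ε) G0).continuousOn
  have k6 := jc (cont_chd (ε := ε) G0)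
  have k7 := jc_et G c R
  have k8 := jc_etd G c R
  have k9 := jc_uh G c
  exact w.mul ((k1.mul (k7.mul k5)).add (k2.mul (((k8.mul (continuousOn_const.mul (k3.add (k9.mul
    (k0.add (continuousOn_snd.mul k1)))))).mul k5).add (k7.mul (k6.mul k4)))))

lemma zf_ge (x : Eu n) : zf (fun _ => 0) x ≤ zf u x := by simp [zf, sq_nonneg]

lemma FJ_zero (hR : 0 < R) {x : Eu n} (hx : x ∈ Om e)
    (h : 2 * R ^ 2 < zf (fun _ => 0) x ∨ rf e 0 (fun _ => 0) x < ε) : FJ ε R c e p u x l = 0 := by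
  rcases h with h | h
  · have : 2 * R ^ 2 ≤ zf (uh e p u c l) x := h.le.trans (zf_ge x)
    simp [FJ, et_zero hR this, etd_zero hR this]
  · simp [FJ, ch_zero hx h.le, chd_zero hx h.le]

lemma int_FJ (S : Sol e p u) (hε : 0 < ε) (hR : 0 < R) (c : ℝ) :
    IntegrableOn (fun x => ∫ l in (0:ℝ)..1, FJ ε R c e p u x l) (Om e) ∧
    ∫ x in Om e, ∫ l in (0:ℝ)..1, FJ ε R c e p u x l = 0 := by
  have G := S.toGeo
  have G0 := Geo0 G.he
  obtain ⟨K, h1, h2, h3⟩ := supp_compact G0 hε (2 * R ^ 2)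
  obtain ⟨i1, i2⟩ := swap_int (isOpen_Om e) (jc_FJ (ε := ε) (R := R) (c := c) G) h1 h2
    (fun x hx hxK l _ => FJ_zero hR hx (h3 x hx hxK))
  refine ⟨i1, ?_⟩
  rw [i2]
  have key : ∀ l : ℝ, ∫ x in Om e, FJ ε R c e p u x l = 0 := by
    intro l
    have Gl := Geo_uh G c l
    have hT : TF (Om e) (fun x => (u x - uc e p c x) * (et R (uh e p u c l) x * ch ε e 0 (fun _ => 0) x)) := by
      refine ⟨(G.C1.sub (Geo_uc G.he G.hep c).C1).mul ((smooth_et Gl).mul (smooth_ch G0)), K, h1, h2,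
        fun x hx hxK => ?_⟩
      rcases h3 x hx hxK with h | h
      · simp [et_zero hR (h.le.trans (zf_ge (u := uh e p u c l) x))]
      · simp [ch_zero hx h.le]
    have h := H0 (isOpen_Om e) S.C2 S.df hT
    rw [← h]
    refine setIntegral_congr_fun (isOpen_Om e).measurableSet fun x hx => ?_
    have hs : 0 < sf e x := hx
    have d := ((hasFDerivAt_u G hx).sub (hasFDerivAt_u (Geo_uc G.he G.hep c) hx)).mul
      ((hasFDerivAt_et (R := R) Gl hx).mul (hasFDerivAt_ch (ε := ε) G0 hx))
    have a3 : tf 0 (fun _ => (0:ℝ)) x = 0 := by simp [tf]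
    have a4 : Ls e (Dg u x) = ⟪e, Dg u x⟫ := rfl
    have a5 : Lz (uh e p u c l) x (Dg u x) = 2 * (⟪x, Dg u x⟫ + uh e p u c l x * (b0 c e p u x + l * b1 c e p u x)) := by
      simp only [Lz, ContinuousLinearMap.smul_apply, ContinuousLinearMap.add_apply, innerSL_apply_apply,
        Dg_uh G hx, inner_add_left, inner_smul_left, smul_eq_mul, b0, b1, conj_trivial]
    have d' : fderiv ℝ (fun x => (u x - uc e p c x) * (et R (uh e p u c l) x * ch ε e 0 (fun _ => 0) x)) x = _ := d.fderiv
    simp only [d']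
    rw [rf0 hx, a3]
    simp only [Pi.mul_apply, Pi.sub_apply, ContinuousLinearMap.smul_apply, ContinuousLinearMap.add_apply, ContinuousLinearMap.sub_apply, innerSL_apply_apply, smul_eq_mul, a4, a5, zero_div, zero_mul, zero_smul, ContinuousLinearMap.zero_apply, div_self hs.ne', FJ, one_mul, add_zero]
    have a6 : b1 c e p u x = ⟪Dg u x, Dg u x⟫ - ⟪Dg (uc e p c) x, Dg u x⟫ := by
      rw [b1, inner_sub_left]
    rw [a6]; ring
  simp [key]

/-- length of the homotopy inside the cutoff window -/
noncomputable def len (R c : ℝ) (e p : Eu n) (u : Eu n → ℝ) (x : Eu n) : ℝ :=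
  ∫ l in (0:ℝ)..1, |u x - uc e p c x| * |etd R (uh e p u c l) x|

lemma one_add_inner_le (f g : Eu n → ℝ) (x : Eu n) : 1 + ⟪Dg f x, Dg g x⟫ ≤ Wg g x * Wg f x := by
  have h1 := Wg_sq f x
  have h2 := Wg_sq g x
  have h3 := real_inner_le_norm (Dg f x) (Dg g x)
  have h4 := Wg_pos f x
  have h5 := Wg_pos g x
  have : (1 + ‖Dg f x‖ * ‖Dg g x‖) ^ 2 ≤ (Wg g x * Wg f x) ^ 2 := by
    rw [mul_pow, h1, h2]; nlinarith [sq_nonneg (‖Dg f x‖ - ‖Dg g x‖)]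
  have := (sq_le_sq₀ (by positivity) (by positivity)).1 this
  linarith

lemma norm_Dg_le (u : Eu n → ℝ) (x : Eu n) : ‖Dg u x‖ ≤ Wg u x := by
  have h1 := Wg_sq u x
  have h4 := Wg_pos u x
  nlinarith [norm_nonneg (Dg u x)]

lemma cont_l {F : Eu n → ℝ → ℝ} (h : ContinuousOn (fun z : Eu n × ℝ => F z.1 z.2) (Om e ×ˢ univ)) {x : Eu n}
    (hx : x ∈ Om e) : Continuous (F x) := by
  have h2 : ContinuousOn (fun l : ℝ => ((x, l) : Eu n × ℝ)) univ := by fun_prop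
  have := h.comp h2 fun l _ => ⟨hx, mem_univ _⟩
  exact continuousOn_univ.1 this

lemma U_pt (G : Geo e p u) (hR : 0 < R) (hε : 0 < ε) {x : Eu n} (hx : x ∈ Om e) :
    ch ε e 0 (fun _ => 0) x * (et R u x * Wg u x) ≤ (∫ l in (0:ℝ)..1, FJ ε R c e p u x l)
      + (et R (uc e p c) x * Wg (uc e p c) x + 4 * R * len R c e p u x
      + 4 * (et (2 * R) (fun _ => 0) x * chd ε e 0 (fun _ => 0) x * |u x - uc e p c x|)) := by
  set C0 := ch ε e 0 (fun _ => 0) x with hC0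
  set D0 := chd ε e 0 (fun _ => 0) x with hD0
  set W := Wg u x with hW
  have W1 : 1 ≤ W := one_le_Wg u x
  have W0 : 0 < W := Wg_pos u x
  have c0 : 0 ≤ C0 := ch_nonneg x
  have c1 : C0 ≤ 1 := ch_le_one hε x
  have d0 : 0 ≤ D0 := chd_nonneg hε x
  set P : ℝ → ℝ := fun l => W⁻¹ * C0 * (et R (uh e p u c l) x * (1 + b0 c e p u x + l * b1 c e p u x)) with hP
  set P' : ℝ → ℝ := fun l => W⁻¹ * C0 * ((etd R (uh e p u c l) x * (2 * uh e p u c l x * (u x - uc e p c x))) *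
    (1 + b0 c e p u x + l * b1 c e p u x) + et R (uh e p u c l) x * b1 c e p u x) with hP'
  have hd : ∀ l, HasDerivAt P (P' l) l := by
    intro l
    have h1 := hd_et (R := R) (e := e) (p := p) (u := u) (c := c) (l := l) x
    have h2 := ((hasDerivAt_id l).mul_const (b1 c e p u x)).const_add (1 + b0 c e p u x)
    have h3 := (h1.mul h2).const_mul (W⁻¹ * C0)
    refine h3.congr_deriv ?_
    simp [P']
  have ce := cont_l (F := fun x l => et R (uh e p u c l) x) (jc_et G c R) hx
  have ced := cont_l (F := fun x l => etd R (uh e p u c l) x) (jc_etd G c R) hx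
  have cu := cont_l (F := fun x l => uh e p u c l x) (jc_uh G c) hx
  have cP' : Continuous P' := by
    simp only [P']; fun_prop
  have cF := cont_l (F := fun x l => FJ ε R c e p u x l) (jc_FJ (ε := ε) (R := R) (c := c) G) hx
  have hFTC := intervalIntegral.integral_eq_sub_of_hasDerivAt (fun l _ => hd l) (cP'.intervalIntegrable 0 1)
  have e1 : P 1 = C0 * (et R u x * W) := by
    have : 1 + b0 c e p u x + b1 c e p u x = W ^ 2 := by
      rw [b0, b1, inner_sub_left, Wg_sq, real_inner_self_eq_norm_sq]; ring
    simp only [P, uh_one, one_mul, this]; field_simp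
  have e0 : P 0 ≤ et R (uc e p c) x * Wg (uc e p c) x := by
    have h1 : 1 + b0 c e p u x ≤ W * Wg (uc e p c) x := one_add_inner_le _ _ _
    have h2 : 0 ≤ et R (uc e p c) x := et_nonneg x
    have h3 := Wg_pos (uc e p c) x
    calc P 0 = W⁻¹ * C0 * (et R (uc e p c) x * (1 + b0 c e p u x)) := by simp [P, uh_zero]
      _ ≤ W⁻¹ * C0 * (et R (uc e p c) x * (W * Wg (uc e p c) x)) := by gcongr
      _ = C0 * (et R (uc e p c) x * Wg (uc e p c) x) := by field_simp
      _ ≤ 1 * (et R (uc e p c) x * Wg (uc e p c) x) := by gcongr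
      _ = _ := one_mul _
  have pw : ∀ l, P' l ≤ FJ ε R c e p u x l + (4 * R * (|u x - uc e p c x| * |etd R (uh e p u c l) x|)
      + 4 * (et (2 * R) (fun _ => 0) x * D0 * |u x - uc e p c x|)) := by
    intro l
    set φ := u x - uc e p c x
    set E := et R (uh e p u c l) x with hE
    set Ed := etd R (uh e p u c l) x with hEd
    have id1 : P' l - FJ ε R c e p u x l =
      W⁻¹ * C0 * (φ * Ed * (2 * uh e p u c l x - 2 * ⟪x, Dg u x⟫)) - W⁻¹ * ⟪e, Dg u x⟫ * (φ * E * D0) := by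
      simp only [P', FJ]; ring
    have t2 : -(W⁻¹ * ⟪e, Dg u x⟫ * (φ * E * D0)) ≤ 4 * (et (2 * R) (fun _ => 0) x * D0 * |φ|) := by
      have k1 : |W⁻¹ * ⟪e, Dg u x⟫| ≤ 1 := by
        rw [abs_mul, abs_of_pos (by positivity), inv_mul_le_iff₀ W0, mul_one]
        refine (abs_real_inner_le_norm _ _).trans ?_
        rw [G.he, one_mul]; exact norm_Dg_le u x
      have k2 : E ≤ 4 * et (2 * R) (fun _ => 0) x := by
        by_cases hz : 2 * R ^ 2 ≤ zf (uh e p u c l) x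
        · rw [hE, et_zero hR hz]; have := et_nonneg (R := 2 * R) (u := fun _ => 0) x; positivity
        · have : 1 ≤ et (2 * R) (fun _ => 0) x := et_ge_one (by positivity)
            ((zf_ge (u := uh e p u c l) x).trans (by nlinarith))
          have := et_le (R := R) (u := uh e p u c l) x
          linarith
      have k3 : 0 ≤ E := et_nonneg x
      calc -(W⁻¹ * ⟪e, Dg u x⟫ * (φ * E * D0)) ≤ |W⁻¹ * ⟪e, Dg u x⟫ * (φ * E * D0)| := neg_le_abs _
        _ = |W⁻¹ * ⟪e, Dg u x⟫| * (|φ| * E * D0) := by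
            rw [abs_mul (W⁻¹ * _), abs_mul (φ * E), abs_mul φ, abs_of_nonneg k3, abs_of_nonneg d0]
        _ ≤ 1 * (|φ| * (4 * et (2 * R) (fun _ => 0) x) * D0) := by gcongr
        _ = _ := by ring
    have t1 : W⁻¹ * C0 * (φ * Ed * (2 * uh e p u c l x - 2 * ⟪x, Dg u x⟫)) ≤ 4 * R * (|φ| * |Ed|) := by
      by_cases hz : 2 * R ^ 2 ≤ zf (uh e p u c l) x
      · rw [hEd, etd_zero hR hz]; simp
      · push Not at hz
        have k1 : |⟪x, Dg u x⟫| ≤ ‖x‖ * W := (abs_real_inner_le_norm _ _).trans (by gcongr; exact norm_Dg_le u x)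
        have k2 : |2 * uh e p u c l x - 2 * ⟪x, Dg u x⟫| ≤ 4 * R * W := by
          have k3 : ‖x‖ + |uh e p u c l x| ≤ 2 * R := by
            simp only [zf] at hz
            rw [← sq_abs (uh e p u c l x)] at hz
            have : (‖x‖ + |uh e p u c l x|) ^ 2 ≤ (2 * R) ^ 2 := by
              nlinarith [sq_nonneg (‖x‖ - |uh e p u c l x|)]
            exact (sq_le_sq₀ (by positivity) (by positivity)).1 this
          calc |2 * uh e p u c l x - 2 * ⟪x, Dg u x⟫| ≤ |2 * uh e p u c l x| + |2 * ⟪x, Dg u x⟫| := abs_sub _ _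
            _ = 2 * |uh e p u c l x| + 2 * |⟪x, Dg u x⟫| := by rw [abs_mul, abs_mul]; norm_num
            _ ≤ 2 * (|uh e p u c l x| * W) + 2 * (‖x‖ * W) := by
              gcongr; nlinarith [abs_nonneg (uh e p u c l x)]
            _ = 2 * (‖x‖ + |uh e p u c l x|) * W := by ring
            _ ≤ 2 * (2 * R) * W := by gcongr
            _ = _ := by ring
        calc W⁻¹ * C0 * (φ * Ed * (2 * uh e p u c l x - 2 * ⟪x, Dg u x⟫))
            ≤ |W⁻¹ * C0 * (φ * Ed * (2 * uh e p u c l x - 2 * ⟪x, Dg u x⟫))| := le_abs_self _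
          _ = W⁻¹ * C0 * (|φ| * |Ed| * |2 * uh e p u c l x - 2 * ⟪x, Dg u x⟫|) := by
              rw [abs_mul, abs_mul (φ * Ed), abs_mul φ, abs_of_nonneg (by positivity : 0 ≤ W⁻¹ * C0)]
          _ ≤ W⁻¹ * 1 * (|φ| * |Ed| * (4 * R * W)) := by gcongr
          _ = _ := by field_simp
    linarith
  have i1 : IntervalIntegrable (fun l => FJ ε R c e p u x l) volume 0 1 := cF.intervalIntegrable _ _
  have i2 : IntervalIntegrable (fun l => 4 * R * (|u x - uc e p c x| * |etd R (uh e p u c l) x|)) volume 0 1 :=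
    Continuous.intervalIntegrable (by fun_prop) _ _
  have i3 : IntervalIntegrable (fun l : ℝ => 4 * (et (2 * R) (fun _ => 0) x * D0 * |u x - uc e p c x|)) volume 0 1 :=
    Continuous.intervalIntegrable (by fun_prop) _ _
  have m := intervalIntegral.integral_mono_on (zero_le_one) (cP'.intervalIntegrable 0 1) (i1.add (i2.add i3)) (fun l _ => pw l)
  rw [hFTC, intervalIntegral.integral_add i1 (i2.add i3), intervalIntegral.integral_add i2 i3,
    intervalIntegral.integral_const_mul, intervalIntegral.integral_const, e1] at m
  simp only [sub_zero, one_smul] at m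
  unfold len
  linarith

end Bern

namespace Bern
open Filter Topology InnerProductSpace
variable {n : ℕ} {e p : Eu n} {u : Eu n → ℝ} {c l ε R : ℝ}

lemma int_ball {f : Eu n → ℝ} (hf : Continuous f) {M : ℝ} (h : ∀ x, M < ‖x‖ → f x = 0) : Integrable f := by
  refine hf.integrable_of_hasCompactSupport ?_
  refine HasCompactSupport.intro (isCompact_closedBall (0 : Eu n) M) fun x hx => h x ?_
  simpa using hx

lemma cont_et {v : Eu n → ℝ} (hv : Continuous v) : Continuous (et R v) := by
  unfold et mf zf; fun_prop

lemma et_zero_norm (hR : 0 < R) {x : Eu n} (h : 2 * R < ‖x‖) : et R u x = 0 := by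
  refine et_zero hR ?_
  unfold zf; nlinarith [sq_nonneg (u x)]

lemma Wg_uc (x : Eu n) : Wg (uc e p c) x = Wg (uc e p c) 0 := by
  simp only [Wg, Dg_uc]

lemma int_uc (hR : 0 < R) (c : ℝ) : Integrable (fun x => et R (uc e p c) x * Wg (uc e p c) x) := by
  simp only [Wg_uc (e := e) (p := p) (c := c)]
  refine (int_ball (M := 2 * R) (cont_et contDiff_uc.continuous) fun x hx => et_zero_norm hR hx).mul_const _

lemma U_le (S : Sol e p u) (hR : 0 < R) (c : ℝ) {Lb : Eu n → ℝ} (hLb : IntegrableOn Lb (Om e))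
    (hl : ∀ x ∈ Om e, len R c e p u x ≤ Lb x) :
    IntegrableOn (fun x => et R u x * Wg u x) (Om e) ∧
    ∫ x in Om e, et R u x * Wg u x ≤ (∫ x in Om e, et R (uc e p c) x * Wg (uc e p c) x)
      + 4 * R * ∫ x in Om e, Lb x := by
  have G := S.toGeo
  have G0 := Geo0 G.he
  have mO := (isOpen_Om e).measurableSet
  have hlim := slab_lim G.he (by positivity : 0 < 2 * R) (ψ := fun x => u x - uc e p c x)
    (G.cont.sub contDiff_uc.continuous.continuousOn)
    (fun x hx => by simp [G.bd x hx, uc, sf, hx])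
  have hI : ∀ k, IntegrableOn (fun x => ch (ee k) e 0 (fun _ => 0) x * (et R u x * Wg u x)) (Om e) := by
    intro k
    refine int_piece (R := R) G0 (ee_pos k) ((smooth_ch G0).continuousOn.mul ((smooth_et G).continuousOn.mul
      (cont_Wg (isOpen_Om e) G.C1))) ?_
    rintro x hx (h | h)
    · simp [et_zero hR (h.trans (zf_ge (u := u) x))]
    · simp [ch_zero hx h]
  have hI2 : ∀ k, IntegrableOn (fun x => et (2 * R) (fun _ => 0) x * chd (ee k) e 0 (fun _ => 0) x * |u x - uc e p c x|) (Om e) := by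
    intro k
    refine int_piece (R := 2 * R) G0 (ee_pos k) (((smooth_et G0).continuousOn.mul (cont_chd G0)).mul
      (G.C1.continuousOn.sub contDiff_uc.continuous.continuousOn).abs) ?_
    rintro x hx (h | h)
    · simp [et_zero (by positivity : 0 < 2 * R) h]
    · simp [chd_zero hx h]
  have huc := (int_uc (e := e) (p := p) hR c).integrableOn (s := Om e)
  refine fatou (C := fun k => (∫ x in Om e, et R (uc e p c) x * Wg (uc e p c) x)
      + 4 * R * (∫ x in Om e, Lb x) + 4 * ∫ x in Om e, et (2 * R) (fun _ => 0) x * chd (ee k) e 0 (fun _ => 0) x * |u x - uc e p c x|)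
    hI (fun k => ?_) ?_ (fun k => ?_) ?_
  · filter_upwards with x
    exact mul_nonneg (ch_nonneg x) (mul_nonneg (et_nonneg x) (Wg_pos u x).le)
  · filter_upwards [ae_restrict_mem mO] with x hx
    simpa using (ch_lim (p := 0) (u := fun _ => 0) hx).mul_const (et R u x * Wg u x)
  · obtain ⟨j1, j2⟩ := int_FJ S (ee_pos k) hR c
    have j3 : IntegrableOn (fun x => 4 * R * Lb x) (Om e) := hLb.const_mul _
    have j4 := (hI2 k).const_mul 4
    have m := setIntegral_mono_on (hI k) (j1.add ((huc.add j3).add j4)) mO (fun x hx => by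
      have h1 := U_pt (c := c) G hR (ee_pos k) hx
      have h2 : 4 * R * len R c e p u x ≤ 4 * R * Lb x := by gcongr; exact hl x hx
      simp only [Pi.add_apply]
      linarith)
    have s1 : ∫ x in Om e, ((fun x => ∫ l in (0:ℝ)..1, FJ (ee k) R c e p u x l) + (((fun x => et R (uc e p c) x * Wg (uc e p c) x) + fun x => 4 * R * Lb x) + fun x => 4 * (et (2 * R) (fun _ => 0) x * chd (ee k) e 0 (fun _ => 0) x * |u x - uc e p c x|))) x = (∫ x in Om e, et R (uc e p c) x * Wg (uc e p c) x)
      + 4 * R * (∫ x in Om e, Lb x) + 4 * ∫ x in Om e, et (2 * R) (fun _ => 0) x * chd (ee k) e 0 (fun _ => 0) x * |u x - uc e p c x| := by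
      rw [integral_add' j1 ((huc.add j3).add j4), integral_add' (huc.add j3) j4, integral_add' huc j3, j2,
        integral_const_mul, integral_const_mul, zero_add]
    exact m.trans s1.le
  · have := (hlim.const_mul 4).const_add ((∫ x in Om e, et R (uc e p c) x * Wg (uc e p c) x)
      + 4 * R * (∫ x in Om e, Lb x))
    simpa using this

/-- clamp -/
noncomputable def cl (k y : ℝ) : ℝ := max (-k) (min y k)

lemma cl_neg {k : ℝ} (hk : 0 ≤ k) (y : ℝ) : cl k (-y) = - cl k y := by
  unfold cl
  rcases le_total y k with h1 | h1 <;> rcases le_total (-k) y with h2 | h2 <;>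
  rcases le_total (-y) k with h3 | h3 <;> rcases le_total (-k) (-y) with h4 | h4 <;>
  simp [*] <;> linarith

lemma window1 {a b k M : ℝ} {g : ℝ → ℝ} (hg : Continuous g) (hak : |a| ≤ k) (h0 : ∀ l, 0 ≤ g l) (hM : ∀ l, g l ≤ M)
    (hz : ∀ l, k < |a + l * (b - a)| → g l = 0) (hab : -k ≤ b) :
    ∫ l in (0:ℝ)..1, |b - a| * g l ≤ M * |cl k b - a| := by
  have M0 : 0 ≤ M := (h0 0).trans (hM 0)
  have ha := abs_le.1 hak
  have ci : ∀ s t : ℝ, IntervalIntegrable (fun l => |b - a| * g l) volume s t := fun s t =>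
    (continuous_const.mul hg).intervalIntegrable s t
  have bd : ∀ t : ℝ, 0 ≤ t → ∫ l in (0:ℝ)..t, |b - a| * g l ≤ t * (|b - a| * M) := by
    intro t ht
    have := intervalIntegral.integral_mono_on ht (ci 0 t)
      (continuous_const.intervalIntegrable 0 t) (fun l _ => mul_le_mul_of_nonneg_left (hM l) (abs_nonneg (b - a)))
    rw [intervalIntegral.integral_const, sub_zero, smul_eq_mul] at this
    exact this
  rcases le_or_gt b k with h | h
  · have : cl k b = b := by simp [cl, h, hab]
    rw [this]; have := bd 1 zero_le_one; linarith
  · have hc : cl k b = k := by simp [cl, h.le]; linarith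
    have hba : 0 < b - a := by linarith
    set t := (k - a) / (b - a) with ht
    have t0 : 0 ≤ t := div_nonneg (by linarith) hba.le
    have t1 : t ≤ 1 := (div_le_one hba).2 (by linarith)
    have e1 : t * (b - a) = k - a := div_mul_cancel₀ _ hba.ne'
    have i2 : ∫ l in t..1, |b - a| * g l = 0 := by
      rw [intervalIntegral.integral_of_le t1]
      refine setIntegral_eq_zero_of_forall_eq_zero fun l hl => ?_
      rw [hz l, mul_zero]
      refine lt_of_lt_of_le ?_ (le_abs_self _)
      nlinarith [hl.1]
    rw [← intervalIntegral.integral_add_adjacent_intervals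
      (ci 0 t) (ci t 1), i2, hc]
    have := bd t t0
    rw [abs_of_pos hba] at this ⊢
    rw [abs_of_nonneg (by linarith : 0 ≤ k - a)]
    nlinarith

lemma window {a b k M : ℝ} {g : ℝ → ℝ} (hg : Continuous g) (hak : |a| ≤ k) (h0 : ∀ l, 0 ≤ g l) (hM : ∀ l, g l ≤ M)
    (hz : ∀ l, k < |a + l * (b - a)| → g l = 0) :
    ∫ l in (0:ℝ)..1, |b - a| * g l ≤ M * |cl k b - a| := by
  rcases le_total (-k) b with h | h
  · exact window1 hg hak h0 hM hz h
  · have hk := (abs_nonneg a).trans hak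
    have := window1 (k := k) (a := -a) (b := -b) hg (by rwa [abs_neg]) h0 hM (fun l hl => hz l (by
      rw [← abs_neg]; convert hl using 2; ring)) (by linarith)
    rw [cl_neg hk] at this
    have e1 : |-b - -a| = |b - a| := by rw [← abs_neg]; congr 1; ring
    have e2 : |-cl k b - -a| = |cl k b - a| := by rw [← abs_neg]; congr 1; ring
    rwa [e1, e2] at this

lemma len_le (G : Geo e p u) (hR : 0 < R) {x : Eu n} (hx : x ∈ Om e) {k : ℝ} (hk : 2 * R ≤ k)
    (hc : |c * sf e x| ≤ k) : len R c e p u x ≤ 4 / R ^ 2 * (qf p * |cl k (tf p u x) - c * sf e x|) := by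
  have cg := (cont_l (F := fun x l => etd R (uh e p u c l) x) (jc_etd G c R) hx).abs
  have w := window (b := tf p u x) (M := 4 / R ^ 2) cg hc (fun l => abs_nonneg _) (fun l => abs_etd_le hR x)
    (fun l hl => by
      rw [etd_zero hR, abs_zero]
      have h1 := (bessel_graph (Geo_uh G c l) x).2.1
      rw [tf_uh] at h1
      have : k ^ 2 < (c * sf e x + l * (tf p u x - c * sf e x)) ^ 2 := by
        rw [← sq_abs (c * sf e x + _)]
        have : 0 ≤ k := by linarith
        gcongr
      nlinarith [sq_nonneg (sf e x)])
  unfold len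
  have : ∀ l, |u x - uc e p c x| * |etd R (uh e p u c l) x| = qf p * (|tf p u x - c * sf e x| * |etd R (uh e p u c l) x|) := by
    intro l; rw [u_sub_uc, abs_mul, abs_of_pos (qf_pos p)]; ring
  simp only [this]
  rw [intervalIntegral.integral_const_mul]
  have := mul_le_mul_of_nonneg_left w (qf_pos p).le
  linarith

lemma len_zero (hR : 0 < R) {x : Eu n} (hx : 2 * R < ‖x‖) : len R c e p u x = 0 := by
  unfold len
  have : ∀ l, etd R (uh e p u c l) x = 0 := fun l => etd_zero hR (by
    unfold zf; nlinarith [sq_nonneg (uh e p u c l x)])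
  simp [this]

lemma cl_abs_le {k : ℝ} (hk : 0 ≤ k) (y : ℝ) : |cl k y| ≤ k := by
  unfold cl; rw [abs_le]
  exact ⟨le_max_left _ _, max_le (by linarith) (min_le_right _ _)⟩

lemma len_crude (G : Geo e p u) (hR : 0 < R) {x : Eu n} (hx : x ∈ Om e)
    (hc : |c * sf e x| ≤ 2 * R) : len R c e p u x ≤ 16 * qf p / R := by
  refine (len_le G hR hx le_rfl hc).trans ?_
  have h1 : |cl (2 * R) (tf p u x) - c * sf e x| ≤ 4 * R := by
    refine (abs_sub _ _).trans ?_
    have := cl_abs_le (by positivity : 0 ≤ 2 * R) (tf p u x)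
    linarith
  have := qf_pos p
  calc _ ≤ 4 / R ^ 2 * (qf p * (4 * R)) := by gcongr
    _ = _ := by field_simp; ring

end Bern

namespace Bern
open Filter Topology InnerProductSpace
variable {n : ℕ} {e p : Eu n} {u : Eu n → ℝ} {c l ε R : ℝ}

lemma nT_sq_le (G : Geo e p u) {x : Eu n} (hx : x ∈ Om e) : nT e p u x ^ 2 ≤ 1 := by
  have := nRT_sq (p := p) (u := u) hx
  have := (bessel_graph G x).1
  nlinarith [sq_nonneg (nR e p u x)]
lemma abs_nT_le (G : Geo e p u) {x : Eu n} (hx : x ∈ Om e) : |nT e p u x| ≤ 1 :=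
  (sq_le_one_iff_abs_le_one _).1 (nT_sq_le G hx)
lemma kp_nonneg (G : Geo e p u) {x : Eu n} (hx : x ∈ Om e) : 0 ≤ kp e p u x := by
  have := nT_sq_le G hx
  unfold kp; linarith
lemma kp_le (x : Eu n) : kp e p u x ≤ 1 := by
  unfold kp; nlinarith [sq_nonneg (nT e p u x)]
lemma nR_sq_le (G : Geo e p u) {x : Eu n} (hx : x ∈ Om e) : nR e p u x ^ 2 ≤ kp e p u x := by
  have := nRT_sq (p := p) (u := u) hx
  have := (bessel_graph G x).1
  unfold kp; linarith
lemma abs_nR_le (G : Geo e p u) {x : Eu n} (hx : x ∈ Om e) : |nR e p u x| ≤ 1 :=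
  (sq_le_one_iff_abs_le_one _).1 ((nR_sq_le G hx).trans (kp_le x))
lemma rf_sq_le (G : Geo e p u) (x : Eu n) : rf e p u x ^ 2 ≤ zf u x := by
  rw [rf_sq]; exact (bessel_graph G x).2.1
lemma r_nR {x : Eu n} (hx : x ∈ Om e) : rf e p u x * nR e p u x = sf e x * nE e u x + tf p u x * nN p u x := by
  have := rf_pos (p := p) (u := u) hx
  unfold nR; field_simp
lemma h_sub_sq (G : Geo e p u) {x : Eu n} (hx : x ∈ Om e) :
    (hf u x - rf e p u x * nR e p u x) ^ 2 ≤ (zf u x - rf e p u x ^ 2) * (kp e p u x - nR e p u x ^ 2) := by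
  have h1 := (bessel_graph G x).2.2
  have h2 := nRT_sq (p := p) (u := u) hx
  rw [r_nR hx, rf_sq]
  calc _ = (hf u x - sf e x * nE e u x - tf p u x * nN p u x) ^ 2 := by ring
    _ ≤ _ := h1
    _ = _ := by unfold kp; linear_combination (zf u x - sf e x ^ 2 - tf p u x ^ 2) * h2
lemma h_sq_le (u : Eu n → ℝ) (x : Eu n) : hf u x ^ 2 ≤ zf u x := by
  have hW := Wg_pos u x
  have h1 := Wg_sq u x
  have h2 := abs_le.1 (abs_real_inner_le_norm x (Dg u x))
  have h3 : ⟪x, Dg u x⟫ ^ 2 ≤ (‖x‖ * ‖Dg u x‖) ^ 2 := by nlinarith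
  rw [hf, div_pow, div_le_iff₀ (by positivity), h1, zf]
  set a := ⟪x, Dg u x⟫
  set X := ‖x‖
  set D := ‖Dg u x‖
  have hX : 0 ≤ X := norm_nonneg _
  have hD : 0 ≤ D := norm_nonneg _
  have key : (u x - a) ^ 2 ≤ u x ^ 2 + 2 * (|u x| * D) * X + (X * D) ^ 2 := by
    have : |u x * a| ≤ |u x| * (X * D) := by rw [abs_mul]; gcongr; exact abs_le.2 h2
    have := (abs_le.1 this).1
    nlinarith
  have : 2 * (|u x| * D) * X ≤ (|u x| * D) ^ 2 + X ^ 2 := by nlinarith [sq_nonneg (|u x| * D - X)]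
  rw [mul_pow, sq_abs] at this
  nlinarith

lemma abs_le_of_zf {a R : ℝ} (hR : 0 < R) {x : Eu n} (h : a ^ 2 ≤ zf u x) (hz : zf u x ≤ 2 * R ^ 2) :
    |a| ≤ 2 * R := abs_le_of_sq_le_sq (by nlinarith) (by positivity)

lemma abs_etd_le_et (hR : 0 < R) (x : Eu n) : |etd R u x| ≤ 4 / R ^ 2 * et (2 * R) u x := by
  by_cases hz : 2 * R ^ 2 ≤ zf u x
  · rw [etd_zero hR hz, abs_zero]; have := et_nonneg (R := 2 * R) (u := u) x; positivity
  · have : 1 ≤ et (2 * R) u x := et_ge_one (by positivity) (by nlinarith)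
    refine (abs_etd_le hR x).trans ?_
    exact le_mul_of_one_le_right (by positivity) this

noncomputable def II (e : Eu n) (u : Eu n → ℝ) (R : ℝ) : ℝ := ∫ x in Om e, et R u x * Wg u x

lemma int_Lb (R M : ℝ) : Integrable ((closedBall (0 : Eu n) (2 * R)).indicator fun _ => M) :=
  IntegrableOn.integrable_indicator (integrableOn_const (measure_closedBall_lt_top).ne)
    isClosed_closedBall.measurableSet

lemma vol_ball (hR : 0 ≤ R) : volume.real (closedBall (0 : Eu n) (2 * R)) =
    volume.real (closedBall (0 : Eu n) 2) * R ^ n := by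
  have h1 := Measure.addHaar_closedBall_mul (volume : Measure (Eu n)) 0 hR (by norm_num : (0:ℝ) ≤ 2)
  rw [measureReal_def, measureReal_def, mul_comm 2 R, h1, ENNReal.toReal_mul, ENNReal.toReal_ofReal (by positivity)]
  simp [mul_comm]

lemma Wg_uc0 (x : Eu n) : Wg (uc e p 0) x = qf p := by
  simp [Wg, Dg_uc, qf]

lemma II_bound (S : Sol e p u) (hR : 0 < R) :
    IntegrableOn (fun x => et R u x * Wg u x) (Om e) ∧
    II e u R ≤ 68 * qf p * volume.real (closedBall (0 : Eu n) 2) * R ^ n := by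
  have hq := qf_pos p
  have hm : MeasurableSet (closedBall (0 : Eu n) (2 * R)) := isClosed_closedBall.measurableSet
  obtain ⟨h1, h2⟩ := U_le S hR 0 (Lb := (closedBall (0 : Eu n) (2 * R)).indicator fun _ => 16 * qf p / R)
    (int_Lb _ _).integrableOn (fun x hx => by
      by_cases h : ‖x‖ ≤ 2 * R
      · rw [indicator_of_mem (by simpa using h)]
        exact len_crude S.toGeo hR hx (by simp; positivity)
      · rw [indicator_of_notMem (by simpa using h), len_zero hR (by linarith)])
  refine ⟨h1, h2.trans ?_⟩
  have key : ∀ (f : Eu n → ℝ) (M : ℝ), 0 ≤ M → IntegrableOn f (Om e) →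
      (∀ x, f x ≤ (closedBall (0 : Eu n) (2 * R)).indicator (fun _ => M) x) →
      ∫ x in Om e, f x ≤ M * volume.real (closedBall (0 : Eu n) (2 * R)) := by
    intro f M hM hf hfM
    refine (setIntegral_mono hf (int_Lb R M).integrableOn hfM).trans ?_
    refine (setIntegral_le_integral (int_Lb R M) (Filter.Eventually.of_forall fun x => indicator_nonneg (fun _ _ => hM) x)).trans ?_
    rw [integral_indicator hm, setIntegral_const, smul_eq_mul, mul_comm]
  have k1 := key (fun x => et R (uc e p 0) x * Wg (uc e p 0) x) (4 * qf p) (by positivity)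
    (int_uc hR 0).integrableOn (fun x => by
      by_cases h : ‖x‖ ≤ 2 * R
      · rw [indicator_of_mem (by simpa using h), Wg_uc0]
        gcongr; exact et_le x
      · rw [indicator_of_notMem (by simpa using h), et_zero_norm hR (by linarith), zero_mul])
  have k2 := key _ (16 * qf p / R) (by positivity) (int_Lb R _).integrableOn (fun x => le_rfl)
  have k3 : 4 * R * ∫ x in Om e, (closedBall (0 : Eu n) (2 * R)).indicator (fun _ => 16 * qf p / R) x
      ≤ 4 * R * (16 * qf p / R * volume.real (closedBall (0 : Eu n) (2 * R))) := by gcongr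
  have k4 : 4 * R * (16 * qf p / R * volume.real (closedBall (0 : Eu n) (2 * R)))
      = 64 * qf p * volume.real (closedBall (0 : Eu n) (2 * R)) := by field_simp; ring
  rw [vol_ball hR.le] at k1 k3 k4
  linarith

lemma int_W (S : Sol e p u) (hR : 0 < R) : IntegrableOn (fun x => et R u x * Wg u x) (Om e) := (II_bound S hR).1

/-- products dominated by W * eta -/
lemma int_Wg (S : Sol e p u) (hR : 0 < R) {g : Eu n → ℝ} (hg : ContinuousOn g (Om e)) {M : ℝ}
    (hM : ∀ x ∈ Om e, |g x| ≤ M) : IntegrableOn (fun x => et R u x * Wg u x * g x) (Om e) := by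
  refine Integrable.mono' ((int_W S hR).mul_const M) ?_ ?_
  · exact (((smooth_et S.toGeo).continuousOn.mul (cont_Wg (isOpen_Om e) S.C1)).mul hg).aestronglyMeasurable
      (isOpen_Om e).measurableSet
  · filter_upwards [ae_restrict_mem (isOpen_Om e).measurableSet] with x hx
    have h0 : 0 ≤ et R u x * Wg u x := mul_nonneg (et_nonneg x) (Wg_pos u x).le
    rw [Real.norm_eq_abs, abs_mul, abs_of_nonneg h0]
    exact mul_le_mul_of_nonneg_left (hM x hx) h0

lemma etd_bound (hR : 0 < R) {g : Eu n → ℝ} {M : ℝ} {x : Eu n}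
    (hM : zf u x ≤ 2 * R ^ 2 → |g x| ≤ M) :
    |Wg u x * etd R u x * g x| ≤ 4 / R ^ 2 * |M| * (et (2 * R) u x * Wg u x) := by
  have hW := Wg_pos u x
  by_cases hz : 2 * R ^ 2 ≤ zf u x
  · rw [etd_zero hR hz, mul_zero, zero_mul, abs_zero]
    have := et_nonneg (R := 2 * R) (u := u) x; positivity
  · rw [abs_mul, abs_mul, abs_of_pos hW]
    calc Wg u x * |etd R u x| * |g x| ≤ Wg u x * (4 / R ^ 2 * et (2 * R) u x) * |M| := by
          have := abs_etd_le_et (u := u) hR x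
          have := et_nonneg (R := 2 * R) (u := u) x
          have h3 : |g x| ≤ |M| := (hM (by linarith)).trans (le_abs_self _)
          gcongr
      _ = _ := by ring

lemma int_etd (S : Sol e p u) (hR : 0 < R) {g : Eu n → ℝ} (hg : ContinuousOn g (Om e)) {M : ℝ}
    (hM : ∀ x ∈ Om e, zf u x ≤ 2 * R ^ 2 → |g x| ≤ M) : IntegrableOn (fun x => Wg u x * etd R u x * g x) (Om e) := by
  refine Integrable.mono' ((int_W S (by positivity : 0 < 2 * R)).const_mul (4 / R ^ 2 * |M|)) ?_ ?_
  · exact (((cont_Wg (isOpen_Om e) S.C1).mul (cont_etd S.toGeo)).mul hg).aestronglyMeasurable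
      (isOpen_Om e).measurableSet
  · filter_upwards [ae_restrict_mem (isOpen_Om e).measurableSet] with x hx
    exact etd_bound hR (hM x hx)

/-- flux limit -/
lemma flux_lim (G : Geo e p u) (hR : 0 < R) (hi : IntegrableOn (fun x => et R u x * Wg u x) (Om e)) :
    Tendsto (fun k => ∫ x in Om e, Wg u x * nT e p u x * (et R u x * ch (ee k) e p u x)) atTop
     (𝓝 (∫ x in Om e, et R u x * Wg u x * nT e p u x)) := by
  have mO := (isOpen_Om e).measurableSet
  refine tendsto_integral_of_dominated_convergence _ (fun k => ?_) hi (fun k => ?_) ?_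
  · exact ((((cont_Wg (isOpen_Om e) G.C1)).mul (cont_nT G)).mul ((smooth_et G).continuousOn.mul
      (smooth_ch G).continuousOn)).aestronglyMeasurable mO
  · filter_upwards [ae_restrict_mem mO] with x hx
    have h0 : 0 ≤ et R u x * Wg u x := mul_nonneg (et_nonneg x) (Wg_pos u x).le
    have h1 := abs_nT_le G hx
    have h2 : |ch (ee k) e p u x| ≤ 1 := by
      rw [abs_of_nonneg (ch_nonneg x)]; exact ch_le_one (ee_pos k) x
    have : Wg u x * nT e p u x * (et R u x * ch (ee k) e p u x) = (et R u x * Wg u x) * (nT e p u x * ch (ee k) e p u x) := by ring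
    rw [this, Real.norm_eq_abs, abs_mul, abs_of_nonneg h0, abs_mul]
    exact mul_le_of_le_one_right h0 (mul_le_one₀ h1 (abs_nonneg _) h2)
  · filter_upwards [ae_restrict_mem mO] with x hx
    have := (ch_lim (p := p) (u := u) hx).const_mul (et R u x * Wg u x * nT e p u x)
    rw [mul_one] at this
    refine this.congr fun k => by ring

lemma nT_uc (he : ‖e‖ = 1) (hep : ⟪e, p⟫ = (0:ℝ)) {x : Eu n} (hx : x ∈ Om e) : nT e p (uc e p c) x = 1 := by
  have hs : 0 < sf e x := hx
  have hq := qf_pos p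
  have hqs := qf_sq p
  have hW := Wg_pos (uc e p c) x
  have he2 : ⟪e, e⟫ = (1:ℝ) := by rw [real_inner_self_eq_norm_sq, he]; norm_num
  have hpp : ⟪p, p⟫ = ‖p‖ ^ 2 := real_inner_self_eq_norm_sq _
  have hpe : ⟪p, e⟫ = (0:ℝ) := by rw [real_inner_comm]; exact hep
  have d1 : ⟪e, Dg (uc e p c) x⟫ = c * qf p := by
    rw [Dg_uc, inner_add_right, inner_smul_right, hep, he2]; ring
  have d2 : ⟪p, Dg (uc e p c) x⟫ = ‖p‖ ^ 2 := by
    rw [Dg_uc, inner_add_right, inner_smul_right, hpe, hpp]; ring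
  have hW2 : Wg (uc e p c) x = qf p * √(1 + c ^ 2) := by
    rw [← sq_eq_sq₀ hW.le (by positivity), Wg_sq, mul_pow, Real.sq_sqrt (by positivity), hqs, Dg_uc,
      ← real_inner_self_eq_norm_sq, inner_add_left, inner_add_right, inner_add_right, inner_smul_left,
      inner_smul_right, inner_smul_right, hpp, hep, hpe, inner_smul_left, he2]
    simp only [conj_trivial]
    linear_combination c ^ 2 * hqs
  have hr : rf e p (uc e p c) x = sf e x * √(1 + c ^ 2) := by
    rw [rf, tf_uc]
    rw [show sf e x ^ 2 + (c * sf e x) ^ 2 = sf e x ^ 2 * (1 + c ^ 2) by ring, Real.sqrt_mul (by positivity),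
      Real.sqrt_sq hs.le]
  have h3 : 0 < √(1 + c ^ 2) := by positivity
  have h4 : √(1 + c ^ 2) ^ 2 = 1 + c ^ 2 := Real.sq_sqrt (by positivity)
  rw [nT, nN, nE, d1, d2, tf_uc, hr, hW2, ← hqs]
  rw [div_eq_one_iff_eq (by positivity)]
  field_simp
  rw [h4]
  ring

noncomputable def AA (e p : Eu n) (R c : ℝ) : ℝ := ∫ x in Om e, et R (uc e p c) x * Wg (uc e p c) x

lemma flux (S : Sol e p u) (hR : 0 < R) (c : ℝ) : ∫ x in Om e, et R u x * Wg u x * nT e p u x = AA e p R c := by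
  have G := S.toGeo
  have Gc := Geo_uc G.he G.hep c
  have h1 := flux_lim G hR (int_W S hR)
  have h2 := flux_lim Gc hR (int_uc hR c).integrableOn
  have : ∀ k, _ := fun k => flux_cut G (ee_pos k) hR c
  simp only [this] at h1
  rw [tendsto_nhds_unique h1 h2, AA]
  refine setIntegral_congr_fun (isOpen_Om e).measurableSet fun x hx => ?_
  simp only [nT_uc G.he G.hep hx, mul_one]

lemma AA_indep (S : Sol e p u) (hR : 0 < R) (c : ℝ) : AA e p R c = AA e p R 0 := by
  rw [← flux S hR c, flux S hR 0]

open scoped Pointwise in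
lemma AA_scale (hR : 0 < R) : AA e p R 0 = AA e p 1 0 * R ^ n := by
  have h := Measure.setIntegral_comp_smul (volume : Measure (Eu n)) (fun x => et R (uc e p 0) x * Wg (uc e p 0) x) (Om e) hR.ne'
  have h1 : R • Om e = Om e := by
    ext x
    rw [mem_smul_set_iff_inv_smul_mem₀ hR.ne']
    simp only [Om, mem_setOf_eq, inner_smul_right]
    have : 0 < R⁻¹ := by positivity
    exact mul_pos_iff_of_pos_left this
  have h2 : ∀ x, et R (uc e p 0) (R • x) * Wg (uc e p 0) (R • x) = et 1 (uc e p 0) x * Wg (uc e p 0) x := by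
    intro x
    rw [Wg_uc0, Wg_uc0]
    congr 1
    simp only [et, zf, uc, inner_smul_right, norm_smul, Real.norm_eq_abs, abs_of_pos hR]
    congr 1
    field_simp
    simp
    ring
  simp only [h2, h1] at h
  rw [AA, AA, h]
  simp only [finrank_euclideanSpace, Fintype.card_fin, smul_eq_mul]
  rw [abs_of_pos (by positivity)]
  field_simp

end Bern

namespace Bern
open Filter Topology InnerProductSpace
variable {n : ℕ} {e p : Eu n} {u : Eu n → ℝ} {c l ε R : ℝ}

lemma abs_ch_le (hε : 0 < ε) (x : Eu n) : |ch ε e p u x| ≤ 1 := by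
  rw [abs_of_nonneg (ch_nonneg x)]; exact ch_le_one hε x

lemma int_kr (S : Sol e p u) (hR : 0 < R) :
    IntegrableOn (fun x => Wg u x * (et R u x * kp e p u x / rf e p u x)) (Om e) := by
  have G := S.toGeo
  have mO := (isOpen_Om e).measurableSet
  have cW := cont_Wg (isOpen_Om e) G.C1
  have ce := (smooth_et (R := R) G).continuousOn
  have ced := cont_etd (R := R) G
  have cr := (smooth_rf G).continuousOn
  have ck := cont_kp G
  have cnR := cont_nR G
  have chh := cont_hf G
  have hr : ∀ x ∈ Om e, rf e p u x ≠ 0 := fun x hx => (rf_pos hx).ne'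
  set D : Eu n → ℝ := fun x => 4 / R ^ 2 * |8 * R| * (et (2 * R) u x * Wg u x) with hD
  have iD : IntegrableOn D (Om e) := (int_W S (by positivity : 0 < 2 * R)).const_mul _
  have i1 : ∀ k, IntegrableOn (fun x => Wg u x * (et R u x * ch (ee k) e p u x * kp e p u x / rf e p u x)) (Om e) := by
    intro k
    refine int_piece (R := R) G (ee_pos k) (cW.mul (((ce.mul (smooth_ch G).continuousOn).mul ck).div cr hr)) ?_
    rintro x hx (h | h)
    · simp [et_zero hR h]
    · simp [ch_zero hx h]
  have i2 : ∀ k, IntegrableOn (fun x => Wg u x * (et R u x * chd (ee k) e p u x * (1 - nR e p u x ^ 2))) (Om e) := by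
    intro k
    refine int_piece (R := R) G (ee_pos k) (cW.mul ((ce.mul (cont_chd G)).mul (continuousOn_const.sub (cnR.pow 2)))) ?_
    rintro x hx (h | h)
    · simp [et_zero hR h]
    · simp [chd_zero hx h]
  have i3 : ∀ k, IntegrableOn (fun x => Wg u x * etd R u x * (2 * ch (ee k) e p u x * (rf e p u x - hf u x * nR e p u x))) (Om e) := by
    intro k
    refine int_piece (R := R) G (ee_pos k) ((cW.mul ced).mul ((continuousOn_const.mul (smooth_ch G).continuousOn).mul (cr.sub (chh.mul cnR)))) ?_
    rintro x hx (h | h)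
    · simp [etd_zero hR h]
    · simp [ch_zero hx h]
  have key : ∀ k, ∫ x in Om e, Wg u x * (et R u x * ch (ee k) e p u x * kp e p u x / rf e p u x) ≤ ∫ x in Om e, D x := by
    intro k
    have h := id_R_cut S (ee_pos k) hR
    have e1 : ∫ x in Om e, Wg u x * (et R u x * ch (ee k) e p u x * kp e p u x / rf e p u x +
      et R u x * chd (ee k) e p u x * (1 - nR e p u x ^ 2)
      + 2 * (ch (ee k) e p u x * etd R u x) * (rf e p u x - hf u x * nR e p u x)) =
      ∫ x in Om e, ((fun x => Wg u x * (et R u x * ch (ee k) e p u x * kp e p u x / rf e p u x)) + ((fun x => Wg u x * (et R u x * chd (ee k) e p u x * (1 - nR e p u x ^ 2))) + (fun x => Wg u x * etd R u x * (2 * ch (ee k) e p u x * (rf e p u x - hf u x * nR e p u x)))) : Eu n → ℝ) x := by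
      congr 1; ext x; simp only [Pi.add_apply]; ring
    rw [e1, integral_add' (i1 k) ((i2 k).add (i3 k)), integral_add' (i2 k) (i3 k)] at h
    have p2 : 0 ≤ ∫ x in Om e, Wg u x * (et R u x * chd (ee k) e p u x * (1 - nR e p u x ^ 2)) := by
      refine setIntegral_nonneg mO fun x hx => ?_
      have h1 : nR e p u x ^ 2 ≤ 1 := (nR_sq_le G hx).trans (kp_le x)
      exact mul_nonneg (Wg_pos u x).le (mul_nonneg (mul_nonneg (et_nonneg x) (chd_nonneg (ee_pos k) x)) (by linarith))
    have p3 : - ∫ x in Om e, Wg u x * etd R u x * (2 * ch (ee k) e p u x * (rf e p u x - hf u x * nR e p u x)) ≤ ∫ x in Om e, D x := by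
      rw [← integral_neg]
      refine setIntegral_mono_on (i3 k).neg iD mO fun x hx => ?_
      refine (neg_le_abs _).trans (etd_bound (M := 8 * R) (g := fun x => 2 * ch (ee k) e p u x * (rf e p u x - hf u x * nR e p u x)) hR fun hz => ?_)
      have q1 := abs_le_of_zf hR (rf_sq_le G x) hz
      have q2 := abs_le_of_zf hR (h_sq_le u x) hz
      have q3 := abs_nR_le G hx
      have q4 := abs_ch_le (e := e) (p := p) (u := u) (ee_pos k) x
      rw [abs_mul, abs_mul, abs_two]
      calc 2 * |ch (ee k) e p u x| * |rf e p u x - hf u x * nR e p u x| ≤ 2 * 1 * (|rf e p u x| + |hf u x| * |nR e p u x|) := by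
            gcongr; rw [← abs_mul]; exact abs_sub _ _
        _ ≤ 2 * 1 * (2 * R + 2 * R * 1) := by gcongr
        _ = 8 * R := by ring
    linarith
  refine (fatou i1 (fun k => ?_) ?_ key tendsto_const_nhds).1
  · filter_upwards [ae_restrict_mem mO] with x hx
    exact mul_nonneg (Wg_pos u x).le (div_nonneg (mul_nonneg (mul_nonneg (et_nonneg x) (ch_nonneg x)) (kp_nonneg G hx)) (rf_nonneg x))
  · filter_upwards [ae_restrict_mem mO] with x hx
    have := (ch_lim (p := p) (u := u) hx).const_mul (Wg u x * (et R u x * kp e p u x / rf e p u x))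
    rw [mul_one] at this
    refine this.congr fun k => by ring

lemma chd_r (hε : 0 < ε) {x : Eu n} (hx : x ∈ Om e) : chd ε e p u x ≤ 1 / rf e p u x := by
  rw [le_div_iff₀ (rf_pos hx), mul_comm]; exact r_chd_le hε hx

lemma id_X_lim (S : Sol e p u) (hR : 0 < R) :
    n * II e u R = ∫ x in Om e, Wg u x * etd R u x * (-(2 * (zf u x - hf u x ^ 2))) := by
  have G := S.toGeo
  have mO := (isOpen_Om e).measurableSet
  have cW := cont_Wg (isOpen_Om e) G.C1
  have ce := (smooth_et (R := R) G).continuousOn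
  have ced := cont_etd (R := R) G
  have cr := (smooth_rf G).continuousOn
  have cz := (smooth_zf G).continuousOn
  have cnR := cont_nR G
  have chh := cont_hf G
  set D : Eu n → ℝ := fun x => (n * (et R u x * Wg u x) + (et R u x * Wg u x + 2 * R * (Wg u x * (et R u x * kp e p u x / rf e p u x)))) +
    4 / R ^ 2 * |4 * R ^ 2| * (et (2 * R) u x * Wg u x) with hD
  have iD : IntegrableOn D (Om e) := (((int_W S hR).const_mul _).add ((int_W S hR).add ((int_kr S hR).const_mul _))).add
    ((int_W S (by positivity : 0 < 2 * R)).const_mul _)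
  have i1 : IntegrableOn (fun x => n * (et R u x * Wg u x)) (Om e) := (int_W S hR).const_mul _
  have hbz : ∀ x, zf u x ≤ 2 * R ^ 2 → |2 * (zf u x - hf u x ^ 2)| ≤ 4 * R ^ 2 := by
    intro x hz
    have := h_sq_le u x
    rw [abs_of_nonneg (by linarith)]; nlinarith [sq_nonneg (hf u x)]
  have i2 : IntegrableOn (fun x => Wg u x * etd R u x * (2 * (zf u x - hf u x ^ 2))) (Om e) :=
    int_etd S hR (continuousOn_const.mul (cz.sub (chh.pow 2))) (M := 4 * R ^ 2) fun x _ hz => hbz x hz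
  have T : Tendsto (fun k => ∫ x in Om e, Wg u x * (n * (et R u x * ch (ee k) e p u x) +
      et R u x * chd (ee k) e p u x * (rf e p u x - hf u x * nR e p u x)
      + 2 * (ch (ee k) e p u x * etd R u x) * (zf u x - hf u x ^ 2))) atTop
      (𝓝 (∫ x in Om e, (n * (et R u x * Wg u x) + Wg u x * etd R u x * (2 * (zf u x - hf u x ^ 2))))) := by
    refine tendsto_integral_of_dominated_convergence D (fun k => ?_) iD (fun k => ?_) ?_
    · have cc := (smooth_ch (ε := ee k) G).continuousOn
      have ccd := cont_chd (ε := ee k) G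
      refine ContinuousOn.aestronglyMeasurable ?_ mO
      exact cW.mul (((continuousOn_const.mul (ce.mul cc)).add ((ce.mul ccd).mul (cr.sub (chh.mul cnR)))).add
        ((continuousOn_const.mul (cc.mul ced)).mul (cz.sub (chh.pow 2))))
    · filter_upwards [ae_restrict_mem mO] with x hx
      have hr := rf_pos (p := p) (u := u) hx
      have W0 := Wg_pos u x
      have E0 := et_nonneg (R := R) (u := u) x
      have q4 := abs_ch_le (e := e) (p := p) (u := u) (ee_pos k) x
      have d0 := chd_nonneg (e := e) (p := p) (u := u) (ee_pos k) x
      have k0 := kp_nonneg G hx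
      have a1 : |Wg u x * (n * (et R u x * ch (ee k) e p u x))| ≤ n * (et R u x * Wg u x) := by
        rw [abs_mul, abs_mul, abs_mul, abs_of_pos W0, abs_of_nonneg E0, Nat.abs_cast]
        calc Wg u x * (n * (et R u x * |ch (ee k) e p u x|)) ≤ Wg u x * (n * (et R u x * 1)) := by gcongr
          _ = _ := by ring
      have a3 : |Wg u x * etd R u x * (2 * (ch (ee k) e p u x) * (zf u x - hf u x ^ 2))| ≤ 4 / R ^ 2 * |4 * R ^ 2| * (et (2 * R) u x * Wg u x) := by
        refine etd_bound (g := fun x => 2 * (ch (ee k) e p u x) * (zf u x - hf u x ^ 2)) hR fun hz => ?_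
        have := hbz x hz
        calc |2 * ch (ee k) e p u x * (zf u x - hf u x ^ 2)| = |ch (ee k) e p u x| * |2 * (zf u x - hf u x ^ 2)| := by
              rw [← abs_mul]; congr 1; ring
          _ ≤ 1 * (4 * R ^ 2) := by gcongr
          _ = _ := one_mul _
      have a2 : |Wg u x * (et R u x * chd (ee k) e p u x * (rf e p u x - hf u x * nR e p u x))| ≤
          et R u x * Wg u x + 2 * R * (Wg u x * (et R u x * kp e p u x / rf e p u x)) := by
        by_cases hz : 2 * R ^ 2 ≤ zf u x
        · simp [et_zero hR hz]
        · push Not at hz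
          have b1 : |rf e p u x - hf u x * nR e p u x| ≤ rf e p u x + 2 * R * kp e p u x := by
            have c1 : rf e p u x - hf u x * nR e p u x = rf e p u x * (1 - nR e p u x ^ 2) -
              (hf u x - rf e p u x * nR e p u x) * nR e p u x := by ring
            have c2 := nR_sq_le G hx
            have c3 := kp_le (e := e) (p := p) (u := u) x
            have c4 := h_sub_sq G hx
            have c5 : ((hf u x - rf e p u x * nR e p u x) * nR e p u x) ^ 2 ≤ (2 * R * kp e p u x) ^ 2 := by
              have t1 : (hf u x - rf e p u x * nR e p u x) ^ 2 ≤ (2 * R ^ 2) * kp e p u x := by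
                refine c4.trans ?_
                have := rf_sq_le G x
                refine mul_le_mul ?_ ?_ (by linarith) (by positivity)
                · nlinarith
                · nlinarith [sq_nonneg (nR e p u x)]
              rw [mul_pow]
              calc _ ≤ (2 * R ^ 2 * kp e p u x) * kp e p u x := mul_le_mul t1 c2 (sq_nonneg _) (by positivity)
                _ ≤ _ := by nlinarith [mul_nonneg (sq_nonneg R) (sq_nonneg (kp e p u x))]
            have c6 := abs_le_of_sq_le_sq c5 (by positivity)
            rw [c1]
            refine (abs_sub _ _).trans (add_le_add ?_ c6)
            rw [abs_of_nonneg (mul_nonneg hr.le (by linarith))]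
            nlinarith [sq_nonneg (nR e p u x)]
          rw [abs_mul, abs_mul, abs_mul, abs_of_pos W0, abs_of_nonneg E0, abs_of_nonneg d0]
          calc Wg u x * (et R u x * chd (ee k) e p u x * |rf e p u x - hf u x * nR e p u x|)
              ≤ Wg u x * (et R u x * (1 / rf e p u x) * (rf e p u x + 2 * R * kp e p u x)) := by
                have := chd_r (p := p) (u := u) (ee_pos k) hx
                gcongr
            _ = _ := by field_simp
      rw [Real.norm_eq_abs]
      have : Wg u x * (n * (et R u x * ch (ee k) e p u x) +
        et R u x * chd (ee k) e p u x * (rf e p u x - hf u x * nR e p u x)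
        + 2 * (ch (ee k) e p u x * etd R u x) * (zf u x - hf u x ^ 2)) =
        (Wg u x * (n * (et R u x * ch (ee k) e p u x)) + Wg u x * (et R u x * chd (ee k) e p u x * (rf e p u x - hf u x * nR e p u x))) + Wg u x * etd R u x * (2 * (ch (ee k) e p u x) * (zf u x - hf u x ^ 2)) := by ring
      rw [this]
      exact (abs_add_le _ _).trans (add_le_add ((abs_add_le _ _).trans (add_le_add a1 a2)) a3)
    · filter_upwards [ae_restrict_mem mO] with x hx
      have l1 := ch_lim (p := p) (u := u) hx
      have l2 := chd_lim (e := e) (p := p) (u := u) (x := x)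
      have := (((l1.const_mul (et R u x)).const_mul (n:ℝ)).add ((l2.const_mul (et R u x)).mul_const (rf e p u x - hf u x * nR e p u x))).add
        (((l1.mul_const (etd R u x)).const_mul 2).mul_const (zf u x - hf u x ^ 2))
      have := this.const_mul (Wg u x)
      convert this using 2
      ring
  have T0 : ∀ k, _ := fun k => id_X_cut S (ee_pos k) hR
  simp only [T0] at T
  have h := tendsto_nhds_unique T tendsto_const_nhds
  rw [integral_add i1 i2, integral_const_mul] at h
  simp only [mul_neg]
  rw [integral_neg]
  unfold II; linarith

lemma id_K_lim (S : Sol e p u) (hR : 0 < R) :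
    ∫ x in Om e, et R u x * Wg u x * kp e p u x =
     ∫ x in Om e, Wg u x * etd R u x * (2 * Real.arctan (tf p u x / sf e x) * (hf u x * (rf e p u x * nT e p u x))) := by
  have G := S.toGeo
  have mO := (isOpen_Om e).measurableSet
  have cW := cont_Wg (isOpen_Om e) G.C1
  have ce := (smooth_et (R := R) G).continuousOn
  have ced := cont_etd (R := R) G
  have cr := (smooth_rf G).continuousOn
  have cnR := cont_nR G
  have cnT := cont_nT G
  have chh := cont_hf G
  have ck := cont_kp G
  have ca : ContinuousOn (fun x => Real.arctan (tf p u x / sf e x)) (Om e) :=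
    Real.continuous_arctan.comp_continuousOn ((smooth_tf G).continuousOn.div (smooth_sf _).continuousOn
      fun x hx => (ne_of_gt (show 0 < sf e x from hx)))
  have ha : ∀ y, |Real.arctan y| ≤ 2 := fun y => by
    have h1 := Real.arctan_lt_pi_div_two y
    have h2 := Real.neg_pi_div_two_lt_arctan y
    have h3 := Real.pi_lt_four
    rw [abs_le]; constructor <;> linarith
  set D : Eu n → ℝ := fun x => (et R u x * Wg u x + 2 * (et R u x * Wg u x)) +
    4 / R ^ 2 * |16 * R ^ 2| * (et (2 * R) u x * Wg u x) with hD
  have iD : IntegrableOn D (Om e) := ((int_W S hR).add ((int_W S hR).const_mul _)).add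
    ((int_W S (by positivity : 0 < 2 * R)).const_mul _)
  have hb : ∀ x ∈ Om e, zf u x ≤ 2 * R ^ 2 → |2 * Real.arctan (tf p u x / sf e x) * (hf u x * (rf e p u x * nT e p u x))| ≤ 16 * R ^ 2 := by
    intro x hx hz
    have q1 := abs_le_of_zf hR (rf_sq_le G x) hz
    have q2 := abs_le_of_zf hR (h_sq_le u x) hz
    have q3 := abs_nT_le G hx
    have q4 := ha (tf p u x / sf e x)
    rw [abs_mul, abs_mul, abs_mul, abs_mul, abs_two]
    calc _ ≤ 2 * 2 * (2 * R * (2 * R * 1)) := by gcongr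
      _ = _ := by ring
  have i1 : IntegrableOn (fun x => et R u x * Wg u x * kp e p u x) (Om e) :=
    int_Wg S hR ck (M := 1) fun x hx => by rw [abs_of_nonneg (kp_nonneg G hx)]; exact kp_le x
  have i2 : IntegrableOn (fun x => Wg u x * etd R u x * (2 * Real.arctan (tf p u x / sf e x) * (hf u x * (rf e p u x * nT e p u x)))) (Om e) :=
    int_etd S hR ((continuousOn_const.mul ca).mul (chh.mul (cr.mul cnT))) hb
  have T : Tendsto (fun k => ∫ x in Om e, Wg u x * (et R u x * ch (ee k) e p u x * kp e p u x
      - Real.arctan (tf p u x / sf e x) * (et R u x * chd (ee k) e p u x * (rf e p u x * nR e p u x * nT e p u x))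
      - 2 * Real.arctan (tf p u x / sf e x) * (ch (ee k) e p u x * etd R u x) * (hf u x * (rf e p u x * nT e p u x)))) atTop
      (𝓝 (∫ x in Om e, (et R u x * Wg u x * kp e p u x - Wg u x * etd R u x * (2 * Real.arctan (tf p u x / sf e x) * (hf u x * (rf e p u x * nT e p u x)))))) := by
    refine tendsto_integral_of_dominated_convergence D (fun k => ?_) iD (fun k => ?_) ?_
    · have cc := (smooth_ch (ε := ee k) G).continuousOn
      have ccd := cont_chd (ε := ee k) G
      refine ContinuousOn.aestronglyMeasurable ?_ mO
      exact cW.mul ((((ce.mul cc).mul ck).sub (ca.mul ((ce.mul ccd).mul ((cr.mul cnR).mul cnT)))).sub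
        (((continuousOn_const.mul ca).mul (cc.mul ced)).mul (chh.mul (cr.mul cnT))))
    · filter_upwards [ae_restrict_mem mO] with x hx
      have hr := rf_pos (p := p) (u := u) hx
      have W0 := Wg_pos u x
      have E0 := et_nonneg (R := R) (u := u) x
      have q4 := abs_ch_le (e := e) (p := p) (u := u) (ee_pos k) x
      have d0 := chd_nonneg (e := e) (p := p) (u := u) (ee_pos k) x
      have k0 := kp_nonneg G hx
      have k1 := kp_le (e := e) (p := p) (u := u) x
      have a1 : |et R u x * Wg u x * (ch (ee k) e p u x * kp e p u x)| ≤ et R u x * Wg u x := by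
        rw [abs_mul, abs_of_nonneg (mul_nonneg E0 W0.le), abs_mul, abs_of_nonneg k0]
        exact mul_le_of_le_one_right (mul_nonneg E0 W0.le) (mul_le_one₀ q4 k0 k1)
      have a3 : |Wg u x * etd R u x * (ch (ee k) e p u x * (2 * Real.arctan (tf p u x / sf e x) * (hf u x * (rf e p u x * nT e p u x))))| ≤ 4 / R ^ 2 * |16 * R ^ 2| * (et (2 * R) u x * Wg u x) := by
        refine etd_bound (g := fun x => ch (ee k) e p u x * (2 * Real.arctan (tf p u x / sf e x) * (hf u x * (rf e p u x * nT e p u x)))) hR fun hz => ?_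
        have := hb x hx hz
        simp only [abs_mul (ch (ee k) e p u x)]
        calc _ ≤ 1 * (16 * R ^ 2) := by gcongr
          _ = _ := one_mul _
      have a2 : |et R u x * Wg u x * (Real.arctan (tf p u x / sf e x) * ((rf e p u x * chd (ee k) e p u x) * (nR e p u x * nT e p u x)))| ≤
          2 * (et R u x * Wg u x) := by
        have b1 := r_chd_le (p := p) (u := u) (ee_pos k) hx
        have b0 : 0 ≤ rf e p u x * chd (ee k) e p u x := by positivity
        have q3 := abs_nT_le G hx
        have q5 := abs_nR_le G hx
        have q6 := ha (tf p u x / sf e x)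
        rw [abs_mul, abs_of_nonneg (mul_nonneg E0 W0.le), abs_mul, abs_mul, abs_mul (nR e p u x), abs_of_nonneg b0]
        calc _ ≤ et R u x * Wg u x * (2 * (1 * (1 * 1))) := by gcongr
          _ = _ := by ring
      rw [Real.norm_eq_abs]
      have : Wg u x * (et R u x * ch (ee k) e p u x * kp e p u x
        - Real.arctan (tf p u x / sf e x) * (et R u x * chd (ee k) e p u x * (rf e p u x * nR e p u x * nT e p u x))
        - 2 * Real.arctan (tf p u x / sf e x) * (ch (ee k) e p u x * etd R u x) * (hf u x * (rf e p u x * nT e p u x))) =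
        (et R u x * Wg u x * (ch (ee k) e p u x * kp e p u x) - et R u x * Wg u x * (Real.arctan (tf p u x / sf e x) * ((rf e p u x * chd (ee k) e p u x) * (nR e p u x * nT e p u x)))) - Wg u x * etd R u x * (ch (ee k) e p u x * (2 * Real.arctan (tf p u x / sf e x) * (hf u x * (rf e p u x * nT e p u x)))) := by ring
      rw [this]
      exact (abs_sub _ _).trans (add_le_add ((abs_sub _ _).trans (add_le_add a1 a2)) a3)
    · filter_upwards [ae_restrict_mem mO] with x hx
      have l1 := ch_lim (p := p) (u := u) hx
      have l2 := chd_lim (e := e) (p := p) (u := u) (x := x)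
      have := ((((l1.const_mul (et R u x)).mul_const (kp e p u x)).sub (((l2.const_mul (et R u x)).mul_const (rf e p u x * nR e p u x * nT e p u x)).const_mul (Real.arctan (tf p u x / sf e x)))).sub
        (((l1.mul_const (etd R u x)).const_mul (2 * Real.arctan (tf p u x / sf e x))).mul_const (hf u x * (rf e p u x * nT e p u x))))
      have := this.const_mul (Wg u x)
      convert this using 2
      ring
  have T0 : ∀ k, _ := fun k => id_K_cut S (ee_pos k) hR
  simp only [T0] at T
  have h := tendsto_nhds_unique T tendsto_const_nhds
  rw [integral_sub i1 i2] at h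
  linarith

end Bern

namespace Bern
open Filter Topology InnerProductSpace
variable {n : ℕ} {e p : Eu n} {u : Eu n → ℝ} {c l ε R : ℝ}

lemma hd_etR (hR : 0 < R) (x : Eu n) : HasDerivAt (fun R => et R u x) (etd R u x * (-(2 * zf u x)) / R) R := by
  have h1 := (((hasDerivAt_pow 2 R).inv (by positivity)).const_mul (zf u x)).const_sub 2
  have h2 := (hasDerivAt_mf _).comp R h1
  have h3 : HasDerivAt (fun R => et R u x) _ R := h2
  refine h3.congr_deriv ?_
  simp only [Pi.inv_apply, etd, div_eq_mul_inv]
  push_cast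
  field_simp

lemma II_deriv (S : Sol e p u) (hR : 0 < R) :
    HasDerivAt (II e u) (∫ x in Om e, Wg u x * etd R u x * (-(2 * zf u x)) / R) R := by
  have G := S.toGeo
  have mO := (isOpen_Om e).measurableSet
  have cW := cont_Wg (isOpen_Om e) G.C1
  have cz := (smooth_zf G).continuousOn
  refine (hasDerivAt_integral_of_dominated_loc_of_deriv_le (bound := fun x => 32 / R * (et (3 * R) u x * Wg u x))
    (F := fun R x => et R u x * Wg u x) (F' := fun R x => Wg u x * etd R u x * (-(2 * zf u x)) / R)
    (s := ball R (R / 2)) (ball_mem_nhds R (by positivity)) ?_ (int_W S hR) ?_ ?_ ?_ ?_).2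
  · filter_upwards with T
    exact ((smooth_et G).continuousOn.mul cW).aestronglyMeasurable mO
  · exact (((cW.mul (cont_etd G)).mul (continuousOn_const.mul cz).neg).div_const _).aestronglyMeasurable mO
  · filter_upwards with x T hT
    rw [mem_ball, Real.dist_eq, abs_lt] at hT
    have T0 : 0 < T := by linarith
    have W0 := Wg_pos u x
    have e0 := et_nonneg (R := 3 * R) (u := u) x
    by_cases hz : 2 * T ^ 2 ≤ zf u x
    · rw [etd_zero T0 hz]; simp; positivity
    · push Not at hz
      have z0 := zf_nonneg (u := u) x
      have h1 : 1 ≤ et (3 * R) u x := et_ge_one (by positivity) (by nlinarith)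
      rw [Real.norm_eq_abs, abs_div, abs_mul, abs_mul, abs_of_pos W0, abs_of_pos T0, abs_neg, abs_of_nonneg (by positivity : 0 ≤ 2 * zf u x)]
      calc Wg u x * |etd T u x| * (2 * zf u x) / T ≤ Wg u x * (4 / T ^ 2) * (2 * (2 * T ^ 2)) / T := by
            have := abs_etd_le (u := u) T0 x
            gcongr
        _ = 16 / T * (1 * Wg u x) := by field_simp; ring
        _ ≤ 16 / (R / 2) * (et (3 * R) u x * Wg u x) := by gcongr; linarith
        _ = _ := by field_simp; ring
  · exact (int_W S (by positivity : 0 < 3 * R)).const_mul _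
  · filter_upwards with x T hT
    rw [mem_ball, Real.dist_eq, abs_lt] at hT
    have T0 : 0 < T := by linarith
    refine ((hd_etR (u := u) T0 x).mul_const (Wg u x)).congr_deriv ?_
    ring

noncomputable def JJ (e : Eu n) (u : Eu n → ℝ) (R : ℝ) : ℝ := ∫ x in Om e, Wg u x * etd R u x * (-(2 * hf u x ^ 2))

lemma int_J (S : Sol e p u) (hR : 0 < R) : IntegrableOn (fun x => Wg u x * etd R u x * (-(2 * hf u x ^ 2))) (Om e) := by
  refine int_etd S hR (continuousOn_const.mul ((cont_hf S.toGeo).pow 2)).neg (M := 4 * R ^ 2) fun x _ hz => ?_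
  have := h_sq_le u x
  rw [abs_neg, abs_of_nonneg (by positivity)]; linarith

lemma JJ_nonneg (R : ℝ) : 0 ≤ JJ e u R := by
  refine setIntegral_nonneg (isOpen_Om e).measurableSet fun x _ => ?_
  have := etd_nonpos (R := R) (u := u) x
  have := Wg_pos u x
  exact mul_nonneg_of_nonpos_of_nonpos (mul_nonpos_of_nonneg_of_nonpos (by linarith) (by linarith)) (by nlinarith [sq_nonneg (hf u x)])

lemma II_deriv' (S : Sol e p u) (hR : 0 < R) : HasDerivAt (II e u) ((n * II e u R + JJ e u R) / R) R := by
  have h := II_deriv S hR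
  convert h using 1
  have h2 := id_X_lim S hR
  have i1 : IntegrableOn (fun x => Wg u x * etd R u x * (-(2 * (zf u x - hf u x ^ 2)))) (Om e) :=
    int_etd S hR (continuousOn_const.mul ((smooth_zf S.toGeo).continuousOn.sub ((cont_hf S.toGeo).pow 2))).neg
      (M := 4 * R ^ 2) fun x _ hz => by
      have := h_sq_le u x
      rw [abs_neg, abs_of_nonneg (by linarith)]; nlinarith [sq_nonneg (hf u x)]
  rw [h2, JJ, ← integral_add i1 (int_J S hR), integral_div]
  congr 2; ext x; ring

noncomputable def al (e : Eu n) (u : Eu n → ℝ) (R : ℝ) : ℝ := II e u R / R ^ n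

lemma al_deriv (S : Sol e p u) (hR : 0 < R) : HasDerivAt (al e u) (JJ e u R / R ^ (n + 1)) R := by
  have h := (II_deriv' S hR).div (hasDerivAt_pow n R) (by positivity)
  refine h.congr_deriv ?_
  rcases n with _ | m
  · simp
  · simp only [Nat.add_sub_cancel]
    push_cast
    field_simp
    ring

lemma al_mono (S : Sol e p u) : MonotoneOn (al e u) (Ioi 0) := by
  refine monotoneOn_of_deriv_nonneg (convex_Ioi 0) (fun x hx => (al_deriv S hx).continuousAt.continuousWithinAt)
    (fun x hx => ?_) (fun x hx => ?_)
  · rw [interior_Ioi] at hx; exact (al_deriv S hx).differentiableAt.differentiableWithinAt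
  · rw [interior_Ioi] at hx; rw [(al_deriv S hx).deriv]
    have : 0 < x := hx
    have := JJ_nonneg (e := e) (u := u) x
    positivity

lemma al_bdd (S : Sol e p u) : ∃ C, 0 < C ∧ ∀ R, 0 < R → II e u R ≤ C * R ^ n := by
  have hq := qf_pos p
  refine ⟨68 * qf p * volume.real (closedBall (0 : Eu n) 2) + 1, by positivity, fun R hR => ?_⟩
  have := (II_bound S hR).2
  have : 0 < R ^ n := by positivity
  linarith

noncomputable def EE (e p : Eu n) (u : Eu n → ℝ) (R : ℝ) : ℝ := ∫ x in Om e, et R u x * Wg u x * kp e p u x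

lemma int_E (S : Sol e p u) (hR : 0 < R) : IntegrableOn (fun x => et R u x * Wg u x * kp e p u x) (Om e) :=
  int_Wg S hR (cont_kp S.toGeo) (M := 1) fun x hx => by rw [abs_of_nonneg (kp_nonneg S.toGeo hx)]; exact kp_le x

lemma EE_nonneg (S : Sol e p u) (R : ℝ) : 0 ≤ EE e p u R := by
  refine setIntegral_nonneg (isOpen_Om e).measurableSet fun x hx => ?_
  exact mul_nonneg (mul_nonneg (et_nonneg x) (Wg_pos u x).le) (kp_nonneg S.toGeo hx)

lemma EE_le (S : Sol e p u) (hR : 0 < R) {lam : ℝ} (hl : 0 < lam) :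
    EE e p u R ≤ 16 * lam * II e u (2 * R) + 2 / lam * JJ e u R := by
  have G := S.toGeo
  rw [EE, id_K_lim S hR, II, JJ, ← integral_const_mul, ← integral_const_mul]
  have i2 := (int_W S (by positivity : 0 < 2 * R)).const_mul (16 * lam)
  have i3 := (int_J S hR).const_mul (2 / lam)
  rw [← integral_add i2 i3]
  have ca : ContinuousOn (fun x => Real.arctan (tf p u x / sf e x)) (Om e) :=
    Real.continuous_arctan.comp_continuousOn ((smooth_tf G).continuousOn.div (smooth_sf _).continuousOn
      fun x hx => (ne_of_gt (show 0 < sf e x from hx)))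
  have ha : ∀ y, |Real.arctan y| ≤ 2 := fun y => by
    have h1 := Real.arctan_lt_pi_div_two y
    have h2 := Real.neg_pi_div_two_lt_arctan y
    have h3 := Real.pi_lt_four
    rw [abs_le]; constructor <;> linarith
  have hb : ∀ x ∈ Om e, zf u x ≤ 2 * R ^ 2 → |2 * Real.arctan (tf p u x / sf e x) * (hf u x * (rf e p u x * nT e p u x))| ≤ 8 * R * |hf u x| := by
    intro x hx hz
    have q1 := abs_le_of_zf hR (rf_sq_le G x) hz
    have q3 := abs_nT_le G hx
    have q4 := ha (tf p u x / sf e x)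
    rw [abs_mul, abs_mul, abs_mul, abs_mul, abs_two]
    calc _ ≤ 2 * 2 * (|hf u x| * (2 * R * 1)) := by gcongr
      _ = _ := by ring
  have i1 : IntegrableOn (fun x => Wg u x * etd R u x * (2 * Real.arctan (tf p u x / sf e x) * (hf u x * (rf e p u x * nT e p u x)))) (Om e) :=
    int_etd S hR ((continuousOn_const.mul ca).mul ((cont_hf G).mul ((smooth_rf G).continuousOn.mul (cont_nT G)))) (M := 16 * R ^ 2)
      fun x hx hz => (hb x hx hz).trans (by
        have q2 := abs_le_of_zf hR (h_sq_le u x) hz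
        nlinarith)
  refine setIntegral_mono_on i1 (i2.add i3) (isOpen_Om e).measurableSet fun x hx => ?_
  have W0 := Wg_pos u x
  have d0 := etd_nonpos (R := R) (u := u) x
  have e0 := et_nonneg (R := 2 * R) (u := u) x
  by_cases hz : 2 * R ^ 2 ≤ zf u x
  · simp only [etd_zero hR hz, mul_zero, zero_mul, add_zero]; positivity
  · push Not at hz
    have h1 := hb x hx hz.le
    have h2 := abs_etd_le_et (u := u) hR x
    rw [abs_of_nonpos d0] at h2
    set E := -etd R u x with hE
    have E0 : 0 ≤ E := by linarith
    have ed : etd R u x = -E := by simp [hE]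
    rw [ed]
    have h3 : 2 * R * |hf u x| ≤ lam * R ^ 2 + hf u x ^ 2 / lam := by
      rw [← sq_abs (hf u x)]
      have : 0 ≤ (lam * R - |hf u x|) ^ 2 / lam := by positivity
      have h4 : (lam * R - |hf u x|) ^ 2 / lam = lam * R ^ 2 - 2 * R * |hf u x| + |hf u x| ^ 2 / lam := by field_simp; ring
      linarith
    have h5 := (abs_le.1 h1).1
    calc Wg u x * -E * (2 * Real.arctan (tf p u x / sf e x) * (hf u x * (rf e p u x * nT e p u x)))
        = Wg u x * E * -(2 * Real.arctan (tf p u x / sf e x) * (hf u x * (rf e p u x * nT e p u x))) := by ring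
      _ ≤ Wg u x * E * (4 * (lam * R ^ 2 + hf u x ^ 2 / lam)) := by
          refine mul_le_mul_of_nonneg_left ?_ (by positivity); linarith
      _ = 4 * lam * R ^ 2 * Wg u x * E + 2 / lam * (Wg u x * -E * -(2 * hf u x ^ 2)) := by field_simp; ring
      _ ≤ 4 * lam * R ^ 2 * Wg u x * (4 / R ^ 2 * et (2 * R) u x) + 2 / lam * (Wg u x * -E * -(2 * hf u x ^ 2)) := by
          gcongr
      _ = _ := by field_simp; ring

lemma good_scales (S : Sol e p u) : ∃ Rj : ℕ → ℝ, (∀ j, 2 ^ j ≤ Rj j) ∧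
    Tendsto (fun j => EE e p u (Rj j) / Rj j ^ n) atTop (𝓝 0) := by
  obtain ⟨C, hC, hCb⟩ := al_bdd S
  have hm := al_mono S
  have hP : ∀ j : ℕ, (0:ℝ) < 2 ^ j := fun j => by positivity
  have hmono : Monotone fun j : ℕ => al e u (2 ^ j) := fun i j hij =>
    hm (hP i) (hP j) (pow_le_pow_right₀ (by norm_num) hij)
  have hbdd : BddAbove (range fun j : ℕ => al e u (2 ^ j)) := by
    refine ⟨C, ?_⟩
    rintro _ ⟨j, rfl⟩
    have h1 := hCb (2 ^ j) (hP j)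
    exact (div_le_iff₀ (by positivity)).2 h1
  have hl := tendsto_atTop_ciSup hmono hbdd
  have hl2 : Tendsto (fun j : ℕ => al e u (2 ^ (j + 1)) - al e u (2 ^ j)) atTop (𝓝 0) := by
    have := (hl.comp (tendsto_add_atTop_nat 1)).sub hl
    simpa using this
  have mvt : ∀ j : ℕ, ∃ r, 2 ^ j ≤ r ∧ JJ e u r / r ^ n ≤ 2 * (al e u (2 ^ (j + 1)) - al e u (2 ^ j)) := by
    intro j
    have hlt : (2:ℝ) ^ j < 2 ^ (j + 1) := by rw [pow_succ]; linarith [hP j]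
    obtain ⟨r, hr, h⟩ := exists_hasDerivAt_eq_slope (al e u) (fun r => JJ e u r / r ^ (n + 1)) hlt
      (fun x hx => (al_deriv S ((hP j).trans_le hx.1)).continuousAt.continuousWithinAt)
      (fun x hx => al_deriv S ((hP j).trans hx.1))
    refine ⟨r, hr.1.le, ?_⟩
    have r0 : 0 < r := (hP j).trans hr.1
    have J0 := JJ_nonneg (e := e) (u := u) r
    have e1 : (2:ℝ) ^ (j + 1) - 2 ^ j = 2 ^ j := by rw [pow_succ]; ring
    rw [e1, eq_div_iff (hP j).ne'] at h
    rw [← h]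
    have h2 : r ≤ 2 * 2 ^ j := by have := hr.2; rw [pow_succ] at this; linarith
    calc JJ e u r / r ^ n = JJ e u r / r ^ (n + 1) * r := by rw [pow_succ]; field_simp
      _ ≤ JJ e u r / r ^ (n + 1) * (2 * 2 ^ j) := by gcongr
      _ = _ := by ring
  choose Rj h1 h2 using mvt
  refine ⟨Rj, h1, ?_⟩
  have R0 : ∀ j, 0 < Rj j := fun j => (hP j).trans_le (h1 j)
  have hJ : Tendsto (fun j => JJ e u (Rj j) / Rj j ^ n) atTop (𝓝 0) := by
    refine squeeze_zero (fun j => div_nonneg (JJ_nonneg _) (pow_nonneg (R0 j).le _)) h2 ?_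
    simpa using hl2.const_mul 2
  rw [Metric.tendsto_atTop]
  intro ε hε
  set lam := ε / (64 * C * 2 ^ n) with hlam
  have l0 : 0 < lam := by positivity
  have := hJ.const_mul (2 / lam)
  rw [mul_zero] at this
  rw [Metric.tendsto_atTop] at this
  obtain ⟨N, hN⟩ := this (ε / 2) (by positivity)
  refine ⟨N, fun j hj => ?_⟩
  have a := hN j hj
  rw [Real.dist_eq, sub_zero] at a ⊢
  have a1 := (abs_lt.1 a).2
  have Rn : 0 < Rj j ^ n := pow_pos (R0 j) n
  rw [abs_of_nonneg (div_nonneg (EE_nonneg S _) Rn.le), div_lt_iff₀ Rn]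
  have b1 := EE_le S (R0 j) l0
  have b2 := hCb (2 * Rj j) (by have := R0 j; positivity)
  rw [← mul_div_assoc, div_lt_iff₀ Rn] at a1
  have b3 : 16 * lam * II e u (2 * Rj j) ≤ 16 * lam * (C * (2 * Rj j) ^ n) := by gcongr
  have b4 : 16 * lam * (C * (2 * Rj j) ^ n) = ε / 4 * Rj j ^ n := by
    rw [hlam, mul_pow]; field_simp; ring
  have b5 : 0 < ε * Rj j ^ n := by positivity
  linarith

end Bern

namespace Bern
open Filter Topology InnerProductSpace
variable {n : ℕ} {e p : Eu n} {u : Eu n → ℝ} {c l ε R : ℝ}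

noncomputable def Vv (e p : Eu n) (u : Eu n → ℝ) (x : Eu n) : Eu n :=
  (sf e x / qf p) • (Dg u x - p) - tf p u x • e

lemma Vv_le (G : Geo e p u) {x : Eu n} (hx : x ∈ Om e) :
    ‖Vv e p u x‖ ≤ 2 * rf e p u x * Wg u x * √(kp e p u x) := by
  have hr := rf_pos (p := p) (u := u) hx
  have hq := qf_pos p
  have hW := Wg_pos u x
  have hs : 0 < sf e x := hx
  have r2 := rf_sq (e := e) (p := p) (u := u) x
  have q2 := qf_sq p
  have W2 := Wg_sq u x
  have hee : ⟪e, e⟫ = (1:ℝ) := by rw [real_inner_self_eq_norm_sq, G.he]; norm_num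
  have hep := G.hep
  obtain ⟨Th, hTh⟩ : ∃ Th : Eu n, Th = -(sf e x / (qf p * rf e p u x)) • p - (tf p u x / rf e p u x) • e := ⟨_, rfl⟩
  obtain ⟨Tv, hTv⟩ : ∃ Tv : ℝ, Tv = sf e x / (qf p * rf e p u x) := ⟨_, rfl⟩
  obtain ⟨t, ht⟩ : ∃ t : ℝ, t = nT e p u x := ⟨_, rfl⟩
  have hT1 : ⟪Th, Th⟫ + Tv ^ 2 = (1:ℝ) := by
    rw [hTh, hTv]
    simp only [inner_sub_left, inner_sub_right, real_inner_smul_left, real_inner_smul_right, hee, hep,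
      real_inner_comm e p, real_inner_self_eq_norm_sq p]
    have h6 : ‖p‖ ^ 2 = qf p ^ 2 - 1 := by linarith
    rw [h6]
    field_simp
    linear_combination -(qf p ^ 2) * r2
  have hnT : t = -⟪Dg u x, Th⟫ / Wg u x + Tv / Wg u x := by
    rw [hTh, hTv, ht]
    simp only [inner_sub_right, real_inner_smul_right, nT, nN, nE, real_inner_comm e (Dg u x), real_inner_comm p (Dg u x)]
    field_simp
    ring
  obtain ⟨Xh, hXh⟩ : ∃ Xh : Eu n, Xh = -((Wg u x)⁻¹ • Dg u x) - t • Th := ⟨_, rfl⟩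
  obtain ⟨Xv, hXv⟩ : ∃ Xv : ℝ, Xv = (Wg u x)⁻¹ - t * Tv := ⟨_, rfl⟩
  have hX : ‖Xh‖ ^ 2 + Xv ^ 2 = kp e p u x := by
    have h0 : t * Wg u x = Tv - ⟪Dg u x, Th⟫ := by rw [hnT]; field_simp; ring
    rw [← real_inner_self_eq_norm_sq, hXh, hXv, kp, ← ht]
    simp only [inner_sub_left, inner_sub_right, real_inner_smul_left, real_inner_smul_right, inner_neg_left,
      inner_neg_right, real_inner_comm (Dg u x) Th, real_inner_self_eq_norm_sq (Dg u x)]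
    have h4 : ‖Dg u x‖ ^ 2 = Wg u x ^ 2 - 1 := by linarith
    have h5 : ⟪Dg u x, Th⟫ = Tv - t * Wg u x := by linarith
    rw [h4, h5]
    have h6 : ⟪Th, Th⟫ = 1 - Tv ^ 2 := by linarith
    rw [h6]
    field_simp
    ring
  have hV : Vv e p u x = (rf e p u x * Wg u x * Xv) • Th - (sf e x * Wg u x / qf p) • Xh := by
    have a1 : rf e p u x * Wg u x * Xv + sf e x * Wg u x / qf p * t = rf e p u x := by
      rw [hXv, hTv]; field_simp; ring
    have : (rf e p u x * Wg u x * Xv) • Th - (sf e x * Wg u x / qf p) • Xh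
        = (rf e p u x * Wg u x * Xv + sf e x * Wg u x / qf p * t) • Th + (sf e x * Wg u x / qf p * (Wg u x)⁻¹) • Dg u x := by
      rw [hXh]; module
    rw [this, a1, hTh, Vv]
    have a2 : sf e x * Wg u x / qf p * (Wg u x)⁻¹ = sf e x / qf p := by field_simp
    have a3 : rf e p u x * (tf p u x / rf e p u x) = tf p u x := by field_simp
    have a4 : rf e p u x * (sf e x / (qf p * rf e p u x)) = sf e x / qf p := by field_simp
    rw [a2, smul_sub (rf e p u x), smul_smul, smul_smul, a3, mul_neg, a4]
    module
  have k0 := kp_nonneg G hx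
  have b1 : ‖Xh‖ ≤ √(kp e p u x) := Real.le_sqrt_of_sq_le (by nlinarith [sq_nonneg Xv])
  have b2 : |Xv| ≤ √(kp e p u x) := Real.abs_le_sqrt (by nlinarith [sq_nonneg ‖Xh‖])
  have b3 : ‖Th‖ ≤ 1 := by
    rw [real_inner_self_eq_norm_sq] at hT1
    nlinarith [norm_nonneg Th, sq_nonneg Tv]
  have hq1 := one_le_qf p
  have hsr := sf_le_rf (e := e) (p := p) (u := u) x
  rw [hV]
  refine (norm_sub_le _ _).trans ?_
  rw [norm_smul, norm_smul, Real.norm_eq_abs, Real.norm_eq_abs, abs_mul, abs_of_pos (mul_pos hr hW),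
    abs_of_pos (by positivity : 0 < sf e x * Wg u x / qf p)]
  have c1 : rf e p u x * Wg u x * |Xv| * ‖Th‖ ≤ rf e p u x * Wg u x * √(kp e p u x) * 1 := by gcongr
  have c2 : sf e x * Wg u x / qf p * ‖Xh‖ ≤ rf e p u x * Wg u x * √(kp e p u x) := by
    gcongr
    rw [div_le_iff₀ hq]
    have := mul_le_mul_of_nonneg_right hsr hW.le
    have : rf e p u x * Wg u x * 1 ≤ rf e p u x * Wg u x * qf p := by gcongr
    linarith
  linarith

/-- slope function -/
noncomputable def sl (e p : Eu n) (u : Eu n → ℝ) (x : Eu n) : ℝ := tf p u x / sf e x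

lemma smooth_sl (G : Geo e p u) : ContDiffOn ℝ 1 (sl e p u) (Om e) :=
  (smooth_tf G).div (smooth_sf _) fun x hx => ne_of_gt hx

lemma hasFDerivAt_sl (G : Geo e p u) {x : Eu n} (hx : x ∈ Om e) :
    HasFDerivAt (sl e p u) (innerSL ℝ ((sf e x ^ 2)⁻¹ • Vv e p u x)) x := by
  have hs : 0 < sf e x := hx
  have hq := qf_pos p
  have h := (hasFDerivAt_tf G hx).mul ((hasDerivAt_inv hs.ne').comp_hasFDerivAt x (hasFDerivAt_sf (e := e) x))
  refine hfd_congr h (fun y => by simp [sl, div_eq_mul_inv]) fun y => ?_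
  simp only [_root_.add_apply, Function.comp, Ls, Lt, Vv, _root_.sub_apply, _root_.smul_apply, smul_eq_mul, innerSL_apply_apply,
    real_inner_smul_left, inner_sub_left]
  field_simp
  ring

noncomputable def ztd (k y : ℝ) : ℝ := max 0 (2 - |y| / k)
noncomputable def zt (k y : ℝ) : ℝ := ∫ t in (0:ℝ)..y, ztd k t

lemma ztd_cont (k : ℝ) : Continuous (ztd k) := by unfold ztd; fun_prop
lemma ztd_nonneg (k y : ℝ) : 0 ≤ ztd k y := le_max_left _ _
lemma ztd_le {k : ℝ} (hk : 0 < k) (y : ℝ) : ztd k y ≤ 2 :=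
  max_le (by norm_num) (by have : 0 ≤ |y| / k := by positivity
                           linarith)
lemma ztd_ge {k : ℝ} (hk : 0 < k) {y : ℝ} (hy : |y| ≤ k) : 1 ≤ ztd k y :=
  le_max_of_le_right (by have : |y| / k ≤ 1 := by rwa [div_le_one hk]
                         linarith)
lemma ztd_zero {k : ℝ} (hk : 0 < k) {y : ℝ} (hy : 2 * k ≤ |y|) : ztd k y = 0 :=
  max_eq_left (by have : 2 ≤ |y| / k := by rwa [le_div_iff₀ hk]
                  linarith)
lemma zt_deriv (k y : ℝ) : HasDerivAt (zt k) (ztd k y) y :=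
  intervalIntegral.integral_hasDerivAt_right ((ztd_cont k).intervalIntegrable _ _)
    ((ztd_cont k).stronglyMeasurableAtFilter _ _) (ztd_cont k).continuousAt
lemma zt_smooth (k : ℝ) : ContDiff ℝ 1 (zt k) := by
  rw [contDiff_one_iff_deriv]
  refine ⟨fun y => (zt_deriv k y).differentiableAt, ?_⟩
  rw [show deriv (zt k) = ztd k from funext fun y => (zt_deriv k y).deriv]
  exact ztd_cont k
lemma zt_sub (k a b : ℝ) : zt k b - zt k a = ∫ t in a..b, ztd k t := by
  unfold zt
  rw [intervalIntegral.integral_interval_sub_left] <;> exact (ztd_cont k).intervalIntegrable _ _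
lemma zt_mono (k : ℝ) : Monotone (zt k) := by
  intro a b h
  have := zt_sub k a b
  have h2 : 0 ≤ ∫ t in a..b, ztd k t := intervalIntegral.integral_nonneg h fun t _ => ztd_nonneg k t
  linarith
lemma zt_exp {k a b : ℝ} (hk : 0 < k) (ha : -k ≤ a) (hab : a ≤ b) (hb : b ≤ k) : b - a ≤ zt k b - zt k a := by
  rw [zt_sub]
  calc b - a = ∫ t in a..b, (1:ℝ) := by simp
    _ ≤ _ := intervalIntegral.integral_mono_on hab (by simp) ((ztd_cont k).intervalIntegrable _ _)
        fun t ht => ztd_ge hk (abs_le.2 ⟨by linarith [ht.1], by linarith [ht.2]⟩)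
lemma cl_le_zt_aux {k a b : ℝ} (hk : 0 < k) (hab : a ≤ b) : |cl k b - cl k a| ≤ |zt k b - zt k a| := by
  have h0 := zt_mono k hab
  have hm : cl k a ≤ cl k b := by unfold cl; gcongr
  rw [abs_of_nonneg (by linarith), abs_of_nonneg (by linarith)]
  rcases lt_or_ge b (-k) with h | h
  · have e1 : cl k b = -k := by unfold cl; rw [min_eq_left (by linarith), max_eq_left h.le]
    have e2 : cl k a = -k := by unfold cl; rw [min_eq_left (by linarith), max_eq_left (by linarith)]
    linarith
  rcases lt_or_ge k a with h' | h'
  · have e1 : cl k b = k := by unfold cl; rw [min_eq_right (by linarith), max_eq_right (by linarith)]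
    have e2 : cl k a = k := by unfold cl; rw [min_eq_right (by linarith), max_eq_right (by linarith)]
    linarith
  have f1 : cl k b ≤ b := by unfold cl; exact max_le h (min_le_left _ _)
  have f2 : a ≤ cl k a := by unfold cl; rw [min_eq_left h']; exact le_max_right _ _
  have g1 := abs_le.1 (cl_abs_le hk.le a)
  have g2 := abs_le.1 (cl_abs_le hk.le b)
  have := zt_exp hk g1.1 hm g2.2
  have := zt_mono k f1
  have := zt_mono k f2
  linarith
lemma cl_le_zt {k : ℝ} (hk : 0 < k) (a b : ℝ) : |cl k a - cl k b| ≤ |zt k a - zt k b| := by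
  rcases le_total a b with h | h
  · rw [abs_sub_comm, abs_sub_comm (zt k a)]; exact cl_le_zt_aux hk h
  · exact cl_le_zt_aux hk h

lemma cl_scale {k s y : ℝ} (hs : 0 < s) : cl (k * s) (y * s) = s * cl k y := by
  unfold cl
  rw [mul_max_of_nonneg _ _ hs.le, mul_min_of_nonneg _ _ hs.le, mul_comm y s, mul_comm k s, mul_neg]

/-- truncated slope -/
noncomputable def gf (k : ℝ) (e p : Eu n) (u : Eu n → ℝ) (x : Eu n) : ℝ := zt k (sl e p u x)

lemma smooth_gf (k : ℝ) (G : Geo e p u) : ContDiffOn ℝ 1 (gf k e p u) (Om e) :=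
  (zt_smooth k).comp_contDiffOn (smooth_sl G)

lemma gf_fderiv_le {k : ℝ} (hk : 0 < k) (G : Geo e p u) {x : Eu n} (hx : x ∈ Om e) :
    ‖fderiv ℝ (gf k e p u) x‖ ≤ ({x | |tf p u x| ≤ 2 * k * sf e x}.indicator
      (fun x => 4 * (1 + 2 * k) / sf e x * (Wg u x * √(kp e p u x))) x) := by
  have hs : 0 < sf e x := hx
  have h : HasFDerivAt (gf k e p u) (ztd k (sl e p u x) • innerSL ℝ ((sf e x ^ 2)⁻¹ • Vv e p u x)) x :=
    (zt_deriv k _).comp_hasFDerivAt x (hasFDerivAt_sl G hx)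
  rw [h.fderiv, norm_smul, innerSL_apply_norm, norm_smul]
  have hab : |sl e p u x| = |tf p u x| / sf e x := by rw [sl, abs_div, abs_of_pos hs]
  by_cases hc : |tf p u x| ≤ 2 * k * sf e x
  · rw [indicator_of_mem (by exact hc)]
    have h1 := Vv_le G hx
    have h2 : rf e p u x ≤ (1 + 2 * k) * sf e x := by
      rw [rf]
      refine Real.sqrt_le_iff.2 ⟨by positivity, ?_⟩
      have : tf p u x ^ 2 ≤ (2 * k * sf e x) ^ 2 := by
        rw [← sq_abs]; gcongr
      have : 0 ≤ k * sf e x ^ 2 := by positivity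
      nlinarith
    have h3 := ztd_le hk (sl e p u x)
    have h0 := ztd_nonneg k (sl e p u x)
    have hW := (Wg_pos u x).le
    rw [Real.norm_eq_abs, Real.norm_eq_abs, abs_of_nonneg h0, abs_of_pos (by positivity)]
    calc ztd k (sl e p u x) * ((sf e x ^ 2)⁻¹ * ‖Vv e p u x‖)
        ≤ 2 * ((sf e x ^ 2)⁻¹ * (2 * ((1 + 2 * k) * sf e x) * Wg u x * √(kp e p u x))) := by
          gcongr
          exact h1.trans (by gcongr)
      _ = _ := by field_simp; ring
  · rw [indicator_of_notMem (by exact hc)]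
    push Not at hc
    rw [ztd_zero hk (by rw [hab, le_div_iff₀ hs]; exact hc.le)]
    simp
end Bern

namespace Bern
open Filter Topology InnerProductSpace
variable {n : ℕ} {e p : Eu n} {u : Eu n → ℝ} {c l ε R : ℝ}

lemma lint_affine {h : Eu n → ℝ≥0∞} (hh : Measurable h) {t : ℝ} (ht : 1 / 2 ≤ t) (y : Eu n) :
    ∫⁻ x, h (t • x + y) ≤ 2 ^ n * ∫⁻ x, h x := by
  have t0 : 0 < t := by linarith
  have h1 : ∫⁻ x, h (t • x + y) = ∫⁻ x, h (x + y) ∂(Measure.map (t • ·) (volume : Measure (Eu n))) := by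
    rw [lintegral_map (by fun_prop) (by fun_prop)]
  rw [h1, Measure.map_addHaar_smul _ t0.ne', lintegral_smul_measure, lintegral_add_right_eq_self]
  rw [smul_eq_mul]
  gcongr
  rw [show (2:ℝ≥0∞) ^ n = ENNReal.ofReal (2 ^ n) by
    rw [ENNReal.ofReal_pow (by norm_num)]; norm_num]
  apply ENNReal.ofReal_le_ofReal
  rw [abs_of_pos (by positivity), finrank_euclideanSpace, Fintype.card_fin, ← inv_pow]
  gcongr
  rw [inv_le_comm₀ t0 (by norm_num)]
  linarith

lemma poinc_t {C : Set (Eu n)} {h : Eu n → ℝ≥0∞} (hh : Measurable h) (t : ℝ) :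
    ∫⁻ x in C, ∫⁻ y in C, h ((1 - t) • x + t • y) ≤ 2 ^ n * (∫⁻ x, h x) * volume C := by
  rcases le_total (1 / 2) t with ht | ht
  · calc _ ≤ ∫⁻ x in C, 2 ^ n * ∫⁻ x, h x := by
          refine lintegral_mono fun x => ?_
          refine (setLIntegral_le_lintegral _ _).trans ?_
          simp_rw [add_comm ((1 - t) • x)]
          exact lint_affine hh ht _
      _ = _ := by rw [setLIntegral_const]
  · rw [lintegral_lintegral_swap (by fun_prop)]
    calc _ ≤ ∫⁻ x in C, 2 ^ n * ∫⁻ x, h x := by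
          refine lintegral_mono fun x => ?_
          refine (setLIntegral_le_lintegral _ _).trans ?_
          exact lint_affine hh (by linarith) _
      _ = _ := by rw [setLIntegral_const]

lemma seg_bound {Ω C : Set (Eu n)} (hΩ : IsOpen Ω) {g : Eu n → ℝ} (hg : ContDiffOn ℝ 1 g Ω) (hC : Convex ℝ C)
    (hCΩ : C ⊆ Ω) {D : ℝ} (hD : ∀ x ∈ C, ∀ y ∈ C, ‖y - x‖ ≤ D) {x y : Eu n} (hx : x ∈ C) (hy : y ∈ C) :
    ‖g y - g x‖ₑ ≤ ∫⁻ t in Icc (0:ℝ) 1, ENNReal.ofReal D *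
      C.indicator (fun x => ‖fderiv ℝ g x‖ₑ) ((1 - t) • x + t • y) := by
  have hm : ∀ t ∈ Icc (0:ℝ) 1, (1 - t) • x + t • y ∈ C := fun t ht =>
    hC hx hy (by linarith [ht.2]) ht.1 (by ring)
  have hd : ∀ t ∈ uIcc (0:ℝ) 1, HasDerivAt (fun t : ℝ => g ((1 - t) • x + t • y))
      (fderiv ℝ g ((1 - t) • x + t • y) (y - x)) t := by
    intro t ht
    rw [uIcc_of_le zero_le_one] at ht
    have h1 := cdiff_hasFDerivAt hΩ hg (hCΩ (hm t ht))
    have h2 : HasDerivAt (fun t : ℝ => (1 - t) • x + t • y) (y - x) t := by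
      have := (((hasDerivAt_id t).const_sub 1).smul_const x).add ((hasDerivAt_id t).smul_const y)
      exact this.congr_deriv (by module)
    exact h1.comp_hasDerivAt t h2
  have hc : ContinuousOn (fun t : ℝ => fderiv ℝ g ((1 - t) • x + t • y) (y - x)) (uIcc (0:ℝ) 1) := by
    rw [uIcc_of_le zero_le_one]
    refine ContinuousOn.clm_apply ((cdiff_contFDeriv hΩ hg).comp (by fun_prop) fun t ht => hCΩ (hm t ht)) continuousOn_const
  have h3 := intervalIntegral.integral_eq_sub_of_hasDerivAt hd hc.intervalIntegrable
  simp only [sub_self, zero_smul, one_smul, zero_add, sub_zero, add_zero] at h3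
  rw [← h3, intervalIntegral.integral_of_le zero_le_one, ← integral_Icc_eq_integral_Ioc]
  refine (enorm_integral_le_lintegral_enorm _).trans ?_
  refine setLIntegral_mono' measurableSet_Icc fun t ht => ?_
  rw [indicator_of_mem (hm t ht)]
  rw [← ofReal_norm, ← ofReal_norm, ← ENNReal.ofReal_mul ((norm_nonneg _).trans (hD x hx y hy))]
  apply ENNReal.ofReal_le_ofReal
  refine (ContinuousLinearMap.le_opNorm _ _).trans ?_
  rw [mul_comm]
  exact mul_le_mul_of_nonneg_right (hD x hx y hy) (norm_nonneg _)

lemma meas_ind {C : Set (Eu n)} {f : Eu n → ℝ} (hf : ContinuousOn f C) (hC : MeasurableSet C) :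
    Measurable (C.indicator f) := by
  classical
  rw [← Set.piecewise_eq_indicator]
  exact hf.measurable_piecewise continuousOn_const hC

lemma poinc {Ω C : Set (Eu n)} (hΩ : IsOpen Ω) {g : Eu n → ℝ} (hg : ContDiffOn ℝ 1 g Ω) (hC : Convex ℝ C)
    (hK : IsCompact C) (hCΩ : C ⊆ Ω) {D : ℝ} (hD0 : 0 ≤ D) (hD : ∀ x ∈ C, ∀ y ∈ C, ‖y - x‖ ≤ D) (hvol : volume C ≠ 0) :
    ∃ y ∈ C, ∫ x in C, |g x - g y| ≤ D * 2 ^ n * ∫ x in C, ‖fderiv ℝ g x‖ := by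
  have hCm := hK.measurableSet
  have hfin : volume C ≠ ⊤ := hK.measure_lt_top.ne
  have hgc : ContinuousOn g C := hg.continuousOn.mono hCΩ
  have hfc : ContinuousOn (fun x => fderiv ℝ g x) C := (cdiff_contFDeriv hΩ hg).mono hCΩ
  set h : Eu n → ℝ≥0∞ := C.indicator (fun x => ‖fderiv ℝ g x‖ₑ) with hh
  have hm : Measurable h := by
    have : h = fun x => ENNReal.ofReal (C.indicator (fun x => ‖fderiv ℝ g x‖) x) := by
      ext x; rw [hh]; by_cases hx : x ∈ C <;> simp [hx]
    rw [this]
    refine ENNReal.measurable_ofReal.comp ?_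
    exact meas_ind hfc.norm hCm
  set B : ℝ≥0∞ := ENNReal.ofReal D * (2 ^ n * ∫⁻ x, h x) with hB
  have h1 : ∫⁻ x in C, ∫⁻ y in C, ‖g y - g x‖ₑ ≤ B * volume C := by
    calc _ ≤ ∫⁻ x in C, ∫⁻ y in C, ∫⁻ t in Icc (0:ℝ) 1, ENNReal.ofReal D * h ((1 - t) • x + t • y) :=
          setLIntegral_mono' hCm fun x hx => setLIntegral_mono' hCm fun y hy => seg_bound hΩ hg hC hCΩ hD hx hy
      _ = ∫⁻ x in C, ∫⁻ t in Icc (0:ℝ) 1, ∫⁻ y in C, ENNReal.ofReal D * h ((1 - t) • x + t • y) := by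
          refine lintegral_congr fun x => ?_
          rw [lintegral_lintegral_swap]
          fun_prop
      _ = ∫⁻ t in Icc (0:ℝ) 1, ∫⁻ x in C, ∫⁻ y in C, ENNReal.ofReal D * h ((1 - t) • x + t • y) := by
          rw [lintegral_lintegral_swap]
          refine Measurable.aemeasurable ?_
          refine Measurable.lintegral_prod_right' (f := fun z : (Eu n × ℝ) × Eu n => ENNReal.ofReal D * h ((1 - z.1.2) • z.1.1 + z.1.2 • z.2)) ?_
          fun_prop
      _ ≤ ∫⁻ t in Icc (0:ℝ) 1, B * volume C := by
          refine lintegral_mono fun t => ?_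
          have : ∀ x, ∫⁻ y in C, ENNReal.ofReal D * h ((1 - t) • x + t • y) = ENNReal.ofReal D * ∫⁻ y in C, h ((1 - t) • x + t • y) :=
            fun x => lintegral_const_mul _ (by fun_prop)
          simp only [this]
          rw [lintegral_const_mul _ (by fun_prop), hB, mul_assoc]
          gcongr
          exact poinc_t hm t
      _ = B * volume C := by rw [setLIntegral_const]; simp
  obtain ⟨y, hy, h2⟩ := exists_le_setLAverage hvol hfin (f := fun x => ∫⁻ y in C, ‖g y - g x‖ₑ) (by
    have hg' := meas_ind hgc hCm
    have m1 : Measurable fun x => ∫⁻ y in C, ‖C.indicator g y - C.indicator g x‖ₑ := by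
      refine Measurable.lintegral_prod_right' (f := fun z : Eu n × Eu n => ‖C.indicator g z.2 - C.indicator g z.1‖ₑ) ?_
      fun_prop
    refine m1.aemeasurable.congr ?_
    filter_upwards [ae_restrict_mem hCm] with x hx
    refine setLIntegral_congr_fun hCm fun y hy => ?_
    simp [hx, hy])
  refine ⟨y, hy, ?_⟩
  have h3 : ∫⁻ x in C, ‖g x - g y‖ₑ ≤ B := by
    refine h2.trans ?_
    rw [setLAverage_eq]
    exact ENNReal.div_le_of_le_mul h1
  have i1 : IntegrableOn (fun x => |g x - g y|) C := (hgc.sub continuousOn_const).abs.integrableOn_compact hK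
  have i2 : IntegrableOn (fun x => ‖fderiv ℝ g x‖) C := hfc.norm.integrableOn_compact hK
  have h4 : ∫⁻ x, h x = ENNReal.ofReal (∫ x in C, ‖fderiv ℝ g x‖) := by
    rw [hh, lintegral_indicator hCm, ofReal_integral_eq_lintegral_ofReal i2 (ae_of_all _ fun x => norm_nonneg _)]
    simp
  have h5 : ∫⁻ x in C, ‖g x - g y‖ₑ = ENNReal.ofReal (∫ x in C, |g x - g y|) := by
    rw [ofReal_integral_eq_lintegral_ofReal i1 (ae_of_all _ fun x => abs_nonneg _)]
    refine lintegral_congr fun x => ?_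
    rw [← ofReal_norm, Real.norm_eq_abs]
  rw [h5, hB, h4, show (2:ℝ≥0∞) ^ n = ENNReal.ofReal (2 ^ n) by
    rw [ENNReal.ofReal_pow (by norm_num)]; norm_num, ← ENNReal.ofReal_mul (by positivity), ← ENNReal.ofReal_mul hD0] at h3
  have h6 : 0 ≤ ∫ x in C, ‖fderiv ℝ g x‖ := integral_nonneg fun x => norm_nonneg _
  rw [ENNReal.ofReal_le_ofReal_iff (by positivity)] at h3
  linarith
end Bern

namespace Bern
open Filter Topology InnerProductSpace
variable {n : ℕ} {e p : Eu n} {u : Eu n → ℝ} {c l ε R : ℝ}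

def CC (e : Eu n) (d R : ℝ) : Set (Eu n) := closedBall 0 (2 * R) ∩ {x | d * R ≤ sf e x}
def St (e : Eu n) (d R : ℝ) : Set (Eu n) := closedBall 0 (2 * R) ∩ {x | 0 < sf e x ∧ sf e x < d * R}

lemma cont_sf : Continuous (sf e) := by unfold sf; fun_prop

lemma CC_compact (d R : ℝ) : IsCompact (CC e d R) :=
  (isCompact_closedBall _ _).inter_right (isClosed_le continuous_const cont_sf)
lemma CC_convex (d R : ℝ) : Convex ℝ (CC e d R) :=
  (convex_closedBall _ _).inter (convex_halfSpace_ge (innerSL ℝ e).toLinearMap.isLinear _)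
lemma St_meas (d R : ℝ) : MeasurableSet (St e d R) :=
  isClosed_closedBall.measurableSet.inter
    ((isOpen_lt continuous_const cont_sf).inter (isOpen_lt cont_sf continuous_const)).measurableSet
lemma St_fin (d R : ℝ) : volume (St e d R) ≠ ⊤ :=
  ((measure_mono inter_subset_left).trans_lt measure_closedBall_lt_top).ne
lemma CC_sub {d : ℝ} (hd : 0 < d) (hR : 0 < R) : CC e d R ⊆ Om e := fun x hx =>
  lt_of_lt_of_le (mul_pos hd hR) hx.2

lemma CC_vol (he : ‖e‖ = 1) {d : ℝ} (hd : d ≤ 1) (hR : 0 < R) : volume (CC e d R) ≠ 0 := by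
  have h : ball ((3 / 2 * R) • e) (R / 2) ⊆ CC e d R := by
    intro x hx
    rw [mem_ball, dist_eq_norm] at hx
    have h1 : ‖x‖ ≤ ‖x - (3 / 2 * R) • e‖ + ‖(3 / 2 * R) • e‖ := by
      simpa using norm_add_le (x - (3 / 2 * R) • e) ((3 / 2 * R) • e)
    have h2 : ‖(3 / 2 * R) • e‖ = 3 / 2 * R := by
      rw [norm_smul, he, mul_one, Real.norm_eq_abs, abs_of_pos (by positivity)]
    refine ⟨by rw [mem_closedBall_zero_iff]; linarith, ?_⟩
    have h3 := abs_le.1 (abs_real_inner_le_norm e (x - (3 / 2 * R) • e))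
    rw [he, inner_sub_right, real_inner_smul_right, real_inner_self_eq_norm_sq, he] at h3
    have : d * R ≤ R := by nlinarith
    change d * R ≤ ⟪e, x⟫
    linarith [h3.1]
  have h0 : 0 < volume (ball ((3 / 2 * R) • e) (R / 2)) := measure_ball_pos _ _ (by positivity)
  exact (h0.trans_le (measure_mono h)).ne'

open scoped Pointwise in
lemma St_scale (hR : 0 < R) (d : ℝ) : volume.real (St e d R) = volume.real (St e d 1) * R ^ n := by
  have h1 : St e d R = R • St e d 1 := by
    ext x
    rw [mem_smul_set_iff_inv_smul_mem₀ hR.ne']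
    simp only [St, sf, mem_inter_iff, mem_closedBall_zero_iff, mem_setOf_eq, inner_smul_right, norm_smul, norm_inv,
      Real.norm_eq_abs, abs_of_pos hR, mul_one]
    rw [inv_mul_le_iff₀ hR, inv_mul_lt_iff₀ hR, mul_comm R 2, mul_comm R d,
      mul_pos_iff_of_pos_left (inv_pos.2 hR)]
  rw [measureReal_def, h1, Measure.addHaar_smul, ENNReal.toReal_mul, ENNReal.toReal_ofReal (abs_nonneg _),
    finrank_euclideanSpace, Fintype.card_fin, abs_of_pos (by positivity), measureReal_def, mul_comm]

lemma St_lim (e : Eu n) : Tendsto (fun j : ℕ => volume.real (St e (2 / ((j:ℝ) + 2)) 1)) atTop (𝓝 0) := by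
  have h := tendsto_measure_iInter_atTop (μ := (volume : Measure (Eu n))) (s := fun j : ℕ => St e (2 / ((j:ℝ) + 2)) 1)
    (fun j => (St_meas _ _).nullMeasurableSet) (fun i j hij x hx => ⟨hx.1, hx.2.1, lt_of_lt_of_le hx.2.2 (by
      have : (i:ℝ) ≤ j := by exact_mod_cast hij
      gcongr)⟩) ⟨0, St_fin _ _⟩
  have h0 : ⋂ j : ℕ, St e (2 / ((j:ℝ) + 2)) 1 = ∅ := by
    ext x
    simp only [mem_iInter, mem_empty_iff_false, iff_false, not_forall]
    by_contra hc
    push Not at hc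
    have h1 := (hc 0).2.1
    obtain ⟨j, hj⟩ := exists_nat_gt (2 / sf e x)
    have h2 := (hc j).2.2
    rw [div_lt_iff₀ h1] at hj
    rw [mul_one, lt_div_iff₀ (by positivity)] at h2
    nlinarith
  rw [h0, measure_empty] at h
  have := (ENNReal.tendsto_toReal ENNReal.zero_ne_top).comp h
  simpa [measureReal_def, Function.comp_def] using this

lemma grad_int (S : Sol e p u) (hR : 0 < R) {k lam : ℝ} (hk : 2 ≤ k) (hl : 0 < lam) :
    ∫ x in CC e (2 / k) R, ‖fderiv ℝ (gf k e p u) x‖ ≤ 2 * k * (1 + 2 * k) / R *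
      (lam * II e u ((2 + qf p * (4 * k + 2)) * R) + EE e p u ((2 + qf p * (4 * k + 2)) * R) / lam) := by
  have G := S.toGeo
  have k0 : 0 < k := by linarith
  have hq := qf_pos p
  have hq1 := one_le_qf p
  have mO := (isOpen_Om e).measurableSet
  obtain ⟨R', hR'⟩ : ∃ R', R' = (2 + qf p * (4 * k + 2)) * R := ⟨_, rfl⟩
  rw [← hR']
  have R'0 : 0 < R' := by rw [hR']; positivity
  have hsub := CC_sub (e := e) (d := 2 / k) (by positivity) hR
  have i1 : IntegrableOn (fun x => ‖fderiv ℝ (gf k e p u) x‖) (CC e (2 / k) R) :=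
    ((cdiff_contFDeriv (isOpen_Om e) (smooth_gf k G)).mono hsub).norm.integrableOn_compact (CC_compact _ _)
  set K := 2 * k * (1 + 2 * k) / R with hK
  have K0 : 0 ≤ K := by positivity
  let F : Eu n → ℝ := fun x => K * (lam * (et R' u x * Wg u x) + et R' u x * Wg u x * kp e p u x / lam)
  have i2 : IntegrableOn F (Om e) := (((int_W S R'0).const_mul lam).add ((int_E S R'0).div_const lam)).const_mul K
  have F0 : ∀ x ∈ Om e, 0 ≤ F x := fun x hx => by
    have := et_nonneg (R := R') (u := u) x
    have := kp_nonneg G hx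
    have := (Wg_pos u x).le
    simp only [F]; positivity
  calc ∫ x in CC e (2 / k) R, ‖fderiv ℝ (gf k e p u) x‖ ≤ ∫ x in CC e (2 / k) R, F x := by
        refine setIntegral_mono_on i1 (i2.mono_set hsub) (CC_compact _ _).measurableSet fun x hx => ?_
        refine (gf_fderiv_le k0 G (hsub hx)).trans ?_
        have hs : 0 < sf e x := hsub hx
        have hs2 : 2 / k * R ≤ sf e x := hx.2
        have hn : ‖x‖ ≤ 2 * R := mem_closedBall_zero_iff.1 hx.1
        by_cases hc : |tf p u x| ≤ 2 * k * sf e x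
        · rw [indicator_of_mem (by exact hc)]
          have hsn : sf e x ≤ 2 * R := by
            have := real_inner_le_norm e x
            rw [G.he, one_mul] at this
            exact this.trans hn
          have hz : zf u x ≤ R' ^ 2 := by
            have h1 : u x = ⟪p, x⟫ + qf p * tf p u x := by rw [inner_N (u := u) x]; ring
            have h2 : ‖p‖ ≤ qf p := by
              have := qf_sq p
              nlinarith [norm_nonneg p]
            have h3 : |u x| ≤ qf p * (4 * k + 2) * R := by
              rw [h1]
              refine (abs_add_le _ _).trans ?_
              rw [abs_mul, abs_of_pos hq]
              have a1 : |⟪p, x⟫| ≤ qf p * (2 * R) := (abs_real_inner_le_norm p x).trans (by gcongr)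
              have a2 : |tf p u x| ≤ 2 * k * (2 * R) := hc.trans (by gcongr)
              have a3 : qf p * |tf p u x| ≤ qf p * (2 * k * (2 * R)) := by gcongr
              linarith
            have h4 : u x ^ 2 ≤ (qf p * (4 * k + 2) * R) ^ 2 := by rw [← sq_abs]; gcongr
            have h5 : ‖x‖ ^ 2 ≤ (2 * R) ^ 2 := by gcongr
            have h6 : 0 ≤ (2 * R) * (qf p * (4 * k + 2) * R) := by positivity
            rw [zf, hR']
            nlinarith
          have he1 := et_ge_one R'0 hz
          have k1 := kp_nonneg G (hsub hx)
          have hW := (Wg_pos u x).le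
          have hsq : √(kp e p u x) ≤ lam + kp e p u x / lam := by
            have a1 := Real.sq_sqrt k1
            set q := √(kp e p u x)
            rw [← a1]
            have : 0 ≤ (q / 2 - lam) ^ 2 / lam + 3 / 4 * (q ^ 2 / lam) := by positivity
            have h2 : (q / 2 - lam) ^ 2 / lam + 3 / 4 * (q ^ 2 / lam) = q ^ 2 / lam - q + lam := by field_simp; ring
            linarith
          have hsK : 4 * (1 + 2 * k) / sf e x ≤ K := by
            rw [hK, div_le_div_iff₀ hs hR]
            have : 2 * R ≤ k * sf e x := by
              rw [div_mul_eq_mul_div, div_le_iff₀ k0] at hs2; linarith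
            nlinarith
          calc 4 * (1 + 2 * k) / sf e x * (Wg u x * √(kp e p u x)) ≤ K * (Wg u x * (lam + kp e p u x / lam)) := by gcongr
            _ ≤ K * (et R' u x * (Wg u x * (lam + kp e p u x / lam))) := by
                exact mul_le_mul_of_nonneg_left (le_mul_of_one_le_left (by positivity) he1) K0
            _ = F x := by simp only [F]; ring
        · rw [indicator_of_notMem (by exact hc)]
          exact F0 x (hsub hx)
    _ ≤ ∫ x in Om e, F x := setIntegral_mono_set i2 ((ae_restrict_mem mO).mono F0) (ae_of_all _ hsub)
    _ = _ := by
        simp only [F]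
        rw [integral_const_mul, integral_add ((int_W S R'0).const_mul lam) ((int_E S R'0).div_const lam),
          integral_const_mul, integral_div]
        rfl

lemma core (S : Sol e p u) (hR : 0 < R) {k lam : ℝ} (hk : 2 ≤ k) (hl : 0 < lam) :
    II e u R ≤ (AA e p 1 0 + 64 * qf p * volume.real (St e (2 / k) 1)) * R ^ n + 256 * qf p * k * (1 + 2 * k) * 2 ^ n *
      (lam * II e u ((2 + qf p * (4 * k + 2)) * R) + EE e p u ((2 + qf p * (4 * k + 2)) * R) / lam) := by
  have G := S.toGeo
  have k0 : 0 < k := by linarith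
  have hq := qf_pos p
  have mO := (isOpen_Om e).measurableSet
  have hsub := CC_sub (e := e) (d := 2 / k) (by positivity) hR
  have hgr := grad_int S hR hk hl
  set X := (lam * II e u ((2 + qf p * (4 * k + 2)) * R) + EE e p u ((2 + qf p * (4 * k + 2)) * R) / lam) with hX
  obtain ⟨y, hy, hpo⟩ := poinc (isOpen_Om e) (smooth_gf k G) (CC_convex (2 / k) R) (CC_compact _ _) hsub
    (D := 4 * R) (by positivity) (fun x hx y hy => by
      have h1 := mem_closedBall_zero_iff.1 hx.1
      have h2 := mem_closedBall_zero_iff.1 hy.1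
      refine (norm_sub_le _ _).trans (by linarith)) (CC_vol G.he (by rw [div_le_one k0]; exact hk) hR)
  have mC := (CC_compact (e := e) (2 / k) R).measurableSet
  have mS := St_meas (e := e) (2 / k) R
  have hA := hpo.trans (mul_le_mul_of_nonneg_left hgr (by positivity))
  have iA : IntegrableOn (fun x => |gf k e p u x - gf k e p u y|) (CC e (2 / k) R) :=
    (((smooth_gf k G).continuousOn.mono hsub).sub continuousOn_const).abs.integrableOn_compact (CC_compact _ _)
  let c := cl k (sl e p u y)
  have hc : |c| ≤ k := cl_abs_le k0.le _
  let L1 := (St e (2 / k) R).indicator fun _ => 16 * qf p / R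
  let L2 := (CC e (2 / k) R).indicator fun x => 8 * qf p / R * |gf k e p u x - gf k e p u y|
  have j1 : Integrable L1 := IntegrableOn.integrable_indicator (integrableOn_const (St_fin _ _)) mS
  have j2 : Integrable L2 := IntegrableOn.integrable_indicator (iA.const_mul _) mC
  have hU := (U_le S hR c (Lb := fun x => L1 x + L2 x) (j1.add j2).integrableOn (fun x hx => by
    have hs : 0 < sf e x := hx
    have n1 : 0 ≤ L1 x := indicator_nonneg (fun _ _ => by positivity) x
    have n2 : 0 ≤ L2 x := indicator_nonneg (fun _ _ => by positivity) x
    by_cases hb : 2 * R < ‖x‖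
    · rw [len_zero hR hb]; positivity
    push Not at hb
    by_cases hd : sf e x < 2 / k * R
    · have e1 : L1 x = 16 * qf p / R := indicator_of_mem (by exact ⟨mem_closedBall_zero_iff.2 hb, hs, hd⟩) _
      have h1 := len_crude G hR hx (c := c) (by
        rw [abs_mul, abs_of_pos hs]
        calc |c| * sf e x ≤ k * (2 / k * R) := by gcongr
          _ = 2 * R := by field_simp)
      linarith
    · push Not at hd
      have e2 : L2 x = 8 * qf p / R * |gf k e p u x - gf k e p u y| :=
        indicator_of_mem (by exact ⟨mem_closedBall_zero_iff.2 hb, hd⟩) _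
      have h1 := len_le G hR hx (c := c) (k := k * sf e x) (by
        rw [div_mul_eq_mul_div, div_le_iff₀ k0] at hd; linarith) (by
        rw [abs_mul, abs_of_pos hs]; gcongr)
      have h2 : cl (k * sf e x) (tf p u x) = sf e x * cl k (sl e p u x) := by
        rw [← cl_scale hs, sl, div_mul_cancel₀ _ hs.ne']
      have h3 : |cl (k * sf e x) (tf p u x) - c * sf e x| ≤ 2 * R * |gf k e p u x - gf k e p u y| := by
        rw [h2, show sf e x * cl k (sl e p u x) - c * sf e x = sf e x * (cl k (sl e p u x) - cl k (sl e p u y)) by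
          simp only [c]; ring, abs_mul, abs_of_pos hs]
        have hsn : sf e x ≤ 2 * R := by
          have := real_inner_le_norm e x
          rw [G.he, one_mul] at this
          exact this.trans hb
        have := cl_le_zt k0 (sl e p u x) (sl e p u y)
        exact mul_le_mul hsn this (abs_nonneg _) (by positivity)
      have h4 : 4 / R ^ 2 * (qf p * |cl (k * sf e x) (tf p u x) - c * sf e x|) ≤
          4 / R ^ 2 * (qf p * (2 * R * |gf k e p u x - gf k e p u y|)) := by gcongr
      have h5 : 4 / R ^ 2 * (qf p * (2 * R * |gf k e p u x - gf k e p u y|)) = L2 x := by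
        rw [e2]; field_simp; ring
      linarith)).2
  have hI : ∫ x in Om e, L1 x + L2 x = 16 * qf p / R * volume.real (St e (2 / k) R) +
      8 * qf p / R * ∫ x in CC e (2 / k) R, |gf k e p u x - gf k e p u y| := by
    rw [integral_add j1.integrableOn j2.integrableOn]
    congr 1
    · rw [setIntegral_indicator mS, inter_eq_right.2 (fun x hx => hx.2.1), setIntegral_const, smul_eq_mul, mul_comm]
    · rw [setIntegral_indicator mC, inter_eq_right.2 hsub, integral_const_mul]
  rw [hI, St_scale hR] at hU
  have hAA : (∫ x in Om e, et R (uc e p c) x * Wg (uc e p c) x) = AA e p 1 0 * R ^ n := by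
    rw [← AA_scale hR, ← AA_indep S hR c]; rfl
  rw [hAA] at hU
  change II e u R ≤ _ at hU
  refine hU.trans ?_
  have h9 : 4 * R * (8 * qf p / R * ∫ x in CC e (2 / k) R, |gf k e p u x - gf k e p u y|) ≤
      4 * R * (8 * qf p / R * (4 * R * 2 ^ n * (2 * k * (1 + 2 * k) / R * X))) := by gcongr
  have h10 : 4 * R * (8 * qf p / R * (4 * R * 2 ^ n * (2 * k * (1 + 2 * k) / R * X))) =
      256 * qf p * k * (1 + 2 * k) * 2 ^ n * X := by field_simp; ring
  have h11 : 4 * R * (16 * qf p / R * (volume.real (St e (2 / k) 1) * R ^ n)) =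
      64 * qf p * volume.real (St e (2 / k) 1) * R ^ n := by field_simp; ring
  linarith

lemma al_le (S : Sol e p u) {R : ℝ} (hR : 0 < R) : al e u R ≤ AA e p 1 0 := by
  have hq := qf_pos p
  obtain ⟨C, hC, hCb⟩ := al_bdd S
  obtain ⟨Rj, hRj, hE⟩ := good_scales S
  refine le_of_forall_pos_le_add fun η hη => ?_
  have h1 := (St_lim e).const_mul (64 * qf p)
  rw [mul_zero] at h1
  obtain ⟨i, hi⟩ := (h1.eventually_lt_const (show (0:ℝ) < η / 3 by positivity)).exists
  obtain ⟨k, hk⟩ : ∃ k : ℝ, k = (i:ℝ) + 2 := ⟨_, rfl⟩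
  rw [← hk] at hi
  have k2 : 2 ≤ k := by rw [hk]; linarith [(Nat.cast_nonneg i : (0:ℝ) ≤ i)]
  obtain ⟨M, hM⟩ : ∃ M : ℝ, M = 2 + qf p * (4 * k + 2) := ⟨_, rfl⟩
  have M0 : 0 < M := by rw [hM]; positivity
  obtain ⟨K, hK⟩ : ∃ K : ℝ, K = 256 * qf p * k * (1 + 2 * k) * 2 ^ n := ⟨_, rfl⟩
  have K0 : 0 < K := by rw [hK]; positivity
  obtain ⟨lam, hlam⟩ : ∃ lam : ℝ, lam = η / (3 * (K * C * M ^ n)) := ⟨_, rfl⟩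
  have lam0 : 0 < lam := by rw [hlam]; positivity
  have h2 := hE.const_mul (K * M ^ n / lam)
  rw [mul_zero] at h2
  have h3 : Tendsto (fun j : ℕ => (2:ℝ) ^ j) atTop atTop := tendsto_pow_atTop_atTop_of_one_lt (by norm_num)
  obtain ⟨j, hj1, hj2⟩ := ((h2.eventually_lt_const (show (0:ℝ) < η / 3 by positivity)).and
    (h3.eventually_ge_atTop (M * R))).exists
  have hjR := hj2.trans (hRj j)
  set T := Rj j with hT
  have T0 : 0 < T := (by positivity : 0 < M * R).trans_le hjR
  obtain ⟨R1, hR1⟩ : ∃ R1 : ℝ, R1 = T / M := ⟨_, rfl⟩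
  have R10 : 0 < R1 := by rw [hR1]; positivity
  have hTM : T = M * R1 := by rw [hR1]; field_simp
  have hRR : R ≤ R1 := by rw [hR1, le_div_iff₀ M0]; linarith
  refine (al_mono S hR R10 hRR).trans ?_
  have hc := core S R10 k2 lam0
  rw [← hM, ← hK, ← hTM] at hc
  rw [al, div_le_iff₀ (by positivity)]
  refine hc.trans ?_
  have b1 : lam * II e u T ≤ lam * (C * T ^ n) := by gcongr; exact hCb T T0
  have b2 : K * (lam * (C * T ^ n)) = η / 3 * R1 ^ n := by
    rw [hlam, hTM, mul_pow]; field_simp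
  have b3 : K * (EE e p u T / lam) ≤ η / 3 * R1 ^ n := by
    have : K * (EE e p u T / lam) = (K * M ^ n / lam * (EE e p u T / T ^ n)) * R1 ^ n := by
      rw [hTM, mul_pow]; field_simp
    rw [this]; gcongr
  have b4 : K * (lam * II e u T) ≤ η / 3 * R1 ^ n := by
    rw [← b2]; gcongr
  have b5 : 64 * qf p * volume.real (St e (2 / k) 1) * R1 ^ n ≤ η / 3 * R1 ^ n := by gcongr
  linarith
end Bern

namespace Bern
open Filter Topology InnerProductSpace
variable {n : ℕ} {e p : Eu n} {u : Eu n → ℝ} {c l ε R : ℝ}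

lemma nT_one (S : Sol e p u) {x : Eu n} (hx : x ∈ Om e) : nT e p u x = 1 := by
  have G := S.toGeo
  have mO := (isOpen_Om e).measurableSet
  obtain ⟨R, hR⟩ : ∃ R : ℝ, R = zf u x + 1 := ⟨_, rfl⟩
  have z0 := zf_nonneg (u := u) x
  have R0 : 0 < R := by rw [hR]; linarith
  have hzR : zf u x ≤ R ^ 2 := by rw [hR]; nlinarith
  have h1 := al_le S R0
  rw [al, div_le_iff₀ (by positivity), ← AA_scale R0, ← flux S R0 0] at h1
  have i1 := int_W S R0
  have i2 := int_Wg S R0 (cont_nT G) (fun x hx => abs_nT_le G hx)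
  let F : Eu n → ℝ := fun x => et R u x * Wg u x - et R u x * Wg u x * nT e p u x
  have F0 : ∀ x ∈ Om e, 0 ≤ F x := fun x hx => by
    have a1 := et_nonneg (R := R) (u := u) x
    have a2 := (Wg_pos u x).le
    have a3 := (abs_le.1 (abs_nT_le G hx)).2
    have : F x = et R u x * Wg u x * (1 - nT e p u x) := by simp only [F]; ring
    rw [this]
    exact mul_nonneg (mul_nonneg a1 a2) (by linarith)
  have hF : ∫ x in Om e, F x = 0 := by
    refine le_antisymm ?_ (setIntegral_nonneg mO F0)
    simp only [F]
    rw [integral_sub i1 i2]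
    change II e u R - _ ≤ 0
    linarith
  have hae := (setIntegral_eq_zero_iff_of_nonneg_ae ((ae_restrict_mem mO).mono F0) (i1.sub i2)).1 hF
  have ce : ContinuousOn (et R u) (Om e) := (smooth_et G).continuousOn
  have cW : ContinuousOn (Wg u) (Om e) := cont_Wg (isOpen_Om e) G.C1
  have cF : ContinuousOn F (Om e) := (ce.mul cW).sub ((ce.mul cW).mul (cont_nT G))
  have hz := Measure.eqOn_open_of_ae_eq hae (isOpen_Om e) cF continuousOn_const hx
  have b1 := et_ge_one R0 hzR
  have b2 := Wg_pos u x
  have b3 : et R u x * Wg u x * (1 - nT e p u x) = 0 := by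
    have : F x = 0 := hz
    simp only [F] at this
    linarith
  rcases mul_eq_zero.1 b3 with h | h
  · have : 0 < et R u x * Wg u x := by positivity
    linarith
  · linarith

lemma Sol_affine (S : Sol e p u) : ∃ a : ℝ, ∀ x, 0 ≤ ⟪e, x⟫ → u x = ⟪p, x⟫ + a * ⟪e, x⟫ := by
  have G := S.toGeo
  have hconv : Convex ℝ (Om e) := convex_halfSpace_gt (innerSL ℝ e).toLinearMap.isLinear _
  have hV : ∀ x ∈ Om e, Vv e p u x = 0 := fun x hx => by
    have h := Vv_le G hx
    have hk : kp e p u x = 0 := by rw [kp, nT_one S hx]; norm_num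
    rw [hk, Real.sqrt_zero, mul_zero] at h
    exact norm_le_zero_iff.1 h
  obtain ⟨a, ha⟩ := (isOpen_Om e).exists_is_const_of_fderiv_eq_zero hconv.isPreconnected
    ((smooth_sl G).differentiableOn (by norm_num)) (fun x hx => by
      rw [(hasFDerivAt_sl G hx).fderiv, hV x hx]; simp)
  refine ⟨qf p * a, fun x hx => ?_⟩
  rcases hx.eq_or_lt with h | h
  · rw [G.bd x h.symm, ← h]; simp
  · have h1 := ha x h
    have h2 : tf p u x = a * ⟪e, x⟫ := by
      rw [← h1, sl, sf, div_mul_cancel₀ _ h.ne']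
    rw [inner_N (u := u) x, h2]; ring

lemma mse_translate {Ω Ω' : Set (Eu n)} {u : Eu n → ℝ} (h : MinimalSurfaceEq u Ω) (x0 : Eu n) (d : ℝ)
    (hO : ∀ x ∈ Ω', x + x0 ∈ Ω) : MinimalSurfaceEq (fun x => u (x + x0) - d) Ω' := by
  have h1 : ∀ (f : Eu n → ℝ) (i : Fin n) (x : Eu n), pderiv' (fun y => f (y + x0)) i x = pderiv' f i (x + x0) := by
    intro f i x
    simp only [pderiv', fderiv_comp_add_right]
  have h2 : ∀ (i : Fin n) (x : Eu n), pderiv' (fun x => u (x + x0) - d) i x = pderiv' u i (x + x0) := by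
    intro i x
    rw [← h1 u]
    simp only [pderiv', fderiv_sub_const]
  intro x hx
  have h3 := h _ (hO x hx)
  simp only [h2, gradSq]
  rw [← h3]
  refine Finset.sum_congr rfl fun i _ => ?_
  exact h1 (fun y => pderiv' u i y / Real.sqrt (1 + gradSq u y)) i x

lemma inner_eq_sum (a x : Eu n) : ⟪a, x⟫ = ∑ i, a i * x i := by
  simp [PiLp.inner_apply, mul_comm]

end Bern

open Bern in
theorem bernstein_halfspace
    (n : ℕ) (hn : 1 ≤ n)
    (v : EuclideanSpace ℝ (Fin n)) (hv : v ≠ 0) (c : ℝ)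
    (Ω : Set (EuclideanSpace ℝ (Fin n)))
    (hΩ : Ω = {x | c < ∑ i, v i * x i})
    (u : EuclideanSpace ℝ (Fin n) → ℝ)
    (hu2 : ContDiffOn ℝ 2 u Ω) (hu0 : ContinuousOn u (closure Ω))
    (hmse : MinimalSurfaceEq u Ω)
    (w : EuclideanSpace ℝ (Fin n)) (b : ℝ)
    (hbdry : ∀ x : EuclideanSpace ℝ (Fin n), (∑ i, v i * x i) = c →
      u x = ∑ i, w i * x i + b) :
    ∃ a : ℝ, ∀ x ∈ closure Ω,
      u x = (∑ i, w i * x i + b) + a * ((∑ i, v i * x i) - c) := by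
  simp only [← inner_eq_sum] at *
  have hv0 : 0 < ‖v‖ := norm_pos_iff.2 hv
  obtain ⟨e, he⟩ : ∃ e : Eu n, e = ‖v‖⁻¹ • v := ⟨_, rfl⟩
  have hve : v = ‖v‖ • e := by rw [he, smul_smul, mul_inv_cancel₀ hv0.ne', one_smul]
  have he1 : ‖e‖ = 1 := by rw [he, norm_smul, norm_inv, norm_norm, inv_mul_cancel₀ hv0.ne']
  have hee : ⟪e, e⟫ = (1:ℝ) := by rw [real_inner_self_eq_norm_sq, he1]; norm_num
  obtain ⟨x0, hx0⟩ : ∃ x0 : Eu n, x0 = (c / ‖v‖) • e := ⟨_, rfl⟩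
  have hin : ∀ x : Eu n, ⟪v, x + x0⟫ = ‖v‖ * ⟪e, x⟫ + c := by
    intro x
    conv_lhs => rw [hve]
    rw [real_inner_smul_left, inner_add_right, hx0, real_inner_smul_right, hee]
    field_simp
  have hcl1 : closure Ω ⊆ {x | c ≤ ⟪v, x⟫} := by
    refine closure_minimal ?_ (isClosed_le (by fun_prop) (by fun_prop))
    rw [hΩ]; intro x hx; exact le_of_lt (show c < ⟪v, x⟫ from hx)
  have hcl2 : {x | c ≤ ⟪v, x⟫} ⊆ closure Ω := by
    intro x hx
    rw [Metric.mem_closure_iff]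
    intro ε hε
    refine ⟨x + (ε / 2) • e, ?_, ?_⟩
    · rw [hΩ]
      have h1 : ⟪v, e⟫ = ‖v‖ := by
        conv_lhs => rw [hve]
        rw [real_inner_smul_left, hee, mul_one]
      have hx' : c ≤ ⟪v, x⟫ := hx
      have : 0 < ε / 2 * ‖v‖ := by positivity
      simp only [mem_setOf_eq, inner_add_right, real_inner_smul_right, h1]
      linarith
    · rw [dist_self_add_right, norm_smul, he1, Real.norm_eq_abs, abs_of_pos (by positivity)]
      linarith
  obtain ⟨p, hp⟩ : ∃ p : Eu n, p = w - ⟪w, e⟫ • e := ⟨_, rfl⟩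
  have hpw : ∀ x, ⟪p, x⟫ = ⟪w, x⟫ - ⟪w, e⟫ * ⟪e, x⟫ := by
    intro x; rw [hp, inner_sub_left, real_inner_smul_left]
  obtain ⟨d, hd⟩ : ∃ d : ℝ, d = ⟪w, x0⟫ + b := ⟨_, rfl⟩
  have hmap : ∀ x ∈ Om e, x + x0 ∈ Ω := by
    intro x hx
    have hx' : 0 < ⟪e, x⟫ := hx
    rw [hΩ]
    simp only [mem_setOf_eq, hin]
    have : 0 < ‖v‖ * ⟪e, x⟫ := by positivity
    linarith
  have C2 : ContDiffOn ℝ 2 (fun x => u (x + x0) - d) (Om e) :=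
    (hu2.comp (g := u) (f := fun x => x + x0) (by fun_prop) hmap).sub contDiffOn_const
  have S : Sol e p (fun x => u (x + x0) - d) :=
    { he := he1
      hep := by rw [real_inner_comm, hpw, hee]; ring
      C1 := C2.of_le (by norm_num)
      cont := by
        refine ContinuousOn.sub (hu0.comp (f := fun x => x + x0) (by fun_prop) fun x hx => hcl2 ?_) continuousOn_const
        have hx' : 0 ≤ ⟪e, x⟫ := hx
        simp only [mem_setOf_eq, hin]
        have : 0 ≤ ‖v‖ * ⟪e, x⟫ := by positivity
        linarith
      bd := by
        intro x hx
        rw [hbdry _ (by rw [hin, hx]; ring), hpw, hx, hd, inner_add_right]; ring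
      C2 := C2
      df := divFree_of_mse (mse_translate hmse x0 d hmap) }
  obtain ⟨a, ha⟩ := Sol_affine S
  refine ⟨(a - ⟪w, e⟫) / ‖v‖, fun y hy => ?_⟩
  have h1 := hin (y - x0)
  rw [sub_add_cancel] at h1
  have hy' : c ≤ ⟪v, y⟫ := hcl1 hy
  have h2 : ⟪e, y - x0⟫ = (⟪v, y⟫ - c) / ‖v‖ := by rw [h1]; field_simp; ring
  have h3 := ha (y - x0) (by rw [h2]; exact div_nonneg (by linarith) hv0.le)
  simp only [sub_add_cancel] at h3
  rw [hpw, h2, hd, inner_sub_right] at h3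
  have h4 : (a - ⟪w, e⟫) / ‖v‖ * (⟪v, y⟫ - c) = (a - ⟪w, e⟫) * ((⟪v, y⟫ - c) / ‖v‖) := by ring
  rw [h4]
  linarith
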